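/- arXiv:2012.08211 — 2 statements merged into one kernel-verified Lean document; each statement's English description precedes it below -/
import Mathlib

section
/- For every integer d ≥ 1 there exists a constant C_d > 0, depending only on d, such that for every prime p > d, every polynomial f ∈ ℤ[X] of degree d, and every integer m ≥ 1, one has max(1, J_{p^{-m}f}) · |S_m(f)| ≤ C_d (equivalently, |S_m(f)| ≤ C_d · min(1, J_{p^{-m}f}^{-1}), with the convention min(1, J^{-1}) = 1/max(1, J)). -/
open Polynomial

/-- `J_P(z) = max_{2 ≤ k ≤ deg P} |P^{(k)}(z)/k!|^{1/k}` (empty max = 0). -/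
noncomputable def Jfun {p : ℕ} [Fact p.Prime] (P : Polynomial ℚ_[p]) (z : ℤ_[p]) : NNReal :=
  (Finset.Icc 2 P.natDegree).sup fun k =>
    ‖(derivative^[k] P).eval (z : ℚ_[p]) / (k.factorial : ℚ_[p])‖₊ ^ ((1 : ℝ) / (k : ℝ))

/-- `J_P = inf_{z ∈ ℤ_p} J_P(z)`. -/
noncomputable def Jinf {p : ℕ} [Fact p.Prime] (P : Polynomial ℚ_[p]) : NNReal :=
  ⨅ z : ℤ_[p], Jfun P z

/-- The normalized complete exponential sum `S_m(f) = p^{-m} ∑_{x=0}^{p^m-1} e^{2πi f(x)/p^m}`. -/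
noncomputable def expSum (p m : ℕ) (f : Polynomial ℤ) : ℂ :=
  ((p : ℂ) ^ m)⁻¹ * ∑ x ∈ Finset.range (p ^ m),
    Complex.exp (2 * (Real.pi : ℂ) * Complex.I * ((f.eval (x : ℤ) : ℤ) : ℂ) / (p : ℂ) ^ m)

/-- The polynomial `p^{-m} f` regarded as an element of `ℚ_p[X]`. -/
noncomputable def padicScaled (p : ℕ) [Fact p.Prime] (m : ℕ) (f : Polynomial ℤ) :
    Polynomial ℚ_[p] :=
  Polynomial.C (((p : ℚ_[p]) ^ m)⁻¹) * f.map (Int.castRingHom ℚ_[p])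

section Stepanov

variable {K : Type*} [Field K]

/-- The coefficient of `Z ^ l` of `B ∈ K[X][Z]` has `X`-degree at most `D + s * l`. -/
def SlopeLE (s D : ℕ) (B : K[X][X]) : Prop := ∀ l, (B.coeff l).natDegree ≤ D + s * l

namespace SlopeLE

variable {s D E : ℕ} {A B : K[X][X]}

lemma mono (h : SlopeLE s D B) (hDE : D ≤ E) : SlopeLE s E B := fun l => (h l).trans (by gcongr)

lemma add (hA : SlopeLE s D A) (hB : SlopeLE s D B) : SlopeLE s D (A + B) := fun l => by
  rw [coeff_add]
  exact natDegree_add_le_of_degree_le (hA l) (hB l)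

lemma sum {ι : Type*} (t : Finset ι) {f : ι → K[X][X]} (h : ∀ i ∈ t, SlopeLE s D (f i)) :
    SlopeLE s D (∑ i ∈ t, f i) := fun l => by
  rw [finsetSum_coeff]
  exact natDegree_sum_le_of_forall_le _ _ fun i hi => h i hi l

lemma mul (hA : SlopeLE s D A) (hB : SlopeLE s E B) : SlopeLE s (D + E) (A * B) := fun l => by
  rw [coeff_mul]
  refine natDegree_sum_le_of_forall_le _ _ fun ij hij => ?_
  have h := Finset.HasAntidiagonal.mem_antidiagonal.1 hij
  calc _ ≤ _ := natDegree_mul_le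
    _ ≤ (D + s * ij.1) + (E + s * ij.2) := add_le_add (hA _) (hB _)
    _ = D + E + s * l := by rw [← h]; ring

lemma const {f : K[X]} (hf : f.natDegree ≤ D) : SlopeLE s D (C f) := fun l => by
  rw [coeff_C]
  split_ifs
  · omega
  · simp

lemma pow (hA : SlopeLE s D A) (n : ℕ) : SlopeLE s (n * D) (A ^ n) := by
  induction n with
  | zero => simpa using const (D := 0) (f := (1 : K[X])) (by simp)
  | succ n ih => rw [pow_succ, Nat.succ_mul]; exact ih.mul hA

end SlopeLE

/-- The substitution `f(X) ↦ f(X + Z)`, with values in `K[X][Z]`. -/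
noncomputable def shiftHom (K : Type*) [Field K] : K[X] →ₐ[K] K[X][X] := aeval (X + C X)

lemma shiftHom_coeff (f : K[X]) (l : ℕ) : ((shiftHom K) f).coeff l = hasseDeriv l f := by
  have h1 : (shiftHom K) f = taylor X (f.map C) := by
    rw [shiftHom, taylor_apply, aeval_def, comp, eval₂_map]
    rfl
  have h2 : hasseDeriv l (f.map C) = (hasseDeriv l f).map C := by
    ext n
    simp [hasseDeriv_coeff]
  rw [h1, taylor_coeff, h2, eval_map, eval₂_C_X]

lemma slopeLE_shiftHom (s : ℕ) (f : K[X]) : SlopeLE s f.natDegree ((shiftHom K) f) := fun l => by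
  rw [shiftHom_coeff]
  exact (natDegree_hasseDeriv_le f l).trans (by omega)

lemma slopeLE_shiftHom_sub (g : K[X]) :
    SlopeLE g.natDegree 0 ((shiftHom K) g - C g) := fun l => by
  rw [coeff_sub, shiftHom_coeff, coeff_C]
  rcases Nat.eq_zero_or_pos l with rfl | hl
  · simp
  · rw [if_neg (by omega), sub_zero]
    refine (natDegree_hasseDeriv_le g l).trans ?_
    have : g.natDegree * 1 ≤ g.natDegree * l := Nat.mul_le_mul_left _ hl
    omega

lemma finset_sum_comp_eq {ι : Type*} (t : Finset ι) (f : ι → K[X]) (h : K[X]) :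
    (∑ i ∈ t, f i).comp h = ∑ i ∈ t, (f i).comp h :=
  map_sum (compRingHom h) f t

lemma map_evalRingHom_shiftHom (x : K) (f : K[X]) :
    ((shiftHom K) f).map (evalRingHom x) = f.comp (X + C x) := by
  rw [shiftHom, aeval_def, ← coe_mapRingHom, hom_eval₂, comp]
  congr 1
  · ext
    simp
  · simp

variable (p : ℕ)

/-- The trace polynomial `g + g ^ p + ⋯ + g ^ (p ^ (k - 1))`. -/
noncomputable def tracePoly (k : ℕ) (g : K[X]) : K[X] := ∑ i ∈ Finset.range k, g ^ p ^ i

/-- The increment of the trace polynomial, modulo `p ^ k`-th powers. -/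
noncomputable def traceIncr (k : ℕ) (g : K[X]) : K[X][X] :=
  ∑ i ∈ Finset.range k, ((shiftHom K) g - C g) ^ p ^ i

lemma slopeLE_traceIncr (k : ℕ) (g : K[X]) : SlopeLE g.natDegree 0 (traceIncr p k g) :=
  SlopeLE.sum _ fun i _ => by simpa using (slopeLE_shiftHom_sub g).pow (p ^ i)

/-- The expansion of `auxPoly` at a generic point `X` with `X ^ (p ^ k) = X` and trace `c`. -/
noncomputable def localExpansion (k I A : ℕ) (g : K[X]) (c : K) (r : Fin I × Fin p → degreeLT K A) :
    K[X][X] :=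
  ∑ ij, (shiftHom K) (r ij : K[X]) * C X ^ (ij.1 : ℕ) *
    (C (C c) + traceIncr p k g) ^ (ij.2 : ℕ)

lemma slopeLE_localExpansion (k I A : ℕ) (g : K[X]) (c : K) (r : Fin I × Fin p → degreeLT K A) :
    SlopeLE g.natDegree (A + I) (localExpansion p k I A g c r) := by
  refine SlopeLE.sum _ fun ij _ => ?_
  have h1 : SlopeLE g.natDegree A ((shiftHom K) (r ij : K[X])) := by
    refine (slopeLE_shiftHom _ _).mono ?_
    rcases eq_or_ne (r ij : K[X]) 0 with h0 | h0
    · simp [h0]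
    · exact ((natDegree_lt_iff_degree_lt h0).2 (mem_degreeLT.1 (r ij).2)).le
  have h2 : SlopeLE g.natDegree (ij.1 * 1) (C X ^ (ij.1 : ℕ) : K[X][X]) :=
    (SlopeLE.const natDegree_X_le).pow _
  have h3 : SlopeLE g.natDegree (ij.2 * 0) ((C (C c) + traceIncr p k g) ^ (ij.2 : ℕ)) :=
    ((SlopeLE.const (by simp)).add (slopeLE_traceIncr p k g)).pow _
  refine ((h1.mul h2).mul h3).mono ?_
  have := ij.1.2
  omega

lemma exists_localExpansion_coeff_eq_zero (k I A M : ℕ) (g : K[X]) (hg : 0 < g.natDegree) (c : K)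
    (h : M * (A + I + g.natDegree * M) < I * p * A) :
    ∃ r : Fin I × Fin p → degreeLT K A, r ≠ 0 ∧
      ∀ l < M, (localExpansion p k I A g c r).coeff l = 0 := by
  set D := A + I + g.natDegree * M with hD
  let Φ : (Fin I × Fin p → degreeLT K A) →ₗ[K] (Fin M × Fin D → K) :=
    { toFun := fun r ln => ((localExpansion p k I A g c r).coeff ln.1).coeff ln.2
      map_add' := fun r r' => by
        funext ln
        simp [localExpansion, add_mul, Finset.sum_add_distrib]
      map_smul' := fun a r => by
        funext ln
        have : localExpansion p k I A g c (a • r) = a • localExpansion p k I A g c r := by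
          simp [localExpansion, Finset.smul_sum]
        simp [this] }
  have : FiniteDimensional K (degreeLT K A) := (degreeLTEquiv K A).symm.finiteDimensional
  have hfin : Module.finrank K (degreeLT K A) = A := by
    rw [(degreeLTEquiv K A).finrank_eq, Module.finrank_fin_fun]
  have hlt : Module.finrank K (Fin M × Fin D → K) <
      Module.finrank K (Fin I × Fin p → degreeLT K A) := by
    rw [Module.finrank_fintype_fun_eq_card, Module.finrank_pi_fintype]
    simpa [hfin] using h
  obtain ⟨r, hr, hr0⟩ := (Submodule.ne_bot_iff _).1 (Φ.ker_ne_bot_of_finrank_lt hlt)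
  refine ⟨r, hr0, fun l hl => ?_⟩
  ext n
  rw [coeff_zero]
  by_cases hn : n < D
  · exact congrFun (LinearMap.mem_ker.1 hr) (⟨l, hl⟩, ⟨n, hn⟩)
  · refine coeff_eq_zero_of_natDegree_lt ((slopeLE_localExpansion p k I A g c r l).trans_lt ?_)
    have := (Nat.mul_lt_mul_left hg).2 hl
    omega

variable [hp : Fact p.Prime]

lemma natDegree_tracePoly (k : ℕ) (g : K[X]) (hg : 0 < g.natDegree) :
    (tracePoly p (k + 1) g).natDegree = g.natDegree * p ^ k := by
  have h1 : ∀ k, (tracePoly p k g).natDegree < g.natDegree * p ^ k := by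
    intro k
    refine (natDegree_sum_le_of_forall_le (n := g.natDegree * p ^ k - 1) _ _ fun i hi => ?_).trans_lt
      (Nat.sub_lt (Nat.mul_pos hg (pow_pos hp.out.pos _)) one_pos)
    rw [natDegree_pow, mul_comm]
    have h2 : p ^ i < p ^ k := Nat.pow_lt_pow_right hp.out.one_lt (Finset.mem_range.1 hi)
    exact Nat.le_sub_one_of_lt ((Nat.mul_lt_mul_left hg).2 h2)
  rw [tracePoly, Finset.sum_range_succ, natDegree_add_eq_right_of_natDegree_lt, natDegree_pow,
    mul_comm]
  rw [natDegree_pow, mul_comm (p ^ k)]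
  exact h1 k

/-- The auxiliary polynomial of Stepanov's method. -/
noncomputable def auxPoly (k I A : ℕ) (g : K[X]) (r : Fin I × Fin p → degreeLT K A) : K[X] :=
  ∑ ij, (r ij : K[X]) * (X ^ (p ^ k)) ^ (ij.1 : ℕ) * tracePoly p k g ^ (ij.2 : ℕ)

lemma auxPoly_ne_zero (k I : ℕ) (g : K[X]) (hg : 0 < g.natDegree) (hgp : g.natDegree < p)
    (r : Fin I × Fin p → degreeLT K (p ^ k)) (hr : r ≠ 0) :
    auxPoly p (k + 1) I (p ^ k) g r ≠ 0 := by
  classical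
  intro h
  have hT := natDegree_tracePoly p k g hg
  set T := tracePoly p (k + 1) g with hTdef
  have hT0 : T ≠ 0 := by
    rintro h0
    rw [h0, natDegree_zero] at hT
    exact (Nat.mul_pos hg (pow_pos hp.out.pos k)).ne hT
  have hdeg : ∀ ij, (r ij : K[X]) ≠ 0 →
      (((r ij : K[X]) * (X ^ (p ^ (k + 1))) ^ (ij.1 : ℕ) * T ^ (ij.2 : ℕ)).natDegree =
        (r ij : K[X]).natDegree + p ^ k * (p * ij.1 + g.natDegree * ij.2)) := by
    intro ij h0
    rw [natDegree_mul (by simp [h0]) (by simp [hT0]), natDegree_mul h0 (by simp), natDegree_pow,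
      natDegree_X_pow, natDegree_pow, hT]
    ring
  have hlt : ∀ ij, (r ij : K[X]) ≠ 0 → (r ij : K[X]).natDegree < p ^ k := fun ij h0 =>
    (natDegree_lt_iff_degree_lt h0).2 (mem_degreeLT.1 (r ij).2)
  have key := degree_sum_eq_of_disjoint
    (fun ij => (r ij : K[X]) * (X ^ (p ^ (k + 1))) ^ (ij.1 : ℕ) * T ^ (ij.2 : ℕ)) Finset.univ ?_
  · change degree (auxPoly p (k + 1) I (p ^ k) g r) = _ at key
    rw [h, degree_zero] at key
    apply hr
    funext ij
    have := (Finset.sup_eq_bot_iff _ _).1 key.symm ij (Finset.mem_univ _)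
    rw [degree_eq_bot] at this
    simpa [hT0] using this
  · rintro ij ⟨-, h1⟩ ij' ⟨-, h2⟩ hne heq
    apply hne
    have h1' : (r ij : K[X]) ≠ 0 := fun h => h1 (by simp [h])
    have h2' : (r ij' : K[X]) ≠ 0 := fun h => h2 (by simp [h])
    have heq' := natDegree_eq_of_degree_eq heq
    rw [hdeg _ h1', hdeg _ h2'] at heq'
    have hdiv := congrArg (· / p ^ k) heq'
    simp only [Nat.add_mul_div_left _ _ (pow_pos hp.out.pos k), Nat.div_eq_of_lt (hlt _ h1'),
      Nat.div_eq_of_lt (hlt _ h2'), zero_add] at hdiv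
    have hmod : g.natDegree * (ij.2 : ℕ) ≡ g.natDegree * (ij'.2 : ℕ) [MOD p] := by
      have := congrArg (· % p) hdiv
      simpa [Nat.ModEq, Nat.mul_add_mod] using this
    have hco : p.gcd g.natDegree = 1 :=
      Nat.coprime_of_lt_prime hg.ne' hgp hp.out
    have h3 : (ij.2 : ℕ) = ij'.2 :=
      Nat.ModEq.eq_of_lt_of_lt (Nat.ModEq.cancel_left_of_coprime hco hmod) ij.2.2 ij'.2.2
    rw [h3] at hdiv
    have h4 : (ij.1 : ℕ) = ij'.1 := Nat.eq_of_mul_eq_mul_left hp.out.pos (Nat.add_right_cancel hdiv)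
    exact Prod.ext (Fin.ext h4) (Fin.ext h3)

lemma natDegree_auxPoly_le (k I : ℕ) (g : K[X]) (hg : 0 < g.natDegree)
    (r : Fin I × Fin p → degreeLT K (p ^ k)) :
    (auxPoly p (k + 1) I (p ^ k) g r).natDegree ≤
      p ^ k + p ^ (k + 1) * I + g.natDegree * p ^ (k + 1) := by
  refine natDegree_sum_le_of_forall_le _ _ fun ij _ => ?_
  refine natDegree_mul_le.trans (add_le_add (natDegree_mul_le.trans (add_le_add ?_ ?_)) ?_)
  · rcases eq_or_ne (r ij : K[X]) 0 with h0 | h0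
    · simp [h0]
    · exact ((natDegree_lt_iff_degree_lt h0).2 (mem_degreeLT.1 (r ij).2)).le
  · rw [natDegree_pow, natDegree_X_pow, mul_comm]
    exact Nat.mul_le_mul_left _ ij.1.2.le
  · rw [natDegree_pow, natDegree_tracePoly p k g hg, pow_succ, mul_comm, mul_assoc]
    exact Nat.mul_le_mul_left _ (Nat.mul_le_mul_left _ ij.2.2.le)

variable [CharP K p]

lemma X_sub_C_pow_dvd_auxPoly (k I A M : ℕ) (g : K[X]) (c : K) (hM : M ≤ p ^ k)
    (r : Fin I × Fin p → degreeLT K A) (hr : ∀ l < M, (localExpansion p k I A g c r).coeff l = 0)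
    (x : K) (hx : x ^ p ^ k = x) (hc : ∑ i ∈ Finset.range k, g.eval x ^ p ^ i = c) :
    (X - C x) ^ M ∣ auxPoly p k I A g r := by
  rw [X_sub_C_pow_dvd_iff]
  have h1 : X ^ M ∣ (localExpansion p k I A g c r).map (evalRingHom x) := by
    rw [X_pow_dvd_iff]
    intro l hl
    rw [coeff_map, hr l hl, map_zero]
  refine (dvd_iff_dvd_of_dvd_sub (dvd_trans (pow_dvd_pow X hM) ?_)).1 h1
  have hT : (tracePoly p k g).comp (X + C x) = C c + (traceIncr p k g).map (evalRingHom x) := by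
    rw [tracePoly, traceIncr, Polynomial.map_sum, ← hc, map_sum, ← Finset.sum_add_distrib,
      finset_sum_comp_eq]
    refine Finset.sum_congr rfl fun i _ => ?_
    rw [Polynomial.map_pow, Polynomial.map_sub, map_evalRingHom_shiftHom, sub_pow_char_pow, pow_comp,
      map_C, C_pow]
    simp
  have hX : (X ^ p ^ k + C x : K[X]) = (X + C x) ^ p ^ k := by
    rw [add_pow_char_pow, ← C_pow, hx]
  rw [auxPoly, localExpansion, Polynomial.map_sum, finset_sum_comp_eq,
    ← Finset.sum_sub_distrib]
  refine Finset.dvd_sum fun ij _ => ?_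
  simp only [mul_comp, pow_comp, X_comp, hT, Polynomial.map_mul, Polynomial.map_pow,
    Polynomial.map_add, map_evalRingHom_shiftHom, ← hX, map_C, coe_evalRingHom, eval_C,
    eval_X]
  rw [← sub_mul, ← mul_sub]
  refine Dvd.dvd.mul_right (Dvd.dvd.mul_left ?_ _) _
  rw [dvd_sub_comm]
  have h2 := sub_dvd_pow_sub_pow (X ^ p ^ k + C x) (C x) (ij.1 : ℕ)
  rwa [add_sub_cancel_right] at h2

/-- Stepanov's bound for the number of points of the affine line over the field with `p ^ (k + 1)`
elements at which `g` has trace `c`. -/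
theorem card_trace_eq_le (k s : ℕ) (hks : 2 * s + 3 ≤ k) (g : K[X]) (hg : 0 < g.natDegree)
    (hgp : g.natDegree < p) (c : K) (N : Finset K)
    (hN : ∀ x ∈ N, x ^ p ^ (k + 1) = x ∧ ∑ i ∈ Finset.range (k + 1), g.eval x ^ p ^ i = c) :
    (p ^ (s + 1) - 1) * N.card ≤ p ^ k + p ^ (k + 1) * p ^ s + g.natDegree * p ^ (k + 1) := by
  classical
  set M := p ^ (s + 1) - 1 with hM
  have hM1 : M + 1 = p ^ (s + 1) := Nat.sub_add_cancel (pow_pos hp.out.pos _)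
  have hsp : 0 < p ^ s := pow_pos hp.out.pos _
  have hineq : M * (p ^ k + p ^ s + g.natDegree * M) < p ^ s * p * p ^ k := by
    have h1 : p ^ s + g.natDegree * M ≤ p ^ (s + 2) := by
      have : (g.natDegree + 1) * p ^ (s + 1) ≤ p * p ^ (s + 1) := Nat.mul_le_mul_right _ hgp
      have h2 : p ^ s ≤ p ^ (s + 1) := Nat.pow_le_pow_right hp.out.pos (by omega)
      have h3 : g.natDegree * M ≤ g.natDegree * p ^ (s + 1) := Nat.mul_le_mul_left _ (by omega)
      have h4 : p ^ (s + 2) = p * p ^ (s + 1) := by ring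
      rw [add_mul, one_mul] at this
      omega
    have h2 : M * (p ^ s + g.natDegree * M) < p ^ k := by
      calc _ ≤ M * p ^ (s + 2) := Nat.mul_le_mul_left _ h1
        _ < p ^ (s + 1) * p ^ (s + 2) :=
          (Nat.mul_lt_mul_right (pow_pos hp.out.pos _)).2 (by omega)
        _ = p ^ (2 * s + 3) := by ring
        _ ≤ p ^ k := Nat.pow_le_pow_right hp.out.pos hks
    calc _ = M * p ^ k + M * (p ^ s + g.natDegree * M) := by ring
      _ < M * p ^ k + p ^ k := by omega
      _ = (M + 1) * p ^ k := by ring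
      _ = _ := by rw [hM1]; ring
  obtain ⟨r, hr0, hr⟩ := exists_localExpansion_coeff_eq_zero p (k + 1) (p ^ s) (p ^ k) M g hg c hineq
  have hR := auxPoly_ne_zero p k (p ^ s) g hg hgp r hr0
  refine le_trans ?_ (natDegree_auxPoly_le p k (p ^ s) g hg r)
  set R := auxPoly p (k + 1) (p ^ s) (p ^ k) g r with hRdef
  have hMk : M ≤ p ^ (k + 1) := by
    have : p ^ (s + 1) ≤ p ^ (k + 1) := Nat.pow_le_pow_right hp.out.pos (by omega)
    omega
  have hle : M • N.val ≤ R.roots := by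
    rw [Multiset.le_iff_count]
    intro x
    rw [Multiset.count_nsmul, count_roots]
    by_cases hx : x ∈ N
    · rw [Multiset.count_eq_one_of_mem N.nodup hx, mul_one, le_rootMultiplicity_iff hR]
      exact X_sub_C_pow_dvd_auxPoly p (k + 1) (p ^ s) (p ^ k) M g c hMk r hr x (hN x hx).1 (hN x hx).2
    · rw [Multiset.count_eq_zero_of_notMem hx]
      simp
  have := (Multiset.card_le_card hle).trans (card_roots' R)
  simpa using this

end Stepanov

section FrobeniusOrbits

variable {K : Type*} [Field K] (p : ℕ)

/-- The product of the `X - x ^ (p ^ i)` for `i < k`. -/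
noncomputable def orbitPoly (x : K) (k : ℕ) : K[X] := ∏ i ∈ Finset.range k, (X - C (x ^ p ^ i))

lemma monic_orbitPoly (x : K) (k : ℕ) : (orbitPoly p x k).Monic :=
  monic_prod_of_monic _ _ fun _ _ => monic_X_sub_C _

lemma natDegree_orbitPoly (x : K) (k : ℕ) : (orbitPoly p x k).natDegree = k := by
  rw [orbitPoly, natDegree_prod_of_monic _ _ fun _ _ => monic_X_sub_C _]
  simp only [natDegree_X_sub_C, Finset.sum_const, Finset.card_range, smul_eq_mul, mul_one]

lemma roots_orbitPoly (x : K) (k : ℕ) :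
    (orbitPoly p x k).roots = (Multiset.range k).map fun i => x ^ p ^ i := by
  have h : orbitPoly p x k = (((Multiset.range k).map fun i => x ^ p ^ i).map fun a => X - C a).prod := by
    rw [Multiset.map_map]
    rfl
  rw [h, roots_multiset_prod_X_sub_C]

lemma X_sub_C_dvd_orbitPoly (x : K) {k : ℕ} (hk : 0 < k) : X - C x ∣ orbitPoly p x k := by
  have := Finset.dvd_prod_of_mem (fun i => X - C (x ^ p ^ i)) (Finset.mem_range.2 hk)
  rwa [pow_zero, pow_one] at this

lemma orbitPoly_mul (x : K) {r : ℕ} (hr : x ^ p ^ r = x) (j : ℕ) :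
    x ^ p ^ (r * j) = x ∧ orbitPoly p x (r * j) = orbitPoly p x r ^ j := by
  induction j with
  | zero => simp [orbitPoly]
  | succ j ih =>
    constructor
    · rw [Nat.mul_succ, pow_add, pow_mul, ih.1, hr]
    · rw [Nat.mul_succ, pow_succ, ← ih.2, orbitPoly, Finset.prod_range_add]
      congr 1
      refine Finset.prod_congr rfl fun i _ => ?_
      rw [pow_add, pow_mul, ih.1]

variable [hp : Fact p.Prime]

lemma isPeriodicPt_frobenius_iff [CharP K p] {x : K} {k : ℕ} :
    Function.IsPeriodicPt (frobenius K p) k x ↔ x ^ p ^ k = x := by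
  rw [Function.IsPeriodicPt, Function.IsFixedPt, ← iterateFrobenius_def, coe_iterateFrobenius]

variable [Algebra (ZMod p) K]

lemma mem_range_algebraMap_of_pow_eq {x : K} (hx : x ^ p = x) :
    x ∈ Set.range (algebraMap (ZMod p) K) := by
  have h : (X ^ p - X : (ZMod p)[X]) = ∏ a : ZMod p, (X - C a) := by
    have h1 := FiniteField.roots_X_pow_card_sub_X (ZMod p)
    have hd := FiniteField.X_pow_card_sub_X_natDegree_eq (ZMod p) hp.out.one_lt
    rw [ZMod.card] at h1
    have h2 : (X ^ p - X : (ZMod p)[X]).Monic :=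
      monic_X_pow_sub (by rw [degree_X]; exact_mod_cast hp.out.one_lt)
    have h3 := prod_multiset_X_sub_C_of_monic_of_roots_card_eq h2 (by rw [h1, hd]; simp)
    rw [h1] at h3
    exact h3.symm
  have h4 := congrArg (fun f => (f.map (algebraMap (ZMod p) K)).eval x) h
  simp only [Polynomial.map_sub, Polynomial.map_pow, map_X, eval_sub, eval_pow, eval_X, hx,
    sub_self, Polynomial.map_prod, eval_prod, map_C, eval_C] at h4
  obtain ⟨a, -, ha⟩ := Finset.prod_eq_zero_iff.1 h4.symm
  exact ⟨a, (sub_eq_zero.1 ha).symm⟩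

variable [CharP K p]

lemma map_frobenius_map (h : (ZMod p)[X]) (i : ℕ) :
    (h.map (algebraMap (ZMod p) K)).map (iterateFrobenius K p i) = h.map (algebraMap (ZMod p) K) := by
  rw [Polynomial.map_map]
  congr 1
  exact Subsingleton.elim _ _

lemma exists_map_eq_orbitPoly {x : K} {k : ℕ} (hx : x ^ p ^ k = x) :
    ∃ H : (ZMod p)[X], H.Monic ∧ H.natDegree = k ∧
      H.map (algebraMap (ZMod p) K) = orbitPoly p x k := by
  have h1 : (orbitPoly p x k).map (frobenius K p) = orbitPoly p x k := by
    rcases k with _ | k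
    · simp [orbitPoly]
    · simp only [orbitPoly, Polynomial.map_prod, Polynomial.map_sub, map_X, map_C, frobenius_def,
        ← pow_mul, ← pow_succ]
      rw [Finset.prod_range_succ, hx, Finset.prod_range_succ' (fun i => X - C (x ^ p ^ i))]
      simp
  have h2 : orbitPoly p x k ∈ lifts (algebraMap (ZMod p) K) := by
    rw [lifts_iff_coeff_lifts]
    intro n
    apply mem_range_algebraMap_of_pow_eq
    have := congrArg (fun f => f.coeff n) h1
    simpa [frobenius_def] using this
  obtain ⟨H, h3, h4, h5⟩ := lifts_and_natDegree_eq_and_monic h2 (monic_orbitPoly p x k)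
  exact ⟨H, h5, by rw [h4, natDegree_orbitPoly], h3⟩

open Classical in
lemma exists_pow_eq_of_isRoot {h : (ZMod p)[X]} (h0 : h ≠ 0) {x : K}
    (hx : (h.map (algebraMap (ZMod p) K)).IsRoot x) : ∃ r, 0 < r ∧ x ^ p ^ r = x := by
  have h0' : h.map (algebraMap (ZMod p) K) ≠ 0 := by
    rwa [Ne, Polynomial.map_eq_zero]
  have hmem : ∀ i : ℕ, x ^ p ^ i ∈ (h.map (algebraMap (ZMod p) K)).roots.toFinset := by
    intro i
    rw [Multiset.mem_toFinset, mem_roots h0', ← map_frobenius_map p h i, IsRoot.def,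
      ← iterateFrobenius_def, eval_map_apply, hx.eq_zero, map_zero]
  obtain ⟨a, -, b, -, hab, heq⟩ := Set.infinite_univ.exists_ne_map_eq_of_mapsTo
    (f := fun i : ℕ => x ^ p ^ i) (fun i _ => Finset.mem_coe.2 (hmem i)) (Finset.finite_toSet _)
  have hlt : ∀ a b : ℕ, a < b → x ^ p ^ a = x ^ p ^ b → ∃ r, 0 < r ∧ x ^ p ^ r = x := by
    intro a b hlt heq
    refine ⟨b - a, by omega, ?_⟩
    apply (iterateFrobenius K p a).injective
    rw [iterateFrobenius_def, iterateFrobenius_def, heq, ← pow_mul, ← pow_add,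
      Nat.sub_add_cancel hlt.le]
  rcases lt_or_gt_of_ne hab with h' | h'
  · exact hlt a b h' heq
  · exact hlt b a h' heq.symm

open Classical in
/-- The multiplicity of a root `x` counts the powers of its minimal polynomial dividing `h`. -/
lemma card_orbitPoly_dvd {h : (ZMod p)[X]} (h0 : h ≠ 0) {n : ℕ} (hn : h.natDegree ≤ n) (x : K) :
    ((Finset.Icc 1 n).filter fun k => x ^ p ^ k = x ∧
      orbitPoly p x k ∣ h.map (algebraMap (ZMod p) K)).card =
    (h.map (algebraMap (ZMod p) K)).rootMultiplicity x := by
  set H := h.map (algebraMap (ZMod p) K) with hH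
  have h0' : H ≠ 0 := by rwa [Ne, hH, Polynomial.map_eq_zero]
  set m := H.rootMultiplicity x with hm
  rcases Nat.eq_zero_or_pos m with hm0 | hm0
  · rw [hm0, Finset.card_eq_zero, Finset.filter_eq_empty_iff]
    rintro k hk ⟨-, hdvd⟩
    have := (rootMultiplicity_pos h0').2
      (dvd_iff_isRoot.1 ((X_sub_C_dvd_orbitPoly p x (Finset.mem_Icc.1 hk).1).trans hdvd))
    omega
  obtain ⟨r₀, hr₀, hxr₀⟩ := exists_pow_eq_of_isRoot p h0 ((rootMultiplicity_pos h0').1 hm0)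
  set r := Function.minimalPeriod (frobenius K p) x with hr
  have hrpos : 0 < r :=
    Function.IsPeriodicPt.minimalPeriod_pos hr₀ ((isPeriodicPt_frobenius_iff p).2 hxr₀)
  have hxr : x ^ p ^ r = x := (isPeriodicPt_frobenius_iff p).1 (Function.isPeriodicPt_minimalPeriod _ _)
  have hper : ∀ k, x ^ p ^ k = x ↔ r ∣ k := fun k => by
    rw [← isPeriodicPt_frobenius_iff, Function.isPeriodicPt_iff_minimalPeriod_dvd]
  have hdvd : ∀ j, orbitPoly p x (r * j) ∣ H ↔ j ≤ m := by
    intro j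
    rw [(orbitPoly_mul p x hxr j).2, hm, le_rootMultiplicity_iff h0']
    refine ⟨fun hj => (pow_dvd_pow_of_dvd (X_sub_C_dvd_orbitPoly p x hrpos) j).trans hj, fun hj => ?_⟩
    rw [orbitPoly, ← Finset.prod_pow]
    refine Finset.prod_dvd_of_coprime (fun a ha b hb hab => ?_) fun i _ => ?_
    · refine (isCoprime_X_sub_C_of_isUnit_sub (IsUnit.mk0 _ (sub_ne_zero.2 fun heq => hab ?_))).pow
      refine Function.iterate_injOn_Iio_minimalPeriod (f := frobenius K p) (x := x)
        (Finset.mem_range.1 ha) (Finset.mem_range.1 hb) ?_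
      simpa only [← coe_iterateFrobenius, iterateFrobenius_def] using heq
    · have := Polynomial.map_dvd (iterateFrobenius K p i) hj
      rwa [hH, map_frobenius_map, Polynomial.map_pow, Polynomial.map_sub, map_X, map_C,
        iterateFrobenius_def] at this
  have himg : ((Finset.Icc 1 n).filter fun k => x ^ p ^ k = x ∧ orbitPoly p x k ∣ H) =
      (Finset.Icc 1 m).image (r * ·) := by
    ext k
    simp only [Finset.mem_filter, Finset.mem_Icc, Finset.mem_image, hper]
    constructor
    · rintro ⟨⟨hk, -⟩, ⟨j, rfl⟩, hj⟩
      exact ⟨j, ⟨Nat.pos_of_mul_pos_left hk, (hdvd j).1 hj⟩, rfl⟩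
    · rintro ⟨j, ⟨hj1, hjm⟩, rfl⟩
      have hj := (hdvd j).2 hjm
      refine ⟨⟨Nat.mul_pos hrpos hj1, ?_⟩, dvd_mul_right _ _, hj⟩
      have := natDegree_le_of_dvd hj h0'
      rw [natDegree_orbitPoly, hH, natDegree_map] at this
      exact this.trans hn
  rw [himg, Finset.card_image_of_injective _ (fun a b hab => Nat.eq_of_mul_eq_mul_left hrpos hab), Nat.card_Icc]
  omega

end FrobeniusOrbits

section LFunction

open Classical in
/-- Newton's identities: if two multisets have the same elementary symmetric functions below `k`,
then their power sums differ by a multiple of the `k`-th elementary symmetric function. -/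
lemma psum_sub_psum_eq {K : Type*} [CommRing K] (m m' : Multiset K) {k : ℕ}
    (h : ∀ i < k, m.esymm i = m'.esymm i) {j : ℕ} (hj0 : 0 < j) (hj : j ≤ k) :
    (m.map (· ^ j)).sum - (m'.map (· ^ j)).sum =
      (-1) ^ (j + 1) * j * (m.esymm j - m'.esymm j) := by
  have newton : ∀ (m : Multiset K) (j : ℕ), 0 < j → (m.map (· ^ j)).sum =
      (-1) ^ (j + 1) * j * m.esymm j - ∑ a ∈ Finset.HasAntidiagonal.antidiagonal j with a.1 ∈ Set.Ioo 0 j,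
        (-1) ^ a.1 * m.esymm a.1 * (m.map (· ^ a.2)).sum := by
    intro m j hj
    have hm : Multiset.map (fun x : m => (x : K)) Finset.univ.val = m := Multiset.map_univ_coe m
    have hp : ∀ i, MvPolynomial.aeval (fun x : m => (x : K)) (MvPolynomial.psum m K i) =
        (m.map (· ^ i)).sum := by
      intro i
      conv_rhs => rw [← hm]
      rw [MvPolynomial.psum, map_sum, Multiset.map_map]
      simp only [map_pow, MvPolynomial.aeval_X]
      rfl
    have he : ∀ i, MvPolynomial.aeval (fun x : m => (x : K)) (MvPolynomial.esymm m K i) =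
        m.esymm i := by
      intro i
      rw [MvPolynomial.aeval_esymm_eq_multiset_esymm, hm]
    have := congrArg (MvPolynomial.aeval (fun x : m => (x : K)))
      (MvPolynomial.psum_eq_mul_esymm_sub_sum m K j hj)
    simpa only [map_sub, map_mul, map_sum, map_pow, map_neg, map_one, map_natCast, hp, he] using this
  induction j using Nat.strong_induction_on with
  | _ j ih =>
    rw [newton m j hj0, newton m' j hj0]
    have hsum : ∀ a ∈ (Finset.HasAntidiagonal.antidiagonal j).filter (fun a => a.1 ∈ Set.Ioo 0 j),
        (-1) ^ a.1 * m.esymm a.1 * (m.map (· ^ a.2)).sum =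
          (-1) ^ a.1 * m'.esymm a.1 * (m'.map (· ^ a.2)).sum := by
      intro a ha
      obtain ⟨h1, h2, h3⟩ := Finset.mem_filter.1 ha
      have h4 := Finset.HasAntidiagonal.mem_antidiagonal.1 h1
      have h5 := ih a.2 (by omega) (by omega) (by omega)
      rw [h a.2 (by omega), sub_self, mul_zero, sub_eq_zero] at h5
      rw [h a.1 (by omega), h5]
    rw [Finset.sum_congr rfl hsum]
    ring

variable {K : Type*} [Field K] (p : ℕ) [hp : Fact p.Prime] [Algebra (ZMod p) K]

lemma finite_monics (n : ℕ) : {h : (ZMod p)[X] | h.Monic ∧ h.natDegree = n}.Finite := by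
  refine (Set.finite_range fun a : Fin n → ZMod p =>
    X ^ n + ∑ i : Fin n, C (a i) * X ^ (i : ℕ)).subset ?_
  rintro h ⟨hm, rfl⟩
  refine ⟨fun i => h.coeff i, ?_⟩
  conv_rhs => rw [hm.as_sum]
  simp only [Finset.sum_range]

/-- The monic polynomials of degree `n` over `ZMod p`. -/
noncomputable def monics (n : ℕ) : Finset (ZMod p)[X] := (finite_monics p n).toFinset

lemma mem_monics {n : ℕ} {h : (ZMod p)[X]} : h ∈ monics p n ↔ h.Monic ∧ h.natDegree = n := by
  simp [monics]

/-- The completely multiplicative weight `χ(∑ G(θ))`, the sum being over the roots `θ` of `h`. -/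
noncomputable def rootWeight (χ : AddChar K ℂ) (G : K → K) (h : (ZMod p)[X]) : ℂ :=
  χ ((h.map (algebraMap (ZMod p) K)).roots.map G).sum

lemma rootWeight_mul (χ : AddChar K ℂ) (G : K → K) {h h' : (ZMod p)[X]} (h0 : h ≠ 0) (h0' : h' ≠ 0) :
    rootWeight p χ G (h * h') = rootWeight p χ G h * rootWeight p χ G h' := by
  have : (h.map (algebraMap (ZMod p) K)) * h'.map (algebraMap (ZMod p) K) ≠ 0 := by
    simp [h0, h0', Polynomial.map_eq_zero]
  rw [rootWeight, Polynomial.map_mul, roots_mul this, Multiset.map_add, Multiset.sum_add,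
    AddChar.map_add_eq_mul]
  rfl

/-- The `n`-th coefficient of the `L`-function. -/
noncomputable def lCoeff (χ : AddChar K ℂ) (G : K → K) (n : ℕ) : ℂ :=
  ∑ h ∈ monics p n, rootWeight p χ G h

lemma lCoeff_zero (χ : AddChar K ℂ) (G : K → K) : lCoeff p χ G 0 = 1 := by
  have : monics p 0 = {1} := by
    ext h
    rw [mem_monics, Finset.mem_singleton]
    exact ⟨fun h' => h'.1.natDegree_eq_zero.1 h'.2, fun h' => by simp [h']⟩
  rw [lCoeff, this, Finset.sum_singleton, rootWeight]
  simp

lemma sum_map_eval_roots (g : K[X]) (m : Multiset K) :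
    (m.map fun x => g.eval x).sum =
      ∑ j ∈ Finset.range (g.natDegree + 1), g.coeff j * (m.map (· ^ j)).sum := by
  induction m using Multiset.induction_on with
  | empty => simp
  | cons a m ih =>
    simp only [Multiset.map_cons, Multiset.sum_cons, ih, mul_add, Finset.sum_add_distrib]
    rw [eval_eq_sum_range]

variable [IsAlgClosed K]

lemma esymm_roots_eq_coeff {h : (ZMod p)[X]} (hm : h.Monic) {i : ℕ} (hi : i ≤ h.natDegree) :
    (h.map (algebraMap (ZMod p) K)).roots.esymm i =
      (-1) ^ i * algebraMap (ZMod p) K (h.coeff (h.natDegree - i)) := by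
  set H := h.map (algebraMap (ZMod p) K)
  have hd : H.natDegree = h.natDegree := natDegree_map _
  have hsplit : H.Splits := IsAlgClosed.splits H
  have := coeff_eq_esymm_roots_of_card (splits_iff_card_roots.1 hsplit)
    (k := h.natDegree - i) (by omega)
  rw [coeff_map, (hm.map _).leadingCoeff, hd, Nat.sub_sub_self hi, one_mul] at this
  rw [this, ← mul_assoc, ← mul_pow]
  simp

lemma card_roots_map (h : (ZMod p)[X]) :
    (h.map (algebraMap (ZMod p) K)).roots.card = h.natDegree := by
  rw [splits_iff_card_roots.1 (IsAlgClosed.splits _), natDegree_map]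

/-- Changing the `e`-th highest coefficient multiplies the weight by a fixed factor. -/
lemma rootWeight_add (χ : AddChar K ℂ) (g : K[X]) (hg : 0 < g.natDegree) {n : ℕ}
    (hn : g.natDegree ≤ n) (t : ZMod p) {h : (ZMod p)[X]} (hh : h ∈ monics p n) :
    rootWeight p χ (fun x => g.eval x) (h + C t * X ^ (n - g.natDegree)) =
      χ (-(g.leadingCoeff * g.natDegree * algebraMap (ZMod p) K t)) *
        rootWeight p χ (fun x => g.eval x) h ∧ h + C t * X ^ (n - g.natDegree) ∈ monics p n := by
  set e := g.natDegree with he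
  obtain ⟨hm, hd⟩ := (mem_monics p).1 hh
  have hlt : (C t * X ^ (n - e)).degree < h.degree := by
    rw [degree_eq_natDegree hm.ne_zero, hd]
    exact (degree_C_mul_X_pow_le _ _).trans_lt (by exact_mod_cast (by omega))
  set h' := h + C t * X ^ (n - e) with hh'
  have hm' : h'.Monic := hm.add_of_left hlt
  have hd' : h'.natDegree = n := by
    rw [hh', natDegree_add_eq_left_of_degree_lt hlt, hd]
  refine ⟨?_, (mem_monics p).2 ⟨hm', hd'⟩⟩
  have hcoeff : ∀ i ≤ n, h'.coeff (n - i) = h.coeff (n - i) + if i = e then t else 0 := by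
    intro i hi
    rw [hh', coeff_add, coeff_C_mul_X_pow]
    congr 2
    exact propext (by omega)
  set m := (h.map (algebraMap (ZMod p) K)).roots with hmdef
  set m' := (h'.map (algebraMap (ZMod p) K)).roots with hmdef'
  have hes : ∀ i ≤ n, m'.esymm i = m.esymm i +
      if i = e then (-1) ^ e * algebraMap (ZMod p) K t else 0 := by
    intro i hi
    rw [hmdef, hmdef', esymm_roots_eq_coeff p hm (by omega), esymm_roots_eq_coeff p hm' (by omega),
      hd, hd', hcoeff i hi]
    split_ifs with h1
    · rw [map_add, mul_add, h1]
    · simp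
  have hlow : ∀ i < e, m'.esymm i = m.esymm i := fun i hi => by
    rw [hes i (by omega), if_neg hi.ne, add_zero]
  have hpj : ∀ j ∈ Finset.range e, g.coeff j * (m'.map (· ^ j)).sum =
      g.coeff j * (m.map (· ^ j)).sum := by
    intro j hj
    have hj := Finset.mem_range.1 hj
    rcases Nat.eq_zero_or_pos j with rfl | hj0
    · have h1 : m'.card = m.card := by
        rw [hmdef, hmdef', card_roots_map, card_roots_map, hd, hd']
      simp [h1]
    · have := psum_sub_psum_eq m' m hlow hj0 hj.le
      rw [hlow j hj, sub_self, mul_zero, sub_eq_zero] at this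
      rw [this]
  have hpe : (m'.map (· ^ e)).sum = (m.map (· ^ e)).sum - e * algebraMap (ZMod p) K t := by
    have := psum_sub_psum_eq m' m hlow hg le_rfl
    rw [hes e hn, if_pos rfl, add_sub_cancel_left] at this
    rw [eq_add_of_sub_eq this, pow_succ]
    have h1 : ((-1 : K) ^ e) * (-1) ^ e = 1 := by rw [← mul_pow]; simp
    linear_combination (-(e : K) * algebraMap (ZMod p) K t) * h1
  rw [rootWeight, rootWeight, ← AddChar.map_add_eq_mul, ← hmdef, ← hmdef', sum_map_eval_roots,
    sum_map_eval_roots, ← he, Finset.sum_range_succ, Finset.sum_range_succ, Finset.sum_congr rfl hpj,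
    hpe]
  congr 1
  rw [leadingCoeff, ← he]
  ring

lemma lCoeff_eq_zero (χ : AddChar K ℂ) (g : K[X]) (hg : 0 < g.natDegree) {n : ℕ}
    (hn : g.natDegree ≤ n) (t : ZMod p)
    (ht : χ (-(g.leadingCoeff * g.natDegree * algebraMap (ZMod p) K t)) ≠ 1) :
    lCoeff p χ (fun x => g.eval x) n = 0 := by
  have h1 : lCoeff p χ (fun x => g.eval x) n =
      ∑ h ∈ monics p n, rootWeight p χ (fun x => g.eval x) (h + C t * X ^ (n - g.natDegree)) := by
    refine (Finset.sum_bij (fun h _ => h + C t * X ^ (n - g.natDegree))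
      (fun h hh => (rootWeight_add p χ g hg hn t hh).2) (fun a _ b _ hab => add_right_cancel hab)
      (fun h hh => ⟨h + C (-t) * X ^ (n - g.natDegree), (rootWeight_add p χ g hg hn (-t) hh).2, ?_⟩)
      fun _ _ => rfl).symm
    simp
  rw [Finset.sum_congr rfl fun h hh => (rootWeight_add p χ g hg hn t hh).1, ← Finset.mul_sum] at h1
  change lCoeff p χ (fun x => g.eval x) n = _ * lCoeff p χ (fun x => g.eval x) n at h1
  by_contra h0
  exact ht (mul_right_cancel₀ h0 (by rw [one_mul]; exact h1.symm))

end LFunction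

section Convolution

variable {K : Type*} [Field K] (p : ℕ)

open Classical in
/-- The fixed points of the `k`-th power of Frobenius. -/
noncomputable def frobFixed (K : Type*) [Field K] (p k : ℕ) : Finset K :=
  (X ^ p ^ k - X : K[X]).roots.toFinset

/-- The exponential sum over the fixed points of the `k`-th power of Frobenius. -/
noncomputable def frobSum (χ : AddChar K ℂ) (G : K → K) (k : ℕ) : ℂ :=
  ∑ x ∈ frobFixed K p k, χ (∑ i ∈ Finset.range k, G (x ^ p ^ i))

variable [hp : Fact p.Prime]

open Classical in
lemma mem_frobFixed {k : ℕ} (hk : 0 < k) {x : K} : x ∈ frobFixed K p k ↔ x ^ p ^ k = x := by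
  have h0 : (X ^ p ^ k - X : K[X]) ≠ 0 :=
    FiniteField.X_pow_card_pow_sub_X_ne_zero K hk.ne' hp.out.one_lt
  rw [frobFixed, Multiset.mem_toFinset, mem_roots h0]
  simp [sub_eq_zero]

open Classical in
lemma card_frobFixed [CharP K p] [IsAlgClosed K] {k : ℕ} (hk : 0 < k) : (frobFixed K p k).card = p ^ k := by
  have hsep : (X ^ p ^ k - X : K[X]).Separable := galois_poly_separable p _ (dvd_pow_self p hk.ne')
  rw [frobFixed, Multiset.toFinset_card_of_nodup (nodup_roots hsep),
    splits_iff_card_roots.1 (IsAlgClosed.splits _),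
    FiniteField.X_pow_card_pow_sub_X_natDegree_eq K hk.ne' hp.out.one_lt]

variable [Algebra (ZMod p) K] [CharP K p]

open Classical in
lemma sum_rootWeight_filter (χ : AddChar K ℂ) (G : K → K) {k n : ℕ} (hkn : k ≤ n)
    {x : K} (hx : x ^ p ^ k = x) :
    ∑ h ∈ (monics p n).filter (fun h => orbitPoly p x k ∣ h.map (algebraMap (ZMod p) K)),
      rootWeight p χ G h = χ (∑ i ∈ Finset.range k, G (x ^ p ^ i)) * lCoeff p χ G (n - k) := by
  obtain ⟨H, hH, hHk, hmap⟩ := exists_map_eq_orbitPoly p hx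
  have hw : rootWeight p χ G H = χ (∑ i ∈ Finset.range k, G (x ^ p ^ i)) := by
    rw [rootWeight, hmap, roots_orbitPoly, Multiset.map_map]
    rfl
  rw [lCoeff, Finset.mul_sum, ← hw]
  symm
  refine Finset.sum_bij (fun h _ => H * h) (fun h hh => ?_) (fun a _ b _ hab => ?_) (fun h hh => ?_)
    (fun h hh => ?_)
  · obtain ⟨h1, h2⟩ := (mem_monics p).1 hh
    refine Finset.mem_filter.2 ⟨(mem_monics p).2 ⟨hH.mul h1, ?_⟩, ?_⟩
    · rw [hH.natDegree_mul h1, hHk, h2]; omega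
    · rw [← hmap, Polynomial.map_mul]; exact dvd_mul_right _ _
  · exact mul_left_cancel₀ hH.ne_zero hab
  · obtain ⟨h1, h2⟩ := Finset.mem_filter.1 hh
    obtain ⟨h3, h4⟩ := (mem_monics p).1 h1
    rw [← hmap, Polynomial.map_dvd_map _ (algebraMap (ZMod p) K).injective hH] at h2
    obtain ⟨q, rfl⟩ := h2
    have hq : q.Monic := hH.of_mul_monic_left h3
    refine ⟨q, (mem_monics p).2 ⟨hq, ?_⟩, rfl⟩
    rw [hH.natDegree_mul hq, hHk] at h4
    omega
  · rw [rootWeight_mul p χ G hH.ne_zero ((mem_monics p).1 hh).1.ne_zero]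

open Classical in
/-- The logarithmic derivative of the `L`-function, in terms of coefficients. -/
lemma natCast_mul_lCoeff [IsAlgClosed K] (χ : AddChar K ℂ) (G : K → K) (n : ℕ) :
    (n : ℂ) * lCoeff p χ G n =
      ∑ k ∈ Finset.Icc 1 n, frobSum p χ G k * lCoeff p χ G (n - k) := by
  have hcount : ∀ h ∈ monics p n, n = ∑ k ∈ Finset.Icc 1 n, ((frobFixed K p k).filter
      fun x => orbitPoly p x k ∣ h.map (algebraMap (ZMod p) K)).card := by
    intro h hh
    obtain ⟨hm, hd⟩ := (mem_monics p).1 hh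
    set H := h.map (algebraMap (ZMod p) K) with hH
    set V := (Finset.Icc 1 n).biUnion (frobFixed K p) ∪ H.roots.toFinset with hV
    have h1 : ∑ x ∈ V, H.rootMultiplicity x = n := by
      have := Multiset.sum_count_eq_card (s := V) (m := H.roots)
        (fun a ha => Finset.mem_union_right _ (Multiset.mem_toFinset.2 ha))
      rw [hH, card_roots_map p h, hd] at this
      simpa only [count_roots] using this
    conv_lhs => rw [← h1]
    rw [Finset.sum_congr rfl fun x _ => (card_orbitPoly_dvd p hm.ne_zero hd.le x).symm]
    refine (Finset.sum_card_bipartiteAbove_eq_sum_card_bipartiteBelow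
      (fun x k => x ^ p ^ k = x ∧ orbitPoly p x k ∣ H)).trans ?_
    refine Finset.sum_congr rfl fun k hk => ?_
    rw [Finset.bipartiteBelow]
    congr 1
    ext x
    have hk' := (Finset.mem_Icc.1 hk).1
    rw [Finset.mem_filter, Finset.mem_filter, mem_frobFixed p hk']
    refine ⟨fun h => h.2, fun h => ⟨Finset.mem_union_left _ (Finset.mem_biUnion.2
      ⟨k, hk, (mem_frobFixed p hk').2 h.1⟩), h⟩⟩
  calc (n : ℂ) * lCoeff p χ G n
      = ∑ h ∈ monics p n, ∑ k ∈ Finset.Icc 1 n, ∑ x ∈ frobFixed K p k,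
          if orbitPoly p x k ∣ h.map (algebraMap (ZMod p) K) then rootWeight p χ G h else 0 := by
        rw [lCoeff, Finset.mul_sum]
        refine Finset.sum_congr rfl fun h hh => ?_
        conv_lhs => rw [hcount h hh]
        rw [Nat.cast_sum, Finset.sum_mul]
        refine Finset.sum_congr rfl fun k _ => ?_
        rw [← Finset.sum_filter, Finset.sum_const, nsmul_eq_mul]
    _ = ∑ k ∈ Finset.Icc 1 n, ∑ x ∈ frobFixed K p k, ∑ h ∈ monics p n,
          if orbitPoly p x k ∣ h.map (algebraMap (ZMod p) K) then rootWeight p χ G h else 0 := by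
        rw [Finset.sum_comm]
        exact Finset.sum_congr rfl fun k _ => Finset.sum_comm
    _ = _ := by
        refine Finset.sum_congr rfl fun k hk => ?_
        obtain ⟨hk1, hkn⟩ := Finset.mem_Icc.1 hk
        rw [frobSum, Finset.sum_mul]
        refine Finset.sum_congr rfl fun x hx => ?_
        rw [← Finset.sum_filter]
        exact sum_rootWeight_filter p χ G hkn ((mem_frobFixed p hk1).1 hx)

end Convolution

section FrobeniusSumBound

variable {K : Type*} [Field K] (p : ℕ) [hp : Fact p.Prime] [CharP K p]

lemma trace_pow_eq (y : K) {k : ℕ} (hy : y ^ p ^ k = y) :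
    (∑ i ∈ Finset.range k, y ^ p ^ i) ^ p = ∑ i ∈ Finset.range k, y ^ p ^ i := by
  rw [sum_pow_char]
  simp only [← pow_mul, ← pow_succ]
  have h := Finset.sum_range_succ (fun i => y ^ p ^ i) k
  rw [Finset.sum_range_succ', hy, pow_zero, pow_one] at h
  exact add_right_cancel h

variable [Algebra (ZMod p) K]

lemma norm_stdAddChar {N : ℕ} [NeZero N] (a : ZMod N) : ‖ZMod.stdAddChar a‖ = 1 := by
  rw [ZMod.stdAddChar_apply]
  exact Circle.norm_coe _

lemma sum_stdAddChar {N : ℕ} [NeZero N] (hN : 1 < N) : ∑ a : ZMod N, ZMod.stdAddChar a = 0 := by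
  have : Fact (1 < N) := ⟨hN⟩
  refine AddChar.sum_eq_zero_of_ne_one ?_
  rw [AddChar.ne_one_iff]
  refine ⟨1, fun h => one_ne_zero (ZMod.injective_stdAddChar (N := N) (h.trans ?_))⟩
  exact (AddChar.map_zero_eq_one _).symm

lemma eval_map_pow_frobenius (g : (ZMod p)[X]) (x : K) (i : ℕ) :
    (g.map (algebraMap (ZMod p) K)).eval (x ^ p ^ i) =
      (g.map (algebraMap (ZMod p) K)).eval x ^ p ^ i := by
  rw [← iterateFrobenius_def, ← iterateFrobenius_def, ← eval_map_apply, map_frobenius_map]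

lemma exists_trace_eq (g : (ZMod p)[X]) {k : ℕ} (hk : 0 < k) {x : K} (hx : x ∈ frobFixed K p k) :
    ∃ a : ZMod p, algebraMap (ZMod p) K a =
      ∑ i ∈ Finset.range k, (g.map (algebraMap (ZMod p) K)).eval x ^ p ^ i := by
  refine mem_range_algebraMap_of_pow_eq p (trace_pow_eq p _ ?_)
  rw [← eval_map_pow_frobenius, (mem_frobFixed p hk).1 hx]

variable [IsAlgClosed K] {χ : AddChar K ℂ}

lemma norm_frobSum_le_pow (hχ : ∀ a, χ (algebraMap (ZMod p) K a) = ZMod.stdAddChar a)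
    (g : (ZMod p)[X]) {k : ℕ} (hk : 0 < k) :
    ‖frobSum p χ (fun x => (g.map (algebraMap (ZMod p) K)).eval x) k‖ ≤ (p : ℝ) ^ k := by
  refine (norm_sum_le_of_le _ (n := fun _ => (1 : ℝ)) fun x hx => ?_).trans ?_
  · obtain ⟨a, ha⟩ := exists_trace_eq p g hk hx
    simp only [eval_map_pow_frobenius, ← ha, hχ, norm_stdAddChar, le_refl]
  · simp [card_frobFixed p hk]

open Classical in
/-- An upper bound for all fibres of the trace bounds the exponential sum. -/
lemma norm_frobSum_le (hχ : ∀ a, χ (algebraMap (ZMod p) K a) = ZMod.stdAddChar a)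
    (g : (ZMod p)[X]) {k : ℕ} (hk : 0 < k) (U : ℝ)
    (hU : ∀ a : ZMod p, (((frobFixed K p k).filter fun x => ∑ i ∈ Finset.range k,
      (g.map (algebraMap (ZMod p) K)).eval x ^ p ^ i = algebraMap (ZMod p) K a).card : ℝ) ≤ U) :
    ‖frobSum p χ (fun x => (g.map (algebraMap (ZMod p) K)).eval x) k‖ ≤ p * U - (p : ℝ) ^ k := by
  set T : K → K := fun x => ∑ i ∈ Finset.range k, (g.map (algebraMap (ZMod p) K)).eval x ^ p ^ i
    with hT
  set N : ZMod p → Finset K := fun a =>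
    (frobFixed K p k).filter fun x => T x = algebraMap (ZMod p) K a with hN
  have hfib : ∀ F : K → ℂ, ∑ x ∈ frobFixed K p k, F x = ∑ a, ∑ x ∈ N a, F x := by
    intro F
    simp only [hN, Finset.sum_filter]
    rw [Finset.sum_comm]
    refine Finset.sum_congr rfl fun x hx => ?_
    obtain ⟨a, ha⟩ := exists_trace_eq p g hk hx
    rw [Finset.sum_eq_single a]
    · rw [if_pos ha.symm]
    · intro b _ hb
      rw [if_neg]
      intro h
      exact hb ((algebraMap (ZMod p) K).injective (h.symm.trans ha.symm))
    · simp
  have hcard : ∑ a, ((N a).card : ℝ) = (p : ℝ) ^ k := by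
    have := hfib fun _ => 1
    simp only [Finset.sum_const, nsmul_eq_mul, mul_one, card_frobFixed p hk] at this
    exact_mod_cast this.symm
  have hsum : frobSum p χ (fun x => (g.map (algebraMap (ZMod p) K)).eval x) k =
      ∑ a : ZMod p, (((N a).card : ℂ) - U) * ZMod.stdAddChar a := by
    simp only [sub_mul, Finset.sum_sub_distrib, ← Finset.mul_sum, sum_stdAddChar hp.out.one_lt,
      mul_zero, sub_zero]
    rw [frobSum, hfib]
    refine Finset.sum_congr rfl fun a _ => ?_
    rw [← nsmul_eq_mul]
    refine Finset.sum_eq_card_nsmul fun x hx => ?_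
    simp only [eval_map_pow_frobenius]
    rw [← hχ, ← (Finset.mem_filter.1 hx).2]
  rw [hsum]
  refine (norm_sum_le_of_le _ (n := fun a => U - (N a).card) fun a _ => ?_).trans ?_
  · rw [norm_mul, norm_stdAddChar, mul_one, ← Complex.ofReal_natCast, ← Complex.ofReal_sub,
      Complex.norm_real, Real.norm_eq_abs, abs_sub_comm, abs_of_nonneg (sub_nonneg.2 (hU a))]
  · rw [Finset.sum_sub_distrib, hcard]
    simp

open Classical in
lemma exists_norm_frobSum_le (hχ : ∀ a, χ (algebraMap (ZMod p) K a) = ZMod.stdAddChar a)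
    (g : (ZMod p)[X]) (hg : 0 < g.natDegree) (hgp : g.natDegree < p) :
    ∃ B : ℝ, ∀ k, 0 < k →
      ‖frobSum p χ (fun x => (g.map (algebraMap (ZMod p) K)).eval x) k‖ ≤ B * √p ^ k := by
  set e := g.natDegree with he
  have hp1 : (1 : ℝ) < p := by exact_mod_cast hp.out.one_lt
  have hp2 : (2 : ℝ) ≤ p := by exact_mod_cast hp.out.two_le
  have hs1 : (1 : ℝ) ≤ √p := Real.one_le_sqrt.2 hp1.le
  have hss : √(p : ℝ) ^ 2 = p := Real.sq_sqrt (by positivity)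
  refine ⟨2 * (2 + e * p) * √p ^ 6, fun k hk => ?_⟩
  rcases le_or_gt k 3 with hk3 | hk3
  · refine (norm_frobSum_le_pow p hχ g hk).trans ?_
    calc (p : ℝ) ^ k = √p ^ k * √p ^ k := by rw [← mul_pow, ← sq, hss]
      _ ≤ √p ^ 6 * √p ^ k := by
        exact mul_le_mul_of_nonneg_right (pow_le_pow_right₀ hs1 (by omega)) (by positivity)
      _ ≤ 2 * (2 + e * p) * √p ^ 6 * √p ^ k := by
        gcongr
        refine le_mul_of_one_le_left (by positivity) ?_
        have : (0 : ℝ) ≤ e * p := by positivity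
        linarith
  · obtain ⟨l, rfl⟩ : ∃ l, k = l + 1 := ⟨k - 1, by omega⟩
    obtain ⟨s, hs⟩ : ∃ s, s = (l - 3) / 2 := ⟨_, rfl⟩
    have hpow : (2 : ℝ) ≤ p ^ (s + 1) :=
      hp2.trans (by simpa using pow_le_pow_right₀ hp1.le (show 1 ≤ s + 1 by omega))
    have hD : (0 : ℝ) < p ^ (s + 1) - 1 := by linarith
    refine (norm_frobSum_le p hχ g hk
      (((p : ℝ) ^ l + p ^ (l + 1) * p ^ s + e * p ^ (l + 1)) / (p ^ (s + 1) - 1)) fun a => ?_).trans ?_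
    · rw [le_div_iff₀ hD, mul_comm]
      have h1 := card_trace_eq_le p l s (by omega) (g.map (algebraMap (ZMod p) K))
        (by rwa [natDegree_map]) (by rwa [natDegree_map]) (algebraMap (ZMod p) K a)
        ((frobFixed K p (l + 1)).filter fun x => ∑ i ∈ Finset.range (l + 1),
          (g.map (algebraMap (ZMod p) K)).eval x ^ p ^ i = algebraMap (ZMod p) K a)
        fun x hx => ⟨(mem_frobFixed p hk).1 (Finset.mem_filter.1 hx).1, (Finset.mem_filter.1 hx).2⟩
      rw [natDegree_map] at h1
      have h2 : (1 : ℕ) ≤ p ^ (s + 1) := Nat.one_le_pow _ _ hp.out.pos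
      have h3 : (((p ^ (s + 1) - 1 : ℕ) : ℕ) : ℝ) = (p : ℝ) ^ (s + 1) - 1 := by
        push_cast [Nat.cast_sub h2]; rfl
      rw [← h3]
      exact_mod_cast h1
    · have h1 : (p : ℝ) * ((p ^ l + p ^ (l + 1) * p ^ s + e * p ^ (l + 1)) / (p ^ (s + 1) - 1)) -
          p ^ (l + 1) = p ^ (l + 1) * (2 + e * p) / (p ^ (s + 1) - 1) := by
        field_simp
        ring
      rw [h1, div_le_iff₀ hD]
      have h2 : (p : ℝ) ^ (s + 1) ≤ 2 * (p ^ (s + 1) - 1) := by linarith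
      have h3 : (p : ℝ) ^ (l + 1) ≤ √p ^ 6 * √p ^ (l + 1) * p ^ (s + 1) := by
        have hpp : ∀ n, (p : ℝ) ^ n = √p ^ (2 * n) := fun n => by rw [pow_mul, hss]
        rw [hpp, hpp, ← pow_add, ← pow_add]
        exact pow_le_pow_right₀ hs1 (by omega)
      calc (p : ℝ) ^ (l + 1) * (2 + e * p)
          ≤ √p ^ 6 * √p ^ (l + 1) * (2 * (p ^ (s + 1) - 1)) * (2 + e * p) := by
            refine mul_le_mul_of_nonneg_right (h3.trans ?_) (by positivity)
            gcongr
        _ = _ := by ring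

end FrobeniusSumBound

section LogDerivative

open Filter Topology in
/-- Inside the disc of convergence of a power series `Q`, a polynomial `(X - z) * Q` vanishes
at `z`. -/
lemma eval_eq_zero_of_coe_eq_mul {P : ℂ[X]} {Q : PowerSeries ℂ} {z : ℂ} {ρ A : ℝ} (hρ : 0 ≤ ρ)
    (hPQ : (P : PowerSeries ℂ) = ((X - C z : ℂ[X]) : PowerSeries ℂ) * Q)
    (hQ : ∀ n, ‖PowerSeries.coeff n Q‖ ≤ A * ρ ^ n) (hz : ‖z‖ * ρ < 1) : P.eval z = 0 := by
  have hcoeff0 : P.coeff 0 = -(z * PowerSeries.coeff 0 Q) := by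
    rw [← coeff_coe, hPQ, Polynomial.coe_sub, sub_mul, coe_X, coe_C, map_sub,
      PowerSeries.coeff_zero_X_mul, PowerSeries.coeff_C_mul, zero_sub]
  have hcoeff : ∀ n, P.coeff (n + 1) = PowerSeries.coeff n Q - z * PowerSeries.coeff (n + 1) Q := by
    intro n
    rw [← coeff_coe, hPQ, Polynomial.coe_sub, sub_mul, coe_X, coe_C, map_sub,
      PowerSeries.coeff_succ_X_mul, PowerSeries.coeff_C_mul]
  have hpartial : ∀ N, ∑ n ∈ Finset.range (N + 1), P.coeff n * z ^ n =
      -(PowerSeries.coeff N Q * z ^ (N + 1)) := by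
    intro N
    induction N with
    | zero => rw [Finset.sum_range_one, hcoeff0]; ring
    | succ N ih => rw [Finset.sum_range_succ, ih, hcoeff]; ring
  have hbound : ∀ N ≥ P.natDegree, ‖P.eval z‖ ≤ A * ‖z‖ * (‖z‖ * ρ) ^ N := by
    intro N hN
    rw [eval_eq_sum_range' (Nat.lt_succ_of_le hN), hpartial, norm_neg, norm_mul, norm_pow]
    calc _ ≤ A * ρ ^ N * ‖z‖ ^ (N + 1) := by gcongr; exact hQ N
      _ = _ := by ring
  have hlim : Tendsto (fun N => A * ‖z‖ * (‖z‖ * ρ) ^ N) atTop (𝓝 0) := by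
    simpa using (tendsto_pow_atTop_nhds_zero_of_lt_one (by positivity) hz).const_mul (A * ‖z‖)
  exact norm_le_zero_iff.1 (ge_of_tendsto hlim (eventually_atTop.2 ⟨_, hbound⟩))

/-- If the coefficients of the logarithmic derivative of a polynomial grow at most like `ρ ^ n`,
then the reciprocal roots have absolute value at most `ρ`. -/
lemma not_isRoot_of_log_derivative {L : ℂ[X]} (hL : L ≠ 0) {G : PowerSeries ℂ} {ρ B : ℝ}
    (hρ : 0 < ρ) (hG : ∀ n, ‖PowerSeries.coeff n G‖ ≤ B * ρ ^ n)
    (hLG : ((X * derivative L : ℂ[X]) : PowerSeries ℂ) = L * G) {z : ℂ} (hz0 : z ≠ 0)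
    (hz : ‖z‖ * ρ < 1) : ¬ L.IsRoot z := by
  intro hroot
  obtain ⟨M, hM, hMz⟩ := exists_eq_pow_rootMultiplicity_mul_and_not_dvd L hL z
  obtain ⟨r, hr⟩ : ∃ r, L.rootMultiplicity z = r + 1 :=
    ⟨_, (Nat.succ_pred_eq_of_pos ((rootMultiplicity_pos hL).2 hroot)).symm⟩
  rw [hr] at hM
  rw [dvd_iff_isRoot, IsRoot.def] at hMz
  set P : ℂ[X] := X * (C (r + 1 : ℂ) * M + (X - C z) * derivative M) with hP
  have hXL : X * derivative L = (X - C z) ^ r * P := by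
    rw [hM, derivative_mul, derivative_X_sub_C_pow, hP]
    push_cast
    ring
  have hPQ : (P : PowerSeries ℂ) = ((X - C z : ℂ[X]) : PowerSeries ℂ) * (M * G) := by
    have h0 : (((X - C z : ℂ[X]) ^ r : ℂ[X]) : PowerSeries ℂ) ≠ 0 := by
      rw [Ne, Polynomial.coe_eq_zero_iff]
      exact pow_ne_zero _ (X_sub_C_ne_zero z)
    apply mul_left_cancel₀ h0
    rw [← Polynomial.coe_mul, ← hXL, hLG]
    nth_rw 1 [hM]
    rw [pow_succ, Polynomial.coe_mul, Polynomial.coe_mul]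
    ring
  have hB : 0 ≤ B := by simpa using (norm_nonneg _).trans (hG 0)
  have hQ : ∀ n, ‖PowerSeries.coeff n ((M : PowerSeries ℂ) * G)‖ ≤
      (∑ i ∈ Finset.range (M.natDegree + 1), ‖M.coeff i‖ * (B * (ρ ^ i)⁻¹)) * ρ ^ n := by
    intro n
    rw [PowerSeries.coeff_mul, Finset.Nat.sum_antidiagonal_eq_sum_range_succ
      (fun i j => PowerSeries.coeff i (M : PowerSeries ℂ) * PowerSeries.coeff j G), Finset.sum_mul]
    refine (norm_sum_le _ _).trans ?_
    have hterm : ∀ i ∈ Finset.range (n + 1),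
        ‖PowerSeries.coeff i (M : PowerSeries ℂ) * PowerSeries.coeff (n - i) G‖ ≤
          ‖M.coeff i‖ * (B * (ρ ^ i)⁻¹) * ρ ^ n := by
      intro i hi
      rw [norm_mul, coeff_coe, mul_assoc]
      refine mul_le_mul_of_nonneg_left ((hG _).trans_eq ?_) (norm_nonneg _)
      rw [pow_sub₀ _ hρ.ne' (Nat.lt_succ_iff.1 (Finset.mem_range.1 hi))]
      ring
    refine (Finset.sum_le_sum hterm).trans ?_
    refine (Finset.sum_le_sum_of_subset_of_nonneg (Finset.range_subset_range.2
      (show n + 1 ≤ max (n + 1) (M.natDegree + 1) from le_max_left _ _))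
      fun i _ _ => by positivity).trans_eq ?_
    symm
    refine Finset.sum_subset (Finset.range_subset_range.2 (le_max_right _ _)) fun i _ hi => ?_
    rw [coeff_eq_zero_of_natDegree_lt (by simpa using hi)]
    simp
  have := eval_eq_zero_of_coe_eq_mul hρ.le hPQ hQ hz
  rw [hP] at this
  simp only [eval_mul, eval_X, eval_add, eval_C, eval_sub, sub_self, zero_mul, add_zero,
    mul_eq_zero, hz0, hMz, or_false, false_or] at this
  exact Nat.cast_add_one_ne_zero r this

lemma norm_coeff_one_le {c S : ℕ → ℂ} (h0 : c 0 = 1) {e : ℕ} (hc : ∀ n, e ≤ n → c n = 0)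
    (hrec : ∀ n : ℕ, (n : ℂ) * c n = ∑ k ∈ Finset.Icc 1 n, S k * c (n - k)) {ρ B : ℝ} (hρ : 0 < ρ)
    (hS : ∀ k, 0 < k → ‖S k‖ ≤ B * ρ ^ k) : ‖c 1‖ ≤ (e - 1 : ℕ) * ρ := by
  set L : ℂ[X] := ∑ i ∈ Finset.range e, C (c i) * X ^ i with hLdef
  have hLc : ∀ n, L.coeff n = c n := by
    intro n
    simp only [hLdef, finsetSum_coeff, coeff_C_mul_X_pow, Finset.sum_ite_eq, Finset.mem_range]
    split_ifs with h
    · rfl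
    · exact (hc n (not_lt.1 h)).symm
  have hL0 : L ≠ 0 := fun h => by
    have := hLc 0
    rw [h, h0] at this
    simp at this
  have hLe : L.eval 0 = 1 := by rw [← coeff_zero_eq_eval_zero, hLc, h0]
  have hdeg : L.natDegree ≤ e - 1 := natDegree_le_iff_coeff_eq_zero.2 fun n hn => by
    rw [hLc, hc n (by omega)]
  set G : PowerSeries ℂ := PowerSeries.mk fun k => if k = 0 then 0 else S k with hGdef
  have hB : 0 ≤ B := nonneg_of_mul_nonneg_left ((norm_nonneg _).trans (hS 1 one_pos)) (by positivity)
  have hG : ∀ n, ‖PowerSeries.coeff n G‖ ≤ B * ρ ^ n := by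
    intro n
    rw [hGdef, PowerSeries.coeff_mk]
    split_ifs with h
    · rw [norm_zero]; positivity
    · exact hS n (Nat.pos_of_ne_zero h)
  have hLG : ((X * derivative L : ℂ[X]) : PowerSeries ℂ) = L * G := by
    ext n
    rw [coeff_coe, mul_comm (L : PowerSeries ℂ), PowerSeries.coeff_mul,
      Finset.Nat.sum_antidiagonal_eq_sum_range_succ
        (fun i j => PowerSeries.coeff i G * PowerSeries.coeff j (L : PowerSeries ℂ))]
    have h1 : (X * derivative L).coeff n = n * c n := by
      rcases n with _ | n
      · simp
      · rw [coeff_X_mul, coeff_derivative, hLc]; push_cast; ring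
    rw [h1, hrec]
    have hsub : Finset.Icc 1 n ⊆ Finset.range (n + 1) := fun k hk => by
      simp only [Finset.mem_Icc, Finset.mem_range] at hk ⊢
      omega
    rw [← Finset.sum_subset hsub]
    · refine Finset.sum_congr rfl fun k hk => ?_
      rw [coeff_coe, hLc, hGdef, PowerSeries.coeff_mk, if_neg]
      have := (Finset.mem_Icc.1 hk).1
      omega
    · intro k hk hk'
      have : k = 0 := by
        simp only [Finset.mem_Icc, Finset.mem_range] at hk hk'
        omega
      simp [hGdef, this]
  have hroots : ∀ x ∈ L.roots.map fun z => 1 / (0 - z), ‖x‖ ≤ ρ := by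
    intro x hx
    obtain ⟨z, hz, rfl⟩ := Multiset.mem_map.1 hx
    have hroot := (mem_roots hL0).1 hz
    have hz0 : z ≠ 0 := by
      rintro rfl
      rw [IsRoot.def, hLe] at hroot
      exact one_ne_zero hroot
    have := not_lt.1 fun h => not_isRoot_of_log_derivative hL0 hρ hG hLG hz0 h hroot
    rw [zero_sub, norm_div, norm_neg, norm_one, div_le_iff₀ (norm_pos_iff.2 hz0)]
    linarith
  have hc1 : c 1 = (L.roots.map fun z => 1 / (0 - z)).sum := by
    rw [← (IsAlgClosed.splits L).eval_derivative_div_eval_of_ne_zero (by rw [hLe]; exact one_ne_zero),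
      hLe, div_one, ← coeff_zero_eq_eval_zero, coeff_derivative, hLc]
    simp
  rw [hc1]
  refine (norm_multiset_sum_le _).trans ((Multiset.sum_le_card_nsmul _ ρ ?_).trans ?_)
  · intro x hx
    obtain ⟨y, hy, rfl⟩ := Multiset.mem_map.1 hx
    exact hroots y hy
  · rw [Multiset.card_map, Multiset.card_map, nsmul_eq_mul]
    gcongr
    exact (card_roots' L).trans hdeg

end LogDerivative

section WeilBound

lemma frobSum_one {K : Type*} [Field K] (p : ℕ) [hp : Fact p.Prime] [Algebra (ZMod p) K] [CharP K p]
    {χ : AddChar K ℂ} (hχ : ∀ a, χ (algebraMap (ZMod p) K a) = ZMod.stdAddChar a) (g : (ZMod p)[X]) :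
    frobSum p χ (fun x => (g.map (algebraMap (ZMod p) K)).eval x) 1 =
      ∑ a, ZMod.stdAddChar (g.eval a) := by
  rw [frobSum]
  symm
  refine Finset.sum_bij (fun a _ => algebraMap (ZMod p) K a) (fun a _ => ?_)
    (fun a _ b _ hab => (algebraMap (ZMod p) K).injective hab) (fun x hx => ?_) (fun a _ => ?_)
  · rw [mem_frobFixed p one_pos, pow_one, ← map_pow, ZMod.pow_card]
  · rw [mem_frobFixed p one_pos, pow_one] at hx
    obtain ⟨a, ha⟩ := mem_range_algebraMap_of_pow_eq p hx
    exact ⟨a, Finset.mem_univ a, ha⟩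
  · rw [Finset.sum_range_one, pow_zero, pow_one, eval_map_apply, hχ]

/-- **Weil's bound** for additive character sums over prime fields. -/
theorem norm_sum_stdAddChar_eval_le (p : ℕ) [hp : Fact p.Prime] (g : (ZMod p)[X])
    (hg : 0 < g.natDegree) (hgp : g.natDegree < p) :
    ‖∑ a, ZMod.stdAddChar (g.eval a)‖ ≤ (g.natDegree - 1 : ℕ) * √p := by
  let K := AlgebraicClosure (ZMod p)
  have : CharP K p := charP_of_injective_algebraMap (algebraMap (ZMod p) K).injective p
  obtain ⟨l, hl⟩ := LinearMap.exists_leftInverse_of_injective (Algebra.linearMap (ZMod p) K)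
    (LinearMap.ker_eq_bot.2 (algebraMap (ZMod p) K).injective)
  let χ : AddChar K ℂ := (ZMod.stdAddChar (N := p)).compAddMonoidHom l.toAddMonoidHom
  have hχ : ∀ a, χ (algebraMap (ZMod p) K a) = ZMod.stdAddChar a := fun a =>
    congrArg ZMod.stdAddChar (LinearMap.congr_fun hl a)
  obtain ⟨B, hB⟩ := exists_norm_frobSum_le p hχ g hg hgp
  set G : K → K := fun x => (g.map (algebraMap (ZMod p) K)).eval x with hG
  have h1 := natCast_mul_lCoeff p χ G 1
  rw [Nat.cast_one, one_mul, Finset.Icc_self, Finset.sum_singleton, Nat.sub_self, lCoeff_zero,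
    mul_one, frobSum_one p hχ] at h1
  rw [← h1]
  refine norm_coeff_one_le (lCoeff_zero p χ G) (fun n hn => ?_) (natCast_mul_lCoeff p χ G)
    (Real.sqrt_pos.2 (by exact_mod_cast hp.out.pos)) hB
  have hlc : g.leadingCoeff * (g.natDegree : ZMod p) ≠ 0 := by
    refine mul_ne_zero (leadingCoeff_ne_zero.2 fun h => by simp [h] at hg) ?_
    rw [Ne, ZMod.natCast_eq_zero_iff]
    exact Nat.not_dvd_of_pos_of_lt hg hgp
  refine lCoeff_eq_zero p χ _ (by rwa [natDegree_map]) (by rwa [natDegree_map])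
    (-(g.leadingCoeff * (g.natDegree : ZMod p))⁻¹) ?_
  rw [natDegree_map, leadingCoeff_map, ← map_natCast (algebraMap (ZMod p) K), ← map_mul, ← map_mul,
    ← map_neg, hχ, mul_neg, neg_neg, mul_inv_cancel₀ hlc]
  intro h
  exact one_ne_zero (ZMod.injective_stdAddChar (h.trans (AddChar.map_zero_eq_one _).symm))

end WeilBound

section PrimePowerSums

lemma sum_range_mul_eq {M : Type*} [AddCommMonoid M] (F : ℕ → M) (a b : ℕ) :
    ∑ x ∈ Finset.range (a * b), F x = ∑ j ∈ Finset.range b, ∑ x ∈ Finset.range a, F (a * j + x) := by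
  induction b with
  | zero => simp
  | succ b ih => rw [Nat.mul_succ, Finset.sum_range_add, ih, Finset.sum_range_succ]

lemma sum_range_add_of_periodic {M : Type*} [AddCommGroup M] {F : ℕ → M} {N : ℕ}
    (hF : Function.Periodic F N) (c : ℕ) :
    ∑ x ∈ Finset.range N, F (x + c) = ∑ x ∈ Finset.range N, F x := by
  induction c with
  | zero => rfl
  | succ c ih =>
    have h1 := Finset.sum_range_succ (fun x => F (x + c)) N
    rw [Finset.sum_range_succ'] at h1
    rw [add_comm N c, hF c, zero_add] at h1
    rw [← ih, ← add_right_cancel h1]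
    exact Finset.sum_congr rfl fun x _ => by rw [add_right_comm, add_assoc]

/-- The additive character `a ↦ exp(2πi a / p ^ n)` on the integers. -/
noncomputable def powChar (p n : ℕ) (a : ℤ) : ℂ :=
  Complex.exp (2 * (Real.pi : ℂ) * Complex.I * (a : ℂ) / (p : ℂ) ^ n)

lemma expSum_eq (p n : ℕ) (f : ℤ[X]) :
    expSum p n f = ((p : ℂ) ^ n)⁻¹ * ∑ x ∈ Finset.range (p ^ n), powChar p n (f.eval (x : ℤ)) := rfl

lemma powChar_add (p n : ℕ) (a b : ℤ) : powChar p n (a + b) = powChar p n a * powChar p n b := by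
  rw [powChar, powChar, powChar, ← Complex.exp_add]
  congr 1
  push_cast
  ring

lemma norm_powChar (p n : ℕ) (a : ℤ) : ‖powChar p n a‖ = 1 := by
  rw [powChar, show 2 * (Real.pi : ℂ) * Complex.I * (a : ℂ) / (p : ℂ) ^ n =
    ((2 * Real.pi * a / p ^ n : ℝ) : ℂ) * Complex.I by push_cast; ring]
  exact Complex.norm_exp_ofReal_mul_I _

lemma norm_expSum_le_one (p n : ℕ) (hp : 0 < p) (f : ℤ[X]) : ‖expSum p n f‖ ≤ 1 := by
  have h0 : (0 : ℝ) < (p : ℝ) ^ n := by positivity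
  rw [expSum_eq, norm_mul, norm_inv, norm_pow, Complex.norm_natCast, inv_mul_le_iff₀ h0, mul_one]
  refine (norm_sum_le _ _).trans ?_
  simp [norm_powChar]

lemma norm_expSum_C_add (p n : ℕ) (a : ℤ) (f : ℤ[X]) : ‖expSum p n (C a + f)‖ = ‖expSum p n f‖ := by
  simp only [expSum_eq, eval_add, eval_C, powChar_add, ← Finset.mul_sum, norm_mul, norm_powChar,
    one_mul]

variable {p : ℕ} [hp : Fact p.Prime]

lemma powChar_pow_mul {n s : ℕ} (hs : s ≤ n) (a : ℤ) :
    powChar p n (p ^ s * a) = powChar p (n - s) a := by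
  have h0 : (p : ℂ) ≠ 0 := by exact_mod_cast hp.out.ne_zero
  rw [powChar, powChar]
  congr 1
  push_cast
  rw [← pow_sub_mul_pow (p : ℂ) hs]
  field_simp

lemma powChar_eq_of_dvd {n : ℕ} {a b : ℤ} (h : (p : ℤ) ^ n ∣ a - b) :
    powChar p n a = powChar p n b := by
  obtain ⟨c, hc⟩ := h
  rw [eq_add_of_sub_eq hc, powChar_add, powChar_pow_mul le_rfl, Nat.sub_self]
  have : powChar p 0 c = 1 := by
    rw [powChar, pow_zero, div_one, mul_comm]
    exact Complex.exp_int_mul_two_pi_mul_I c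
  rw [this, one_mul]

lemma periodic_powChar_eval (n : ℕ) (f : ℤ[X]) :
    Function.Periodic (fun x : ℕ => powChar p n (f.eval (x : ℤ))) (p ^ n) := by
  intro x
  refine powChar_eq_of_dvd ((Dvd.dvd.trans ?_) (sub_dvd_eval_sub _ _ f))
  push_cast
  simp

lemma expSum_pow_mul {n s : ℕ} (hs : s ≤ n) (f : ℤ[X]) :
    expSum p n (C ((p : ℤ) ^ s) * f) = expSum p (n - s) f := by
  have h0 : (p : ℂ) ≠ 0 := by exact_mod_cast hp.out.ne_zero
  have hper := periodic_powChar_eval (p := p) (n - s) f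
  rw [expSum_eq, expSum_eq]
  simp only [eval_mul, eval_C, powChar_pow_mul hs]
  rw [← pow_sub_mul_pow p hs, sum_range_mul_eq]
  have : ∀ j, ∑ x ∈ Finset.range (p ^ (n - s)),
      powChar p (n - s) (f.eval ((p ^ (n - s) * j + x : ℕ) : ℤ)) =
        ∑ x ∈ Finset.range (p ^ (n - s)), powChar p (n - s) (f.eval (x : ℤ)) := by
    intro j
    refine Finset.sum_congr rfl fun x _ => ?_
    rw [mul_comm, add_comm]
    exact hper.nat_mul j x
  simp only [this, Finset.sum_const, Finset.card_range, nsmul_eq_mul]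
  rw [← pow_sub_mul_pow (p : ℂ) hs]
  push_cast
  field_simp

/-- Splitting an exponential sum into residue classes modulo `p`. -/
lemma expSum_eq_sum_residues (n : ℕ) (f : ℤ[X]) :
    expSum p n f = (p : ℂ)⁻¹ * ∑ a ∈ Finset.range p,
      expSum p n (f.comp (C (a : ℤ) + C (p : ℤ) * X)) := by
  have h0 : (p : ℂ) ≠ 0 := by exact_mod_cast hp.out.ne_zero
  have hper := periodic_powChar_eval (p := p) n f
  simp only [expSum_eq, ← Finset.mul_sum, eval_comp, eval_add, eval_mul, eval_C, eval_X]
  have h1 := sum_range_mul_eq (fun x : ℕ => powChar p n (f.eval (x : ℤ))) p (p ^ n)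
  rw [mul_comm p, sum_range_mul_eq, Finset.sum_comm] at h1
  have h2 : ∀ j, ∀ x, powChar p n (f.eval ((p ^ n * j + x : ℕ) : ℤ)) =
      powChar p n (f.eval (x : ℤ)) := by
    intro j x
    rw [mul_comm, add_comm]
    exact hper.nat_mul j x
  simp only [h2, Finset.sum_const, Finset.card_range, nsmul_eq_mul, ← Finset.mul_sum] at h1
  rw [Finset.sum_comm] at h1
  have h3 : ∑ a ∈ Finset.range p, ∑ x ∈ Finset.range (p ^ n),
      powChar p n (f.eval ((a : ℤ) + p * (x : ℤ))) = p * ∑ x ∈ Finset.range (p ^ n),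
        powChar p n (f.eval (x : ℤ)) := by
    rw [h1]
    refine Finset.sum_congr rfl fun a _ => Finset.sum_congr rfl fun x _ => ?_
    push_cast
    rw [add_comm]
  rw [h3]
  field_simp

lemma sum_powChar_one_mul {b : ℤ} (hb : ¬ (p : ℤ) ∣ b) :
    ∑ t ∈ Finset.range p, powChar p 1 (t * b) = 0 := by
  set ζ := powChar p 1 b with hζ
  have hpow : ∀ t : ℕ, powChar p 1 (t * b) = ζ ^ t := by
    intro t
    induction t with
    | zero => simp [powChar]
    | succ t ih => rw [pow_succ, ← ih, hζ, ← powChar_add]; congr 1; push_cast; ring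
  have h1 : ζ ≠ 1 := by
    intro h
    have hst : ZMod.stdAddChar (N := p) ((b : ℤ) : ZMod p) = 1 := by
      rw [ZMod.stdAddChar_coe, ← h, hζ, powChar, pow_one]
    refine hb ((ZMod.intCast_zmod_eq_zero_iff_dvd b p).1 (ZMod.injective_stdAddChar (hst.trans ?_)))
    exact (AddChar.map_zero_eq_one _).symm
  have h2 : ζ ^ p = 1 := by
    rw [← hpow]
    have h3 := powChar_eq_of_dvd (p := p) (n := 1) (a := p * b) (b := 0) (by simp)
    rw [h3]
    simp [powChar]
  simp only [hpow]
  rw [geom_sum_eq h1, h2, sub_self, zero_div]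

/-- Residue classes containing no critical point modulo `p` do not contribute. -/
lemma expSum_comp_eq_zero {n : ℕ} (hn : 2 ≤ n) (f : ℤ[X]) (a : ℤ)
    (ha : ¬ (p : ℤ) ∣ f.derivative.eval a) : expSum p n (f.comp (C a + C (p : ℤ) * X)) = 0 := by
  have h0 : (p : ℂ) ≠ 0 := by exact_mod_cast hp.out.ne_zero
  set u := f.comp (C a + C (p : ℤ) * X) with hu
  have hueval : ∀ y : ℤ, u.eval y = f.eval (a + p * y) := fun y => by
    simp [hu, eval_comp]
  have hshift : ∀ t y : ℕ, powChar p n (u.eval ((y + p ^ (n - 2) * t : ℕ) : ℤ)) =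
      powChar p n (u.eval (y : ℤ)) * powChar p 1 (t * f.derivative.eval a) := by
    intro t y
    have h1 : (p : ℤ) ^ (n - 1) = p * p ^ (n - 2) := by
      rw [← pow_succ']; congr 1; omega
    have h2 : (p : ℤ) ^ n = p * (p * p ^ (n - 2)) := by
      rw [← pow_succ', ← pow_succ']; congr 1; omega
    have h3 : powChar p 1 (t * f.derivative.eval a) =
        powChar p n (p ^ (n - 1) * (t * f.derivative.eval a)) := by
      rw [powChar_pow_mul (Nat.sub_le n 1)]
      congr 1
      omega
    rw [h3, ← powChar_add]
    apply powChar_eq_of_dvd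
    obtain ⟨k, hk⟩ := f.binomExpansion (a + p * y) (p * p ^ (n - 2) * t)
    obtain ⟨l, hl⟩ := sub_dvd_eval_sub (a + p * y) a f.derivative
    rw [hueval, hueval]
    have h4 : a + p * ((y + p ^ (n - 2) * t : ℕ) : ℤ) = a + p * y + p * p ^ (n - 2) * t := by
      push_cast; ring
    rw [h4, hk, h1, h2, eq_add_of_sub_eq hl]
    exact ⟨y * l * t + k * p ^ (n - 2) * t ^ 2, by ring⟩
  have hsum : (p : ℂ) * ∑ y ∈ Finset.range (p ^ n), powChar p n (u.eval (y : ℤ)) = 0 := by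
    calc _ = ∑ t ∈ Finset.range p, ∑ y ∈ Finset.range (p ^ n),
          powChar p n (u.eval ((y + p ^ (n - 2) * t : ℕ) : ℤ)) := by
          simp only [sum_range_add_of_periodic (periodic_powChar_eval (p := p) n u),
            Finset.sum_const, Finset.card_range, nsmul_eq_mul]
      _ = _ := by
          simp only [hshift]
          rw [Finset.sum_comm]
          simp only [← Finset.mul_sum, sum_powChar_one_mul ha, mul_zero, Finset.sum_const_zero]
  rw [expSum_eq, (mul_eq_zero.1 hsum).resolve_left h0, mul_zero]

lemma expSum_one_eq (f : ℤ[X]) : expSum p 1 f =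
    (p : ℂ)⁻¹ * ∑ a, ZMod.stdAddChar ((f.map (Int.castRingHom (ZMod p))).eval a) := by
  rw [expSum_eq, pow_one, pow_one]
  congr 1
  refine Finset.sum_bij (fun x _ => (x : ZMod p)) (fun _ _ => Finset.mem_univ _)
    (fun x hx y hy hxy => ?_) (fun a _ => ⟨a.val, Finset.mem_range.2 (ZMod.val_lt a), by simp⟩)
    fun x _ => ?_
  · rw [ZMod.natCast_eq_natCast_iff] at hxy
    exact Nat.ModEq.eq_of_lt_of_lt hxy (Finset.mem_range.1 hx) (Finset.mem_range.1 hy)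
  · have : (f.map (Int.castRingHom (ZMod p))).eval ((x : ℕ) : ZMod p) =
        ((f.eval (x : ℤ) : ℤ) : ZMod p) := by simp
    rw [this, ZMod.stdAddChar_coe, powChar, pow_one]

end PrimePowerSums

section CriticalPoints

lemma coeff_taylor_C_add_pow_mul (p : ℕ) (a : ℤ) (s : ℕ) (h : ℤ[X]) (z : ℤ) {k : ℕ} (hk : k ≠ 0) :
    (taylor z (C a + C ((p : ℤ) ^ s) * h)).coeff k = (p : ℤ) ^ s * (taylor z h).coeff k := by
  rw [map_add, taylor_C, coeff_add, coeff_C_of_ne_zero hk, zero_add, taylor_mul, taylor_C, coeff_C_mul]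

variable {p : ℕ} [hp : Fact p.Prime]

local notation "red" => Polynomial.map (Int.castRingHom (ZMod p))

lemma exists_eq_C_add_pow_mul {q : ℤ[X]} (hq : q.natDegree ≠ 0) :
    ∃ (s : ℕ) (h : ℤ[X]), q = C (q.coeff 0) + C ((p : ℤ) ^ s) * h ∧ 0 < (red h).natDegree := by
  have hq0 : q - C (q.coeff 0) ≠ 0 := fun h => hq (by rw [sub_eq_zero.1 h, natDegree_C])
  have hpz : (p : ℤ) ≠ 0 := by exact_mod_cast hp.out.ne_zero
  have hunit : ¬ IsUnit (C (p : ℤ)) := by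
    rw [isUnit_C, Int.isUnit_iff]
    have := hp.out.two_le
    omega
  obtain ⟨h, hh, hndvd⟩ :=
    (FiniteMultiplicity.of_not_isUnit hunit hq0).exists_eq_pow_mul_and_not_dvd
  set s := multiplicity (C (p : ℤ)) (q - C (q.coeff 0))
  rw [← C_pow] at hh
  refine ⟨s, h, by rw [← hh]; ring, Nat.pos_of_ne_zero fun hdeg => hndvd ?_⟩
  have hc0 : h.coeff 0 = 0 := by
    have := congrArg (fun r => coeff r 0) hh
    simp only [coeff_sub, coeff_C_zero, sub_self, coeff_C_mul] at this
    exact (mul_eq_zero.1 this.symm).resolve_left (pow_ne_zero _ hpz)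
  rw [C_dvd_iff_dvd_coeff]
  intro i
  rw [← ZMod.intCast_zmod_eq_zero_iff_dvd]
  rcases Nat.eq_zero_or_pos i with rfl | hi
  · rw [hc0, Int.cast_zero]
  · have := coeff_eq_zero_of_natDegree_lt (p := red h) (n := i) (by omega)
    simpa using this

variable (p) in
/-- The bound for sums modulo `p ^ n`, where `m` bounds the number of critical points modulo `p`,
and `B` is a lower bound for the size of the higher Taylor coefficients of `p ^ (-n) g`. -/
def CriticalBound (n : ℕ) : Prop :=
  ∀ (g : ℤ[X]) (m : ℕ) (B : ℝ), 0 < (red g).natDegree → (red g).natDegree < p →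
    (red g).natDegree ≤ m + 1 → 1 ≤ m → 0 ≤ B →
    (∀ z : ℤ, ∃ k ≥ 2, B ^ k ≤ (p : ℝ) ^ n * ‖(((taylor z g).coeff k : ℤ) : ℚ_[p])‖) →
    B * ‖expSum p n g‖ ≤ m

lemma norm_intCast_pow_mul (s : ℕ) (c : ℤ) :
    ‖(((p : ℤ) ^ s * c : ℤ) : ℚ_[p])‖ = ((p : ℝ) ^ s)⁻¹ * ‖(c : ℚ_[p])‖ := by
  push_cast
  rw [norm_mul, norm_pow, Padic.norm_p, inv_pow]

lemma mul_norm_expSum_le_of_reduction {n s m : ℕ} {a : ℤ} {h : ℤ[X]} {B : ℝ}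
    (hrec : s ≤ n → CriticalBound p (n - s)) (h1 : 0 < (red h).natDegree)
    (h2 : (red h).natDegree < p) (h3 : (red h).natDegree ≤ m + 1) (hm : 1 ≤ m) (hB : 0 ≤ B)
    (hT : ∀ z : ℤ, ∃ k ≥ 2, B ^ k ≤ (p : ℝ) ^ n *
      ‖(((taylor z (C a + C ((p : ℤ) ^ s) * h)).coeff k : ℤ) : ℚ_[p])‖) :
    B * ‖expSum p n (C a + C ((p : ℤ) ^ s) * h)‖ ≤ m := by
  have hp0 : (0 : ℝ) < p := by exact_mod_cast hp.out.pos
  have hp1 : (1 : ℝ) ≤ p := by exact_mod_cast hp.out.one_lt.le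
  rcases le_or_gt s n with hs | hs
  · rw [norm_expSum_C_add, expSum_pow_mul hs]
    refine hrec hs h m B h1 h2 h3 hm hB fun z => ?_
    obtain ⟨k, hk, hk'⟩ := hT z
    refine ⟨k, hk, hk'.trans_eq ?_⟩
    rw [coeff_taylor_C_add_pow_mul _ _ _ _ _ (by omega), norm_intCast_pow_mul, ← mul_assoc,
      pow_sub₀ _ hp0.ne' hs]
  · obtain ⟨k, hk, hk'⟩ := hT 0
    have hB1 : B ≤ 1 := by
      rw [← pow_le_one_iff_of_nonneg hB (show k ≠ 0 by omega)]
      refine hk'.trans ?_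
      rw [coeff_taylor_C_add_pow_mul _ _ _ _ _ (by omega), norm_intCast_pow_mul, ← mul_assoc]
      refine mul_le_one₀ ?_ (norm_nonneg _) (Padic.norm_int_le_one _)
      rw [mul_inv_le_iff₀ (by positivity), one_mul]
      exact pow_le_pow_right₀ hp1 hs.le
    calc _ ≤ (1 : ℝ) * 1 := mul_le_mul hB1 (norm_expSum_le_one p n hp.out.pos _) (norm_nonneg _) one_pos.le
      _ ≤ m := by rw [mul_one]; exact_mod_cast hm

lemma coeff_taylor_rootMultiplicity_ne_zero {q : (ZMod p)[X]} (hq : derivative q ≠ 0) (a : ZMod p) :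
    (taylor a q).coeff ((derivative q).rootMultiplicity a + 1) ≠ 0 := by
  intro h
  have h1 : (taylor a (derivative q)).coeff ((derivative q).rootMultiplicity a) = 0 := by
    have : taylor a (derivative q) = derivative (taylor a q) := by
      simp [taylor_apply, derivative_comp]
    rw [this, coeff_derivative, h, zero_mul]
  rw [rootMultiplicity_eq_natTrailingDegree, ← taylor_apply] at h1
  refine hq ?_
  rw [← taylor_eq_zero a]
  exact (trailingCoeff_eq_zero).1 h1

lemma derivative_ne_zero_of_natDegree_lt {q : (ZMod p)[X]} (h1 : 0 < q.natDegree)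
    (h2 : q.natDegree < p) : derivative q ≠ 0 := by
  intro h
  have := congrArg (fun r => coeff r (q.natDegree - 1)) h
  simp only [coeff_derivative, coeff_zero] at this
  rw [Nat.sub_add_cancel h1, ← Nat.cast_add_one, Nat.sub_add_cancel h1, mul_eq_zero] at this
  rcases this with h3 | h3
  · rw [coeff_natDegree, leadingCoeff_eq_zero] at h3
    simp [h3] at h1
  · rw [ZMod.natCast_eq_zero_iff] at h3
    exact Nat.not_dvd_of_pos_of_lt h1 h2 h3

lemma coeff_taylor_comp (g : ℤ[X]) (a b z : ℤ) (k : ℕ) :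
    (taylor z (g.comp (C a + C b * X))).coeff k = b ^ k * (taylor (a + b * z) g).coeff k := by
  have : taylor z (g.comp (C a + C b * X)) = (taylor (a + b * z) g).comp (C b * X) := by
    rw [taylor_apply, taylor_apply, comp_assoc, comp_assoc]
    congr 1
    simp
    ring
  rw [this, comp_C_mul_X_coeff, mul_comm]

/-- The contribution of a residue class is bounded by the multiplicity of the critical point. -/
lemma mul_norm_expSum_comp_le {n : ℕ} (hn : 2 ≤ n) (ih : ∀ l < n, CriticalBound p l) {g : ℤ[X]}
    {B : ℝ} (h1 : 0 < (red g).natDegree) (h2 : (red g).natDegree < p) (hB : 0 ≤ B)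
    (hT : ∀ z : ℤ, ∃ k ≥ 2, B ^ k ≤ (p : ℝ) ^ n * ‖(((taylor z g).coeff k : ℤ) : ℚ_[p])‖) (a : ℕ) :
    B / p * ‖expSum p n (g.comp (C (a : ℤ) + C (p : ℤ) * X))‖ ≤
      ((derivative (red g)).rootMultiplicity (a : ZMod p) : ℕ) := by
  have hp0 : (0 : ℝ) < p := by exact_mod_cast hp.out.pos
  have hpz : (p : ℤ) ≠ 0 := by exact_mod_cast hp.out.ne_zero
  have hD := derivative_ne_zero_of_natDegree_lt h1 h2
  set m := (derivative (red g)).rootMultiplicity (a : ZMod p) with hm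
  set u := g.comp (C (a : ℤ) + C (p : ℤ) * X) with hu
  rcases Nat.eq_zero_or_pos m with hm0 | hm0
  · rw [expSum_comp_eq_zero hn g a, norm_zero, mul_zero]
    · positivity
    · rw [← ZMod.intCast_zmod_eq_zero_iff_dvd]
      intro h
      refine absurd hm0 ((rootMultiplicity_pos hD).2 ?_).ne'
      rw [IsRoot.def, ← h, derivative_map]
      simp
  have hmdeg : m + 1 ≤ (red g).natDegree := by
    have h3 : m ≤ (derivative (red g)).natDegree := by
      have := natDegree_le_of_dvd (pow_rootMultiplicity_dvd (derivative (red g)) (a : ZMod p)) hD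
      rwa [natDegree_pow, natDegree_X_sub_C, mul_one] at this
    have := natDegree_derivative_lt h1.ne'
    omega
  have hcu : ∀ k, u.coeff k = (p : ℤ) ^ k * (taylor (a : ℤ) g).coeff k := fun k => by
    have := coeff_taylor_comp g a p 0 k
    rwa [taylor_zero, mul_zero, add_zero] at this
  have hunit : ¬ (p : ℤ) ∣ (taylor (a : ℤ) g).coeff (m + 1) := by
    rw [← ZMod.intCast_zmod_eq_zero_iff_dvd]
    have h3 : taylor (a : ZMod p) (red g) = red (taylor (a : ℤ) g) := by
      simp [taylor_apply, Polynomial.map_comp]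
    have h4 := coeff_taylor_rootMultiplicity_ne_zero hD (a : ZMod p)
    rwa [h3, coeff_map, eq_intCast] at h4
  have hudeg : u.natDegree ≠ 0 := by
    intro h
    have h3 := coeff_eq_zero_of_natDegree_lt (p := u) (n := m + 1) (by omega)
    rw [hcu] at h3
    exact hunit ((mul_eq_zero.1 h3).resolve_left (pow_ne_zero _ hpz) ▸ dvd_zero _)
  obtain ⟨s, h, huh, hdeg⟩ := exists_eq_C_add_pow_mul (p := p) hudeg
  have hch : ∀ k, k ≠ 0 → (p : ℤ) ^ s * h.coeff k = (p : ℤ) ^ k * (taylor (a : ℤ) g).coeff k := by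
    intro k hk
    rw [← hcu]
    conv_rhs => rw [huh]
    rw [coeff_add, coeff_C_of_ne_zero hk, zero_add, coeff_C_mul]
  have hs : s ≤ m + 1 := by
    by_contra! hlt
    have h3 := hch (m + 1) (by omega)
    rw [← Nat.add_sub_cancel' hlt.le, pow_add, mul_assoc] at h3
    have h4 := mul_left_cancel₀ (pow_ne_zero _ hpz) h3
    refine hunit (h4 ▸ ((dvd_pow_self _ (by omega)).mul_right _))
  have hred : ∀ k, s < k → (red h).coeff k = 0 := by
    intro k hk
    have h3 := hch k (by omega)
    rw [← Nat.add_sub_cancel' hk.le, pow_add, mul_assoc, Nat.add_sub_cancel' hk.le] at h3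
    have h4 := mul_left_cancel₀ (pow_ne_zero _ hpz) h3
    rw [coeff_map, eq_intCast, ZMod.intCast_zmod_eq_zero_iff_dvd, h4]
    exact (dvd_pow_self _ (by omega)).mul_right _
  have hdle : (red h).natDegree ≤ s := natDegree_le_iff_coeff_eq_zero.2 hred
  rw [huh]
  refine mul_norm_expSum_le_of_reduction (fun hsn => ih _ (by omega)) hdeg (by omega) (by omega) hm0
    (by positivity) fun z => ?_
  rw [← huh]
  obtain ⟨k, hk, hk'⟩ := hT (a + p * z)
  refine ⟨k, hk, ?_⟩
  rw [hu, coeff_taylor_comp, norm_intCast_pow_mul, div_pow, div_le_iff₀ (by positivity)]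
  refine hk'.trans_eq ?_
  field_simp

lemma criticalBound_zero : CriticalBound p 0 := by
  intro g m B _ _ _ hm hB hT
  obtain ⟨k, hk, hk'⟩ := hT 0
  have hB1 : B ≤ 1 := by
    rw [← pow_le_one_iff_of_nonneg hB (show k ≠ 0 by omega)]
    refine hk'.trans ?_
    rw [pow_zero, one_mul]
    exact Padic.norm_int_le_one _
  calc _ ≤ (1 : ℝ) * 1 := mul_le_mul hB1 (norm_expSum_le_one p 0 hp.out.pos _) (norm_nonneg _) one_pos.le
    _ ≤ m := by rw [mul_one]; exact_mod_cast hm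

lemma criticalBound_one : CriticalBound p 1 := by
  intro g m B h1 h2 h3 hm hB hT
  have hp0 : (0 : ℝ) < p := by exact_mod_cast hp.out.pos
  have hp1 : (1 : ℝ) ≤ p := by exact_mod_cast hp.out.one_lt.le
  have hss : √(p : ℝ) ^ 2 = p := Real.sq_sqrt hp0.le
  obtain ⟨k, hk, hk'⟩ := hT 0
  have hBp : B ≤ √p := by
    by_contra! hlt
    have h4 : B ^ k ≤ p := hk'.trans (by
      rw [pow_one]
      exact mul_le_of_le_one_right hp0.le (Padic.norm_int_le_one _))
    have h5 : 1 ≤ B := (Real.one_le_sqrt.2 hp1).trans hlt.le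
    have h6 : √(p : ℝ) ^ 2 < B ^ 2 := pow_lt_pow_left₀ hlt (Real.sqrt_nonneg _) two_ne_zero
    have h7 : B ^ 2 ≤ B ^ k := pow_le_pow_right₀ h5 hk
    linarith
  have hW := norm_sum_stdAddChar_eval_le p (red g) h1 h2
  rw [expSum_one_eq, norm_mul, norm_inv, Complex.norm_natCast]
  calc _ ≤ √(p : ℝ) * ((p : ℝ)⁻¹ * (((red g).natDegree - 1 : ℕ) * √p)) := by gcongr
    _ = ((red g).natDegree - 1 : ℕ) * (√(p : ℝ) ^ 2 * (p : ℝ)⁻¹) := by ring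
    _ = ((red g).natDegree - 1 : ℕ) := by rw [hss, mul_inv_cancel₀ hp0.ne', mul_one]
    _ ≤ m := by exact_mod_cast (by omega)

lemma sum_rootMultiplicity_le (q : (ZMod p)[X]) :
    ∑ a ∈ Finset.range p, q.rootMultiplicity (a : ZMod p) ≤ q.natDegree := by
  have h1 : ∑ a ∈ Finset.range p, q.rootMultiplicity (a : ZMod p) =
      ∑ a : ZMod p, q.roots.count a := by
    refine Finset.sum_bij (fun x _ => (x : ZMod p)) (fun _ _ => Finset.mem_univ _)
      (fun x hx y hy hxy => ?_) (fun a _ => ⟨a.val, Finset.mem_range.2 (ZMod.val_lt a), by simp⟩)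
      fun x _ => (count_roots q).symm
    rw [ZMod.natCast_eq_natCast_iff] at hxy
    exact Nat.ModEq.eq_of_lt_of_lt hxy (Finset.mem_range.1 hx) (Finset.mem_range.1 hy)
  rw [h1, Multiset.sum_count_eq_card fun a _ => Finset.mem_univ a]
  exact card_roots' q

lemma criticalBound (n : ℕ) : CriticalBound p n := by
  induction n using Nat.strong_induction_on with
  | _ n ih =>
    rcases n with _ | _ | n
    · exact criticalBound_zero
    · exact criticalBound_one
    intro g m B h1 h2 h3 hm hB hT
    have hp0 : (0 : ℝ) < p := by exact_mod_cast hp.out.pos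
    have hD := derivative_ne_zero_of_natDegree_lt h1 h2
    rw [expSum_eq_sum_residues, norm_mul, norm_inv, Complex.norm_natCast, ← mul_assoc,
      ← div_eq_mul_inv]
    calc _ ≤ B / p * ∑ a ∈ Finset.range p,
          ‖expSum p (n + 1 + 1) (g.comp (C (a : ℤ) + C (p : ℤ) * X))‖ := by
          gcongr
          exact norm_sum_le _ _
      _ ≤ ∑ a ∈ Finset.range p,
          (((derivative (red g)).rootMultiplicity (a : ZMod p) : ℕ) : ℝ) := by
          rw [Finset.mul_sum]
          exact Finset.sum_le_sum fun a _ =>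
            mul_norm_expSum_comp_le (by omega) ih h1 h2 hB hT a
      _ ≤ m := by
          have h4 := sum_rootMultiplicity_le (derivative (red g))
          have h5 := natDegree_derivative_lt h1.ne'
          exact_mod_cast (by omega)

end CriticalPoints

section Main

variable {p : ℕ} [hp : Fact p.Prime]

lemma iterate_derivative_padicScaled_div (m k : ℕ) (f : ℤ[X]) (z : ℤ) :
    (derivative^[k] (padicScaled p m f)).eval (((z : ℤ_[p])) : ℚ_[p]) / (k.factorial : ℚ_[p]) =
      ((p : ℚ_[p]) ^ m)⁻¹ * (((taylor z f).coeff k : ℤ) : ℚ_[p]) := by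
  have hk : (k.factorial : ℚ_[p]) ≠ 0 := by exact_mod_cast k.factorial_ne_zero
  have hz : ((derivative^[k] f).eval z : ℤ) = k.factorial * (taylor z f).coeff k := by
    rw [← factorial_smul_hasseDeriv, taylor_coeff, ← nsmul_eq_mul, ← eval_smul]
    rfl
  rw [padicScaled, iterate_derivative_C_mul, iterate_derivative_map, eval_mul, eval_C,
    PadicInt.coe_intCast, eval_intCast_map, eq_intCast, Int.cast_id, hz]
  push_cast
  field_simp

lemma Jinf_le (P : ℚ_[p][X]) (z : ℤ_[p]) : Jinf P ≤ Jfun P z :=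
  ciInf_le (OrderBot.bddBelow _) z

lemma exists_Jinf_pow_le {m : ℕ} {f : ℤ[X]} (hJ : 0 < Jinf (padicScaled p m f)) (z : ℤ) :
    ∃ k ≥ 2, (Jinf (padicScaled p m f) : ℝ) ^ k ≤
      (p : ℝ) ^ m * ‖(((taylor z f).coeff k : ℤ) : ℚ_[p])‖ := by
  set P := padicScaled p m f with hP
  have hle := Jinf_le P (z : ℤ_[p])
  rw [Jfun] at hle
  have hne : (Finset.Icc 2 P.natDegree).Nonempty := by
    rw [Finset.nonempty_iff_ne_empty]
    intro h
    rw [h, Finset.sup_empty] at hle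
    exact absurd hJ (not_lt.2 hle)
  obtain ⟨k, hk, hsup⟩ := Finset.exists_mem_eq_sup _ hne fun k =>
    ‖(derivative^[k] P).eval ((z : ℤ_[p]) : ℚ_[p]) / (k.factorial : ℚ_[p])‖₊ ^ ((1 : ℝ) / (k : ℝ))
  rw [hsup, hP, iterate_derivative_padicScaled_div, ← hP] at hle
  have hk2 := (Finset.mem_Icc.1 hk).1
  refine ⟨k, hk2, ?_⟩
  have h1 := pow_le_pow_left' hle k
  rw [one_div, NNReal.rpow_inv_natCast_pow _ (by omega)] at h1
  have h2 : ((Jinf P : ℝ)) ^ k ≤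
      ‖((p : ℚ_[p]) ^ m)⁻¹ * (((taylor z f).coeff k : ℤ) : ℚ_[p])‖ := by exact_mod_cast h1
  rwa [norm_mul, norm_inv, norm_pow, Padic.norm_p, inv_pow, inv_inv] at h2

lemma Jinf_mul_norm_expSum_le {m : ℕ} {f : ℤ[X]} (h1 : 1 ≤ f.natDegree) (hfp : f.natDegree < p) :
    (Jinf (padicScaled p m f) : ℝ) * ‖expSum p m f‖ ≤ f.natDegree := by
  rcases eq_zero_or_pos (Jinf (padicScaled p m f)) with hJ | hJ
  · rw [hJ, NNReal.coe_zero, zero_mul]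
    positivity
  obtain ⟨s, h, hfh, hdeg⟩ := exists_eq_C_add_pow_mul (p := p) (q := f) (by omega)
  have hle : (h.map (Int.castRingHom (ZMod p))).natDegree ≤ f.natDegree := by
    refine natDegree_map_le.trans (natDegree_le_iff_coeff_eq_zero.2 fun k hk => ?_)
    have h3 := coeff_eq_zero_of_natDegree_lt hk
    rw [hfh, coeff_add, coeff_C_of_ne_zero (by omega), zero_add, coeff_C_mul] at h3
    exact (mul_eq_zero.1 h3).resolve_left (pow_ne_zero _ (by exact_mod_cast hp.out.ne_zero))
  have := mul_norm_expSum_le_of_reduction (n := m) (s := s) (m := f.natDegree) (a := f.coeff 0)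
    (B := (Jinf (padicScaled p m f) : ℝ)) (fun _ => criticalBound _) hdeg (by omega) (by omega) h1
    (NNReal.coe_nonneg _) fun z => by
      rw [← hfh]
      exact exists_Jinf_pow_le hJ z
  rwa [← hfh] at this

end Main

/-- For every `d ≥ 1` there is `C_d > 0` such that for every prime `p > d`, every `f ∈ ℤ[X]` of
degree `d` and every `m ≥ 1`, `max(1, J_{p^{-m}f}) · |S_m(f)| ≤ C_d`. -/
theorem exp_sum_upper_bound :
    ∀ d : ℕ, 1 ≤ d → ∃ C : ℝ, 0 < C ∧
      ∀ (p : ℕ) [Fact p.Prime], d < p →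
        ∀ f : Polynomial ℤ, f.natDegree = d →
          ∀ m : ℕ, 1 ≤ m →
            max 1 ((Jinf (padicScaled p m f) : ℝ)) * ‖expSum p m f‖ ≤ C := by
  intro d hd
  refine ⟨d, by exact_mod_cast hd, fun p hp hdp f hf m _ => ?_⟩
  subst hf
  rw [max_mul_of_nonneg _ _ (norm_nonneg _), one_mul]
  refine max_le ((norm_expSum_le_one p m hp.out.pos f).trans ?_) (Jinf_mul_norm_expSum_le hd hdp)
  exact_mod_cast hd
end

section
/- For every integer d ≥ 1 there exists a constant C_d > 0, depending only on d, such that for every prime p > d, every f ∈ ℤ[X] of degree d, and every m ≥ 1, one has both H_{p^{-m}f} · |S_m(f)| ≤ C_d · √p and J_{p^{-m}f} · |S_m(f)| ≤ C_d. -/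
open Polynomial

/-- `H_P(z) = max_{1 ≤ k ≤ deg P} |P^{(k)}(z)/k!|^{1/k}` (empty max = 0). -/
noncomputable def Hfun {p : ℕ} [Fact p.Prime] (P : Polynomial ℚ_[p]) (z : ℤ_[p]) : NNReal :=
  (Finset.Icc 1 P.natDegree).sup fun k =>
    ‖(derivative^[k] P).eval (z : ℚ_[p]) / (k.factorial : ℚ_[p])‖₊ ^ ((1 : ℝ) / (k : ℝ))

/-- `H_P = inf_{z ∈ ℤ_p} H_P(z)`. -/
noncomputable def Hinf {p : ℕ} [Fact p.Prime] (P : Polynomial ℚ_[p]) : NNReal :=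
  ⨅ z : ℤ_[p], Hfun P z

namespace WeilBound

section Stepanov

variable {K : Type} [Field K]

/-- The affine Artin–Schreier curve `y ^ p - y = f x`. -/
def Curve (p : ℕ) (f : K[X]) : Type := {v : K × K // v.2 ^ p - v.2 = f.eval v.1}

/-- The monomial function `x ^ i * y ^ j` on the Artin–Schreier curve. -/
def mono (p : ℕ) (f : K[X]) (i j : ℕ) : Curve p f → K := fun v => v.1.1 ^ i * v.1.2 ^ j

/-- The functions on the curve spanned by the reduced monomials of weight below `W`, where
`x` has weight `p` and `y` has weight `deg f`. -/
def fil (p : ℕ) (f : K[X]) (W : ℕ) : Submodule K (Curve p f → K) :=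
  Submodule.span K {u | ∃ i j, j < p ∧ p * i + f.natDegree * j < W ∧ u = mono p f i j}

lemma mono_add_p (p : ℕ) (f : K[X]) (i j : ℕ) :
    mono p f i (j + p) = mono p f i (j + 1) +
      ∑ k ∈ Finset.range (f.natDegree + 1), f.coeff k • mono p f (i + k) j := by
  funext v
  have hv := v.2
  rw [sub_eq_iff_eq_add, eval_eq_sum_range] at hv
  simp only [mono, Pi.add_apply, Finset.sum_apply, Pi.smul_apply, smul_eq_mul]
  rw [pow_add _ j p, hv, mul_add, mul_add, Finset.mul_sum, Finset.mul_sum, add_comm]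
  congr 1
  · ring
  · exact Finset.sum_congr rfl fun k _ => by ring

lemma mono_mem_fil {p : ℕ} (hp : 2 ≤ p) {f : K[X]} (j : ℕ) :
    ∀ i W, p * i + f.natDegree * j < W → mono p f i j ∈ fil p f W := by
  induction j using Nat.strong_induction_on with
  | _ j ih =>
    intro i W hW
    rcases lt_or_ge j p with hj | hj
    · exact Submodule.subset_span ⟨i, j, hj, hW, rfl⟩
    · obtain ⟨j, rfl⟩ := Nat.exists_eq_add_of_le' hj
      rw [mono_add_p]
      refine Submodule.add_mem _ (ih _ (by omega) _ _ ?_)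
        (Submodule.sum_mem _ fun k hk => Submodule.smul_mem _ _ (ih _ (by omega) _ _ ?_))
      · refine lt_of_le_of_lt ?_ hW
        gcongr; omega
      · refine lt_of_le_of_lt ?_ hW
        have : k ≤ f.natDegree := by simpa [Nat.lt_succ_iff] using hk
        nlinarith

lemma mono_add_mul_sub_mem {p : ℕ} (hp : 2 ≤ p) {f : K[X]} (hf : 0 < f.natDegree) (i j : ℕ)
    (k : ℕ) : mono p f i (j + p * k) - f.leadingCoeff ^ k • mono p f (i + f.natDegree * k) j ∈
      fil p f (p * i + f.natDegree * (j + p * k)) := by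
  induction k generalizing i with
  | zero => simp
  | succ k ih =>
    have h1 : mono p f i (j + p * (k + 1)) -
        f.leadingCoeff • mono p f (i + f.natDegree) (j + p * k) ∈
        fil p f (p * i + f.natDegree * (j + p * (k + 1))) := by
      rw [show j + p * (k + 1) = (j + p * k) + p by ring, mono_add_p, Finset.sum_range_succ,
        leadingCoeff, ← add_assoc, add_sub_cancel_right]
      refine Submodule.add_mem _ (mono_mem_fil hp _ _ _ ?_)
        (Submodule.sum_mem _ fun l hl => Submodule.smul_mem _ _ (mono_mem_fil hp _ _ _ ?_))
      · have : f.natDegree * (j + p * k + 1) < f.natDegree * (j + p * k + p) := by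
          gcongr; omega
        omega
      · have hl : l < f.natDegree := by simpa using hl
        have : p * l < p * f.natDegree := by gcongr
        nlinarith
    have h2 := Submodule.smul_mem _ f.leadingCoeff (ih (i + f.natDegree))
    rw [show p * (i + f.natDegree) + f.natDegree * (j + p * k) =
      p * i + f.natDegree * (j + p * (k + 1)) by ring] at h2
    have h3 := Submodule.add_mem _ h1 h2
    rw [smul_sub, smul_smul, ← pow_succ', sub_add_sub_cancel] at h3
    convert h3 using 4
    ring

lemma exists_coeffs_of_mem_fil {p : ℕ} {f : K[X]} {W : ℕ} {u : Curve p f → K}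
    (hu : u ∈ fil p f W) : ∃ g : ℕ → K[X],
      (∀ v, u v = ∑ j ∈ Finset.range p, (g j).eval v.1.1 * v.1.2 ^ j) ∧
      ∀ i j, (g j).coeff i ≠ 0 → p * i + f.natDegree * j < W := by
  induction hu using Submodule.span_induction with
  | mem u hu =>
    obtain ⟨i, j, hj, hw, rfl⟩ := hu
    refine ⟨fun l => if l = j then X ^ i else 0, fun v => ?_, fun i' j' h => ?_⟩
    · rw [Finset.sum_eq_single_of_mem j (by simpa using hj)]
      · simp [mono]
      · intro b _ hb; simp [hb]
    · by_cases hj' : j' = j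
      · subst hj'
        by_cases hi : i' = i
        · simpa [hi] using hw
        · simp [coeff_X_pow, hi] at h
      · simp [hj'] at h
  | zero => exact ⟨0, by simp, by simp⟩
  | add u u' _ _ h h' =>
    obtain ⟨g, hg, hg'⟩ := h
    obtain ⟨k, hk, hk'⟩ := h'
    refine ⟨g + k, fun v => ?_, fun i j h => ?_⟩
    · simp [hg, hk, add_mul, Finset.sum_add_distrib]
    · by_cases h0 : (g j).coeff i = 0
      · exact hk' i j fun h1 => h (by simp [h0, h1])
      · exact hg' i j h0
  | smul a u _ h =>
    obtain ⟨g, hg, hg'⟩ := h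
    refine ⟨fun j => C a * g j, fun v => ?_, fun i j h => hg' i j fun h0 => h (by simp [h0])⟩
    simp [hg, Finset.mul_sum, mul_assoc]

/-- If a reduced monomial of weight `W` is cancelled, as a function on the curve, by monomials of
smaller weight, then the curve has few fibres. -/
lemma card_fibres_le {p : ℕ} [hp : Fact p.Prime] [CharP K p]
    {f : K[X]}
    (Z : Finset K) (hZ : ∀ x ∈ Z, ∃ y, y ^ p - y = f.eval x) {c : K} (hc : c ≠ 0) {i₀ j₀ : ℕ}
    (hj₀ : j₀ < p) (h : c • mono p f i₀ j₀ ∈ fil p f (p * i₀ + f.natDegree * j₀)) :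
    Z.card ≤ i₀ := by
  obtain ⟨g, hg, hg'⟩ := exists_coeffs_of_mem_fil h
  set k : ℕ → K[X] := fun j => g j - if j = j₀ then C c * X ^ i₀ else 0 with hk
  have hgi : (g j₀).coeff i₀ = 0 := by
    by_contra h0
    exact lt_irrefl _ (hg' _ _ h0)
  have hk0 : (k j₀).coeff i₀ = -c := by simp [hk, hgi]
  have hkdeg : (k j₀).natDegree ≤ i₀ := by
    rw [natDegree_le_iff_coeff_eq_zero]
    intro N hN
    have h1 : (g j₀).coeff N = 0 := by
      by_contra h0
      have := hg' _ _ h0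
      have : p * i₀ ≤ p * N := by gcongr
      omega
    simp [hk, h1, coeff_X_pow, hN.ne']
  have hkne : k j₀ ≠ 0 := by
    intro h0
    rw [h0] at hk0
    exact hc (by simpa using hk0.symm)
  have hroot : ∀ x ∈ Z, (k j₀).eval x = 0 := by
    intro x hx
    obtain ⟨y, hy⟩ := hZ x hx
    set B : K[X] := ∑ j ∈ Finset.range p, C ((k j).eval x) * X ^ j with hB
    have hBdeg : B.degree < p := by
      refine mem_degreeLT.1 (Submodule.sum_mem _ fun j hj => mem_degreeLT.2 ?_)
      refine (degree_C_mul_X_pow_le _ _).trans_lt ?_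
      exact_mod_cast Finset.mem_range.1 hj
    have hB0 : B = 0 := by
      classical
      let e : ZMod p → K := fun a => y + ZMod.castHom (dvd_refl p) K a
      have he : Function.Injective e := fun a b hab =>
        (ZMod.castHom (dvd_refl p) K).injective (add_left_cancel hab)
      refine eq_zero_of_degree_lt_of_eval_finset_eq_zero (Finset.univ.image e) ?_ ?_
      · rw [Finset.card_image_of_injective _ he, Finset.card_univ, ZMod.card]
        exact hBdeg
      · intro z hz
        obtain ⟨a, -, rfl⟩ := Finset.mem_image.1 hz
        have hv : (e a) ^ p - e a = f.eval x := by
          have : (ZMod.castHom (dvd_refl p) K a) ^ p = ZMod.castHom (dvd_refl p) K a := by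
            rw [← map_pow, ZMod.pow_card]
          simp only [e]
          rw [add_pow_char, this, ← hy]
          ring
        have h1 : c * (x ^ i₀ * e a ^ j₀) =
            ∑ j ∈ Finset.range p, (g j).eval x * e a ^ j := hg ⟨(x, e a), hv⟩
        simp only [hB, hk, eval_finsetSum, eval_mul, eval_C, eval_pow, eval_X, eval_sub, sub_mul,
          Finset.sum_sub_distrib, ← h1]
        rw [Finset.sum_eq_single_of_mem j₀ (by simpa using hj₀)]
        · simp [mul_assoc]
        · intro b _ hb; simp [hb]
    have := congrArg (fun q => q.coeff j₀) hB0
    simpa [hB, finsetSum_coeff, coeff_X_pow, hj₀] using this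
  classical
  calc Z.card ≤ (k j₀).roots.toFinset.card := Finset.card_le_card fun x hx => by
        simp [hkne, hroot x hx]
    _ ≤ (k j₀).roots.card := Multiset.toFinset_card_le _
    _ ≤ (k j₀).natDegree := card_roots' _
    _ ≤ i₀ := hkdeg

/-- Exponents of the reduced monomials of weight below `n`. -/
def lowWeights (p d n : ℕ) : Finset (ℕ × ℕ) :=
  (Finset.range n ×ˢ Finset.range p).filter fun s => p * s.1 + d * s.2 < n

lemma mem_lowWeights {p d n : ℕ} (hp : 0 < p) {s : ℕ × ℕ} :
    s ∈ lowWeights p d n ↔ s.2 < p ∧ p * s.1 + d * s.2 < n := by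
  simp only [lowWeights, Finset.mem_filter, Finset.mem_product, Finset.mem_range]
  refine ⟨fun h => ⟨h.1.2, h.2⟩, fun h => ⟨⟨?_, h.1⟩, h.2⟩⟩
  have := Nat.le_mul_of_pos_left s.1 hp
  omega

lemma weight_injective {p d : ℕ} (hp : 0 < p) (hd : d.Coprime p) {s t : ℕ × ℕ} (hs : s.2 < p)
    (ht : t.2 < p) (h : p * s.1 + d * s.2 = p * t.1 + d * t.2) : s = t := by
  have h1 : d * s.2 ≡ d * t.2 [MOD p] := by
    have : p * s.1 + d * s.2 ≡ p * t.1 + d * t.2 [MOD p] := by rw [h]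
    simpa [Nat.ModEq, Nat.mul_add_mod] using this
  have h2 : s.2 = t.2 :=
    Nat.ModEq.eq_of_lt_of_lt (Nat.ModEq.cancel_left_of_coprime (Nat.Coprime.symm hd) h1) hs ht
  rw [h2, Nat.add_right_cancel_iff] at h
  exact Prod.ext (Nat.eq_of_mul_eq_mul_left hp h) h2

lemma card_lowWeights_le {p d : ℕ} (hp : 0 < p) (hd : d.Coprime p) (n : ℕ) :
    (lowWeights p d n).card ≤ n := by
  refine (Finset.card_le_card_of_injOn (fun s : ℕ × ℕ => p * s.1 + d * s.2)
    (t := Finset.range n) ?_ ?_).trans_eq (Finset.card_range n)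
  · intro s hs
    simpa using ((mem_lowWeights hp).1 hs).2
  · intro s hs t ht h
    exact weight_injective hp hd ((mem_lowWeights hp).1 hs).1 ((mem_lowWeights hp).1 ht).1 h

lemma le_card_lowWeights {p d : ℕ} (hp : 0 < p) (hd : d.Coprime p) (n : ℕ) :
    n ≤ (lowWeights p d n).card + p * d := by
  have hsub : Finset.Ico (p * d) n ⊆
      (lowWeights p d n).image fun s => p * s.1 + d * s.2 := by
    intro w hw
    rw [Finset.mem_Ico] at hw
    obtain ⟨j, hj⟩ : ∃ j, d * j ≡ w [MOD p] := by
      obtain ⟨u, hu⟩ := Nat.exists_mul_mod_eq_of_coprime w hd hp.ne'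
      exact ⟨u, by simpa [Nat.ModEq] using hu.2⟩
    have hj' : d * (j % p) ≡ w [MOD p] := ((Nat.mod_modEq j p).mul_left d).trans hj
    have hlt : j % p < p := Nat.mod_lt _ hp
    have hle : d * (j % p) ≤ w := by
      refine le_trans ?_ hw.1
      rw [mul_comm p d]
      exact Nat.mul_le_mul_left _ hlt.le
    obtain ⟨i, hi⟩ := (Nat.modEq_iff_dvd' hle).1 hj'
    rw [Finset.mem_image]
    have : p * i + d * (j % p) = w := by omega
    exact ⟨(i, j % p), (mem_lowWeights hp).2 ⟨hlt, by simpa [this] using hw.2⟩, this⟩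
  have := (Finset.card_le_card hsub).trans Finset.card_image_le
  rw [Nat.card_Ico] at this
  omega

lemma finrank_fil_le [Finite K] {p : ℕ} (hp : 0 < p) {f : K[X]} (hd : f.natDegree.Coprime p)
    (W : ℕ) : Module.finrank K (fil p f W) ≤ W := by
  classical
  have : fil p f W = Submodule.span K
      (((lowWeights p f.natDegree W).image fun s => mono p f s.1 s.2 :
        Finset (Curve p f → K)) : Set (Curve p f → K)) := by
    unfold fil
    congr 1
    ext u
    simp only [Set.mem_ofPred_eq, Finset.coe_image, Set.mem_image, Finset.mem_coe,
      mem_lowWeights hp, Prod.exists]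
    constructor
    · rintro ⟨i, j, h1, h2, rfl⟩
      exact ⟨i, j, ⟨h1, h2⟩, rfl⟩
    · rintro ⟨i, j, ⟨h1, h2⟩, rfl⟩
      exact ⟨i, j, h1, h2, rfl⟩
  rw [this]
  exact (finrank_span_finset_le_card _).trans
    (Finset.card_image_le.trans (card_lowWeights_le hp hd W))

instance [Finite K] (p : ℕ) (f : K[X]) : Finite (Curve p f) :=
  inferInstanceAs (Finite {v : K × K // v.2 ^ p - v.2 = f.eval v.1})

/-- Bombieri's form of Stepanov's method for the curve `y ^ p - y = f x` over a field with
`r ^ 2 = p ^ (2 (ν + 1))` elements. -/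
lemma card_fibres_lt [Finite K] {p : ℕ} [hp : Fact p.Prime] [CharP K p] {f : K[X]}
    (hf : 0 < f.natDegree) (hd : f.natDegree.Coprime p) {ν r M : ℕ} (hr : r = p ^ (ν + 1))
    (hK : Nat.card K = r ^ 2)
    (hM : r * (r - 1) + M < (lowWeights p f.natDegree r).card * (lowWeights p f.natDegree M).card)
    (Z : Finset K) (hZ : ∀ x ∈ Z, ∃ y, y ^ p - y = f.eval x) :
    p * Z.card < r * M := by
  classical
  have := Fintype.ofFinite K
  have hp0 : 0 < p := hp.out.pos
  have hr0 : 0 < r := hr ▸ pow_pos hp0 _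
  have hpow : ∀ z : K, z ^ (r * r) = z := fun z => by
    rw [← pow_two, ← hK, Nat.card_eq_fintype_card, FiniteField.pow_card]
  set d := f.natDegree
  set S := lowWeights p d r ×ˢ lowWeights p d M
  let v : S → fil p f (r * (r - 1) + M) := fun z =>
    ⟨mono p f (r * z.1.1.1 + z.1.2.1) (r * z.1.1.2 + z.1.2.2), by
      obtain ⟨⟨s, t⟩, hz⟩ := z
      obtain ⟨hs, ht⟩ := Finset.mem_product.1 hz
      have hs := ((mem_lowWeights hp0).1 hs).2
      have ht := ((mem_lowWeights hp0).1 ht).2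
      refine mono_mem_fil hp.out.two_le _ _ _ ?_
      simp only at hs ht
      have h1 : r * (p * s.1 + d * s.2) ≤ r * (r - 1) := Nat.mul_le_mul_left _ (by omega)
      change p * (r * s.1 + t.1) + d * (r * s.2 + t.2) < _
      calc p * (r * s.1 + t.1) + d * (r * s.2 + t.2) =
          r * (p * s.1 + d * s.2) + (p * t.1 + d * t.2) := by ring
        _ < _ := by omega⟩
  have hv : ¬ LinearIndependent K v := by
    intro h
    have h1 := h.fintype_card_le_finrank.trans (finrank_fil_le hp0 hd _)
    rw [Fintype.card_coe, Finset.card_product] at h1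
    omega
  obtain ⟨ρ, hρ, z₀, hz₀⟩ := Fintype.not_linearIndependent_iff.1 hv
  have hρ' : ∀ w : Curve p f, ∑ z : S,
      ρ z * (w.1.1 ^ (r * z.1.1.1 + z.1.2.1) * w.1.2 ^ (r * z.1.1.2 + z.1.2.2)) = 0 := by
    intro w
    have := congrFun (congrArg Subtype.val hρ) w
    simpa [Finset.sum_apply, v, mono] using this
  have hG : ∑ z : S, ρ z ^ r • mono p f (z.1.1.1 + r * z.1.2.1) (z.1.1.2 + r * z.1.2.2) = 0 := by
    funext w
    have h1 : (∑ z : S, ρ z ^ r *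
        (w.1.1 ^ (z.1.1.1 + r * z.1.2.1) * w.1.2 ^ (z.1.1.2 + r * z.1.2.2))) ^ r = 0 := by
      rw [hr, sum_pow_char_pow, ← hr, ← hρ' w]
      refine Finset.sum_congr rfl fun z _ => ?_
      have e : ∀ (x : K) (a b : ℕ), (x ^ (a + r * b)) ^ r = x ^ (r * a + b) := fun x a b => by
        rw [← pow_mul, show (a + r * b) * r = r * a + (r * r) * b by ring, pow_add, pow_mul x (r * r),
          hpow, ← pow_add]
      rw [mul_pow, mul_pow, e, e, ← pow_mul, hpow]
    simpa [Finset.sum_apply, mono] using (pow_eq_zero_iff hr0.ne').1 h1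
  let wt : S → ℕ := fun z => (p * z.1.1.1 + d * z.1.1.2) + r * (p * z.1.2.1 + d * z.1.2.2)
  have hwt : Function.Injective wt := by
    rintro ⟨⟨s, t⟩, hz⟩ ⟨⟨s', t'⟩, hz'⟩ h
    obtain ⟨hs, ht⟩ := Finset.mem_product.1 hz
    obtain ⟨hs', ht'⟩ := Finset.mem_product.1 hz'
    obtain ⟨hs, hsw⟩ := (mem_lowWeights hp0).1 hs
    obtain ⟨hs', hsw'⟩ := (mem_lowWeights hp0).1 hs'
    have ht := ((mem_lowWeights hp0).1 ht).1
    have ht' := ((mem_lowWeights hp0).1 ht').1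
    simp only [wt] at h
    simp only at hsw hsw' hs hs' ht ht'
    have h1 : p * s.1 + d * s.2 = p * s'.1 + d * s'.2 := by
      have := congrArg (· % r) h
      simpa [Nat.mod_eq_of_lt hsw, Nat.mod_eq_of_lt hsw'] using this
    have h2 : p * t.1 + d * t.2 = p * t'.1 + d * t'.2 := by
      rw [h1, Nat.add_left_cancel_iff] at h
      exact Nat.eq_of_mul_eq_mul_left hr0 h
    simp only [Subtype.mk.injEq, Prod.mk.injEq]
    exact ⟨weight_injective hp0 hd hs hs' h1, weight_injective hp0 hd ht ht' h2⟩
  obtain ⟨z, hz, hmax⟩ := Finset.exists_max_image (Finset.univ.filter fun z => ρ z ≠ 0) wt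
    ⟨z₀, by simpa using hz₀⟩
  have hz : ρ z ≠ 0 := by simpa using hz
  have hmem : ρ z ^ r • mono p f (z.1.1.1 + r * z.1.2.1) (z.1.1.2 + r * z.1.2.2) ∈
      fil p f (wt z) := by
    rw [← Finset.add_sum_erase _ _ (Finset.mem_univ z), add_eq_zero_iff_eq_neg] at hG
    rw [hG]
    refine Submodule.neg_mem _ (Submodule.sum_mem _ fun z' hz' => ?_)
    by_cases h0 : ρ z' = 0
    · rw [h0, zero_pow hr0.ne', zero_smul]
      exact Submodule.zero_mem _
    · refine Submodule.smul_mem _ _ (mono_mem_fil hp.out.two_le _ _ _ ?_)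
      have h1 := hmax z' (by simpa using h0)
      have h2 : wt z' ≠ wt z := fun h => (Finset.mem_erase.1 hz').1 (hwt h)
      have h3 : p * (z'.1.1.1 + r * z'.1.2.1) + d * (z'.1.1.2 + r * z'.1.2.2) = wt z' := by
        simp only [wt]; ring
      exact h3 ▸ lt_of_le_of_ne h1 h2
  obtain ⟨⟨⟨i, j⟩, ⟨a, b⟩⟩, hzS⟩ := z
  obtain ⟨hs, ht⟩ := Finset.mem_product.1 hzS
  obtain ⟨hj, hsw⟩ := (mem_lowWeights hp0).1 hs
  obtain ⟨hb, htw⟩ := (mem_lowWeights hp0).1 ht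
  simp only at hj hsw hb htw
  have hrb : r * b = p * (p ^ ν * b) := by rw [hr]; ring
  have hsub := mono_add_mul_sub_mem hp.out.two_le hf (i + r * a) j (p ^ ν * b)
  have hwz : p * (i + r * a) + d * (j + p * (p ^ ν * b)) = wt ⟨((i, j), (a, b)), hzS⟩ := by
    rw [← hrb]; simp only [wt]; ring
  rw [hwz] at hsub
  change _ • mono p f (i + r * a) (j + r * b) ∈ _ at hmem
  rw [hrb] at hmem
  have hlead := Submodule.sub_mem _ hmem
    (Submodule.smul_mem _ (ρ ⟨((i, j), (a, b)), hzS⟩ ^ r) hsub)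
  rw [← smul_sub, sub_sub_cancel, smul_smul, ← hwz,
    show p * (i + r * a) + d * (j + p * (p ^ ν * b)) =
      p * (i + r * a + d * (p ^ ν * b)) + d * j by ring] at hlead
  have hlc : f.leadingCoeff ≠ 0 := by
    rw [leadingCoeff_ne_zero]
    intro h0
    simp [d, h0] at hf
  have hZi := card_fibres_le Z hZ (mul_ne_zero (pow_ne_zero r hz) (pow_ne_zero _ hlc)) hj hlead
  calc p * Z.card ≤ p * (i + r * a + d * (p ^ ν * b)) := Nat.mul_le_mul_left _ hZi
    _ ≤ wt ⟨((i, j), (a, b)), hzS⟩ := by rw [← hwz]; exact Nat.le.intro (k := d * j) (by ring)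
    _ = (p * i + d * j) + r * (p * a + d * b) := rfl
    _ < r + r * (p * a + d * b) := by omega
    _ = r * (p * a + d * b + 1) := by ring
    _ ≤ r * M := Nat.mul_le_mul_left _ (by omega)

/-- The number of fibres with a rational point, over `r ^ 2` elements, is at most
`(r ^ 2 + O(r)) / p`. -/
theorem card_fibres_bound {p : ℕ} [hp : Fact p.Prime] [CharP K p] [Finite K] {f : K[X]}
    (hf : 0 < f.natDegree) (hd : f.natDegree.Coprime p) {ν : ℕ}
    (hK : Nat.card K = (p ^ (ν + 1)) ^ 2) (Z : Finset K)
    (hZ : ∀ x ∈ Z, ∃ y, y ^ p - y = f.eval x) :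
    p * Z.card ≤ (p ^ (ν + 1)) ^ 2 + 8 * p * (p * f.natDegree + 1) ^ 2 * p ^ (ν + 1) := by
  obtain ⟨r, hr⟩ : ∃ r, r = p ^ (ν + 1) := ⟨_, rfl⟩
  obtain ⟨g, hg⟩ : ∃ g, g = p * f.natDegree := ⟨_, rfl⟩
  have hp0 : 1 ≤ p := hp.out.pos
  rw [← hr] at hK ⊢
  rw [← hg]
  rcases le_or_gt r (8 * (g + 1) ^ 2) with h | h
  · have h1 : Z.card ≤ r ^ 2 := by
      have := Fintype.ofFinite K
      rw [← hK, Nat.card_eq_fintype_card]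
      exact Finset.card_le_univ Z
    calc p * Z.card ≤ p * r ^ 2 := Nat.mul_le_mul_left _ h1
      _ = p * r * r := by ring
      _ ≤ p * (8 * (g + 1) ^ 2) * r := by gcongr
      _ = 8 * p * (g + 1) ^ 2 * r := by ring
      _ ≤ _ := Nat.le_add_left _ _
  · have hgr : g < r := by nlinarith
    have h1 := le_card_lowWeights hp0 hd r
    have h2 := le_card_lowWeights hp0 hd (r + (2 * g + 2))
    rw [← hg] at h1 h2
    obtain ⟨s, rfl⟩ := Nat.exists_eq_add_of_lt hgr
    have h3 := card_fibres_lt hf hd hr hK (M := g + s + 1 + (2 * g + 2)) (by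
      refine lt_of_lt_of_le ?_ (Nat.mul_le_mul (show s + 1 ≤ _ by omega)
        (show g + s + 1 + (g + 2) ≤ _ by omega))
      rw [Nat.add_sub_cancel]
      nlinarith) Z hZ
    refine h3.le.trans ?_
    have h4 : 2 * g + 2 ≤ 8 * p * (g + 1) ^ 2 := by nlinarith
    calc (g + s + 1) * (g + s + 1 + (2 * g + 2)) =
        (g + s + 1) ^ 2 + (2 * g + 2) * (g + s + 1) := by ring
      _ ≤ _ := by gcongr

end Stepanov

section EvenExtensions

/-- Additive Hilbert 90 for finite fields over their prime field. -/
lemma exists_pow_sub_eq_of_trace_eq_zero {p : ℕ} [hp : Fact p.Prime] {K : Type} [Field K]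
    [Finite K] [Algebra (ZMod p) K] {u : K} (hu : Algebra.trace (ZMod p) K u = 0) :
    ∃ y, y ^ p - y = u := by
  have := charP_of_injective_algebraMap (algebraMap (ZMod p) K).injective p
  let T : K →ₗ[ZMod p] K :=
    AddMonoidHom.toZModLinearMap p ((frobenius K p : K →+ K) - AddMonoidHom.id K)
  have hT : ∀ y, T y = y ^ p - y := fun y => rfl
  have hle : LinearMap.range T ≤ LinearMap.ker (Algebra.trace (ZMod p) K) := by
    rintro _ ⟨y, rfl⟩
    have h1 := Algebra.trace_eq_of_algEquiv
      (FiniteField.frobeniusAlgEquivOfAlgebraic (ZMod p) K) y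
    rw [FiniteField.coe_frobeniusAlgEquivOfAlgebraic, ZMod.card] at h1
    rw [LinearMap.mem_ker, hT, map_sub, h1, sub_self]
  have hker : Module.finrank (ZMod p) (LinearMap.ker T) ≤ 1 := by
    refine finrank_le_one (⟨1, by simp [hT]⟩ : LinearMap.ker T) fun w => ?_
    have hw : (w : K) ^ p = w := sub_eq_zero.1 ((hT w).symm.trans w.2)
    rw [← Subfield.mem_bot_iff_pow_eq_self K] at hw
    obtain ⟨a, ha⟩ := (bot_le : ⊥ ≤ (algebraMap (ZMod p) K).fieldRange) hw
    exact ⟨a, Subtype.ext (by simp [Algebra.smul_def, ha])⟩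
  have h1 := LinearMap.finrank_range_add_finrank_ker T
  have h2 := LinearMap.finrank_range_add_finrank_ker (Algebra.trace (ZMod p) K)
  rw [LinearMap.range_eq_top.2 (Algebra.trace_surjective (ZMod p) K), finrank_top,
    Module.finrank_self] at h2
  have := Submodule.eq_of_le_of_finrank_le hle (by omega)
  have hu : u ∈ LinearMap.range T := this ▸ hu
  exact hu

/-- Square-root cancellation, up to a constant, over the extensions of even degree. -/
theorem exists_norm_sum_even_le {p : ℕ} [hp : Fact p.Prime] {f : (ZMod p)[X]}
    (hf : 0 < f.natDegree) (hd : f.natDegree.Coprime p) :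
    ∃ B : ℝ, ∀ (ν : ℕ) (K : Type) [Field K] [Fintype K] [Algebra (ZMod p) K],
      Fintype.card K = (p ^ (ν + 1)) ^ 2 → ∀ ψ : AddChar (ZMod p) ℂ, ψ ≠ 1 →
        ‖∑ x : K, ψ (Algebra.trace (ZMod p) K (aeval x f))‖ ≤ B * p ^ (ν + 1) := by
  classical
  refine ⟨8 * p * (p * f.natDegree + 1) ^ 2, fun ν K _ _ _ hK ψ hψ => ?_⟩
  have := charP_of_injective_algebraMap (algebraMap (ZMod p) K).injective p
  set B : ℝ := 8 * p * (p * f.natDegree + 1) ^ 2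
  have hp0 : (0 : ℝ) < p := by exact_mod_cast hp.out.pos
  let N : ZMod p → ℕ := fun c =>
    (Finset.univ.filter fun x : K => Algebra.trace (ZMod p) K (aeval x f) = c).card
  let A : ℝ := (((p : ℝ) ^ (ν + 1)) ^ 2 + B * (p : ℝ) ^ (ν + 1)) / p
  have hN : ∀ c, (N c : ℝ) ≤ A := by
    intro c
    obtain ⟨e, he⟩ := Algebra.trace_surjective (ZMod p) K c
    have hdeg : (f.map (algebraMap (ZMod p) K) - C e).natDegree = f.natDegree := by
      rw [natDegree_sub_C, natDegree_map]
    have h1 := card_fibres_bound (p := p) (f := f.map (algebraMap (ZMod p) K) - C e)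
      (by rwa [hdeg]) (by rwa [hdeg]) (ν := ν) (by rw [Nat.card_eq_fintype_card, hK])
      (Finset.univ.filter fun x : K => Algebra.trace (ZMod p) K (aeval x f) = c) (by
        intro x hx
        refine exists_pow_sub_eq_of_trace_eq_zero (p := p) ?_
        have hx : Algebra.trace (ZMod p) K (aeval x f) = c := by simpa using hx
        rw [eval_sub, eval_C, eval_map_algebraMap, map_sub, he, hx, sub_self])
    rw [hdeg] at h1
    rw [le_div_iff₀ hp0, mul_comm]
    have h2 : ((p * N c : ℕ) : ℝ) ≤ _ := Nat.cast_le.2 h1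
    simpa [B] using h2
  have hsumN : ∑ c, (N c : ℝ) = ((p : ℝ) ^ (ν + 1)) ^ 2 := by
    have h1 := Finset.card_eq_sum_card_fiberwise (s := (Finset.univ : Finset K))
      (t := (Finset.univ : Finset (ZMod p)))
      (f := fun x => Algebra.trace (ZMod p) K (aeval x f)) (by simp)
    rw [Finset.card_univ, hK] at h1
    exact_mod_cast h1.symm
  have hS : ∑ x : K, ψ (Algebra.trace (ZMod p) K (aeval x f)) = ∑ c, ((N c : ℂ) - A) * ψ c := by
    simp_rw [sub_mul, Finset.sum_sub_distrib, ← Finset.mul_sum]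
    rw [AddChar.sum_eq_zero_of_ne_one hψ, mul_zero, sub_zero,
      ← Finset.sum_fiberwise (s := Finset.univ)
        (g := fun x : K => Algebra.trace (ZMod p) K (aeval x f))]
    refine Finset.sum_congr rfl fun c _ => ?_
    rw [Finset.sum_congr rfl (g := fun _ => ψ c) fun x hx => by rw [(Finset.mem_filter.1 hx).2],
      Finset.sum_const, nsmul_eq_mul]
  rw [hS]
  calc ‖∑ c, ((N c : ℂ) - A) * ψ c‖ ≤ ∑ c, ‖((N c : ℂ) - A) * ψ c‖ := norm_sum_le _ _
    _ = ∑ c, (A - N c) := by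
      refine Finset.sum_congr rfl fun c _ => ?_
      rw [norm_mul, AddChar.norm_apply, mul_one, ← Complex.ofReal_natCast, ← Complex.ofReal_sub,
        Complex.norm_real, Real.norm_eq_abs, abs_sub_comm, abs_of_nonneg (sub_nonneg.2 (hN c))]
    _ = B * p ^ (ν + 1) := by
      rw [Finset.sum_sub_distrib, hsumN, Finset.sum_const, Finset.card_univ, ZMod.card,
        nsmul_eq_mul, mul_div_cancel₀ _ hp0.ne']
      ring

end EvenExtensions

section PowerSums

variable {E F : Type*} [Field E] [Field F]

/-- The reversed polynomial, as a power series. -/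
noncomputable def rev (g : E[X]) : PowerSeries E := g.reverse

lemma coeff_rev (g : E[X]) (n : ℕ) :
    PowerSeries.coeff n (rev g) = g.coeff (revAt g.natDegree n) := by
  rw [rev, Polynomial.coeff_coe, coeff_reverse]

lemma constantCoeff_rev (g : E[X]) : PowerSeries.constantCoeff (rev g) = g.leadingCoeff := by
  rw [← PowerSeries.coeff_zero_eq_constantCoeff_apply, rev, Polynomial.coeff_coe,
    coeff_zero_reverse]

lemma constantCoeff_rev_ne_zero {g : E[X]} (hg : g ≠ 0) :
    PowerSeries.constantCoeff (rev g) ≠ 0 := by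
  rw [constantCoeff_rev]
  exact leadingCoeff_ne_zero.2 hg

/-- The generating series of the power sums of the roots of `g`, in terms of the coefficients
of `g`. -/
noncomputable def psum (g : E[X]) : PowerSeries E :=
  PowerSeries.C (g.natDegree : E) -
    PowerSeries.X * PowerSeries.derivative E (rev g) * (rev g)⁻¹

lemma psum_mul_rev {g : E[X]} (hg : g ≠ 0) :
    psum g * rev g = PowerSeries.C (g.natDegree : E) * rev g -
      PowerSeries.X * PowerSeries.derivative E (rev g) := by
  rw [psum, sub_mul, mul_assoc _ _ (rev g),
    PowerSeries.inv_mul_cancel _ (constantCoeff_rev_ne_zero hg), mul_one]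

lemma eq_psum {g : E[X]} (hg : g ≠ 0) {s : PowerSeries E}
    (h : s * rev g = PowerSeries.C (g.natDegree : E) * rev g -
      PowerSeries.X * PowerSeries.derivative E (rev g)) : s = psum g := by
  rw [← psum_mul_rev hg] at h
  exact mul_right_cancel₀ (fun h0 => constantCoeff_rev_ne_zero hg (by rw [h0, map_zero])) h

lemma coeff_zero_psum (g : E[X]) : PowerSeries.constantCoeff (psum g) = g.natDegree := by
  simp [psum]

lemma psum_mul {g h : E[X]} (hg : g ≠ 0) (hh : h ≠ 0) : psum (g * h) = psum g + psum h := by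
  refine (eq_psum (mul_ne_zero hg hh) ?_).symm
  have hr : rev (g * h) = rev g * rev h := by
    rw [rev, reverse_mul_of_domain, Polynomial.coe_mul, rev, rev]
  rw [hr, natDegree_mul hg hh, Derivation.leibniz, smul_eq_mul, smul_eq_mul, Nat.cast_add, map_add]
  linear_combination rev h * psum_mul_rev hg + rev g * psum_mul_rev hh

lemma psum_one : psum (1 : E[X]) = 0 := by
  have := psum_mul (one_ne_zero (α := E[X])) one_ne_zero
  rwa [one_mul, left_eq_add] at this

lemma coeff_psum_X_sub_C (a : E) (j : ℕ) : PowerSeries.coeff j (psum (X - C a)) = a ^ j := by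
  have h : PowerSeries.mk (fun j => a ^ j) = psum (X - C a) := by
    refine eq_psum (X_sub_C_ne_zero a) ?_
    have hr : rev (X - C a) = 1 - PowerSeries.C a * PowerSeries.X := by
      ext n
      rw [coeff_rev, natDegree_X_sub_C]
      rcases n with _ | _ | n
      · simp [revAt_le]
      · simp [revAt_le, PowerSeries.coeff_one]
      · rw [revAt_eq_self_of_lt (by omega), coeff_eq_zero_of_natDegree_lt (by
          rw [natDegree_X_sub_C]; omega)]
        simp [PowerSeries.coeff_one]
    have hd : PowerSeries.derivative E (1 - PowerSeries.C a * PowerSeries.X) =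
        -PowerSeries.C a := by
      rw [map_sub, Derivation.map_one_eq_zero, Derivation.leibniz, PowerSeries.derivative_C,
        PowerSeries.derivative_X]
      simp
    rw [hr, hd, natDegree_X_sub_C, mul_sub, mul_one, mul_left_comm]
    ext n
    rcases n with _ | n
    · simp
    · simp [PowerSeries.coeff_succ_mul_X, PowerSeries.coeff_one, pow_succ', mul_comm PowerSeries.X]
  rw [← h, PowerSeries.coeff_mk]

lemma coeff_psum_prod (s : Multiset E) (j : ℕ) :
    PowerSeries.coeff j (psum (s.map fun a => X - C a).prod) = (s.map (· ^ j)).sum := by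
  induction s using Multiset.induction with
  | empty => simp [psum_one]
  | cons a s ih =>
    rw [Multiset.map_cons, Multiset.prod_cons, psum_mul (X_sub_C_ne_zero a), map_add,
      coeff_psum_X_sub_C, ih, Multiset.map_cons, Multiset.sum_cons]
    exact (monic_multiset_prod_of_monic _ _ fun a _ => monic_X_sub_C a).ne_zero

lemma psum_map (φ : E →+* F) {g : E[X]} (hg : g ≠ 0) :
    psum (g.map φ) = PowerSeries.map φ (psum g) := by
  refine (eq_psum ((Polynomial.map_ne_zero_iff φ.injective).2 hg) ?_).symm
  have hr : rev (g.map φ) = PowerSeries.map φ (rev g) := by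
    ext n
    rw [coeff_rev, natDegree_map, coeff_map, PowerSeries.coeff_map, coeff_rev]
  have hd : PowerSeries.derivative F (PowerSeries.map φ (rev g)) =
      PowerSeries.map φ (PowerSeries.derivative E (rev g)) := by
    ext n
    simp [PowerSeries.coeff_derivative]
  have := congrArg (PowerSeries.map φ) (psum_mul_rev hg)
  rw [hr, natDegree_map, hd]
  simpa using this

lemma coeff_psum_add_X_pow {g : E[X]} (hg : g.Monic) {d : ℕ} (hd : 0 < d) (hdk : d ≤ g.natDegree)
    {j : ℕ} (hj : j ≤ d) :
    PowerSeries.coeff j (psum (g + X ^ (g.natDegree - d))) =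
      PowerSeries.coeff j (psum g) - if j = d then (d : E) else 0 := by
  set h := g + X ^ (g.natDegree - d) with hh
  have hdeg : (X ^ (g.natDegree - d) : E[X]).natDegree < g.natDegree := by
    rw [natDegree_X_pow]; omega
  have hN : h.natDegree = g.natDegree := natDegree_add_eq_left_of_natDegree_lt hdeg
  have hm : h.Monic := hg.add_of_left (degree_lt_degree hdeg)
  have hr : rev h = rev g + PowerSeries.X ^ d := by
    ext n
    rw [map_add, coeff_rev, coeff_rev, hN, hh, coeff_add, coeff_X_pow, PowerSeries.coeff_X_pow]
    congr 1
    rcases le_or_gt n g.natDegree with hn | hn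
    · rw [revAt_le hn]
      exact if_congr (by omega) rfl rfl
    · rw [revAt_eq_self_of_lt hn, if_neg (by omega), if_neg (by omega)]
  have key : psum h - psum g = PowerSeries.X ^ d *
      ((PowerSeries.C (g.natDegree : E) - PowerSeries.C (d : E) - psum g) * (rev h)⁻¹) := by
    have h1 := psum_mul_rev hm.ne_zero
    have h2 := psum_mul_rev hg.ne_zero
    have h3 : PowerSeries.X * PowerSeries.derivative E (PowerSeries.X ^ d : PowerSeries E) =
        PowerSeries.C (d : E) * PowerSeries.X ^ d := by
      obtain ⟨e, rfl⟩ : ∃ e, d = e + 1 := ⟨d - 1, by omega⟩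
      rw [Derivation.leibniz_pow, PowerSeries.derivative_X, Nat.add_sub_cancel, map_natCast]
      simp only [nsmul_eq_mul, smul_eq_mul]
      ring
    rw [← mul_assoc, PowerSeries.eq_mul_inv_iff_mul_eq (constantCoeff_rev_ne_zero hm.ne_zero)]
    rw [hN, hr, map_add] at h1
    rw [hr]
    linear_combination h1 - h2 - h3
  have hc := congrArg (PowerSeries.coeff j) key
  rw [map_sub, PowerSeries.coeff_X_pow_mul'] at hc
  rw [sub_eq_iff_eq_add'.1 hc]
  rcases hj.eq_or_lt with rfl | hj
  · simp [coeff_zero_psum, constantCoeff_rev, hm.leadingCoeff]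
    ring
  · rw [if_neg (by omega), if_neg (by omega), add_zero, sub_zero]

end PowerSums

section EulerProduct

variable {F : Type*} [Field F]

/-- The sum of the values of `f` at the roots of `g`, in terms of the coefficients of `g`. -/
noncomputable def rootSum (f g : F[X]) : F :=
  ∑ i ∈ Finset.range (f.natDegree + 1), f.coeff i * PowerSeries.coeff i (psum g)

lemma rootSum_mul (f : F[X]) {g h : F[X]} (hg : g ≠ 0) (hh : h ≠ 0) :
    rootSum f (g * h) = rootSum f g + rootSum f h := by
  simp_rw [rootSum, psum_mul hg hh, map_add, mul_add, Finset.sum_add_distrib]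

lemma rootSum_one (f : F[X]) : rootSum f 1 = 0 := by
  simp [rootSum, psum_one]

lemma rootSum_pow (f : F[X]) {g : F[X]} (hg : g ≠ 0) (s : ℕ) :
    rootSum f (g ^ s) = s • rootSum f g := by
  induction s with
  | zero => simp [rootSum_one]
  | succ s ih => rw [pow_succ, rootSum_mul f (pow_ne_zero s hg) hg, ih, succ_nsmul]

lemma rootSum_add_X_pow {f g : F[X]} (hf : 0 < f.natDegree) (hg : g.Monic)
    (h : f.natDegree ≤ g.natDegree) :
    rootSum f (g + X ^ (g.natDegree - f.natDegree)) =
      rootSum f g - f.natDegree * f.leadingCoeff := by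
  rw [rootSum, rootSum, Finset.sum_congr rfl fun i hi => by
    rw [coeff_psum_add_X_pow hg hf h (by rw [Finset.mem_range] at hi; omega), mul_sub],
    Finset.sum_sub_distrib]
  simp [mul_comm]

variable [Finite F]

lemma finite_monic_natDegree_eq (k : ℕ) : {g : F[X] | g.Monic ∧ g.natDegree = k}.Finite := by
  have : Finite (degreeLT F (k + 1)) := Finite.of_injective _ (degreeLTEquiv F (k + 1)).injective
  refine (Set.toFinite (degreeLT F (k + 1) : Set F[X])).subset fun g hg => ?_
  rw [SetLike.mem_coe, mem_degreeLT]
  exact degree_le_natDegree.trans_lt (by rw [hg.2]; exact_mod_cast k.lt_succ_self)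

/-- The monic polynomials of degree `k`. -/
noncomputable def monics (F : Type*) [Field F] [Finite F] (k : ℕ) : Finset F[X] :=
  (finite_monic_natDegree_eq k).toFinset

@[simp] lemma mem_monics {k : ℕ} {g : F[X]} : g ∈ monics F k ↔ g.Monic ∧ g.natDegree = k := by
  simp [monics]

open Classical in
/-- The monic irreducible polynomials of degree at most `k`. -/
noncomputable def primes (F : Type*) [Field F] [Finite F] (k : ℕ) : Finset F[X] :=
  {g ∈ (Finset.range (k + 1)).biUnion (monics F) | Irreducible g}

@[simp] lemma mem_primes {k : ℕ} {g : F[X]} :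
    g ∈ primes F k ↔ g.Monic ∧ g.natDegree ≤ k ∧ Irreducible g := by
  simp [primes, and_assoc, and_left_comm]

open Classical in
lemma sum_natDegree_primes {k : ℕ} {g : F[X]} (hg : g ∈ monics F k) :
    ∑ P ∈ primes F k, ∑ s ∈ Finset.Icc 1 k, (if P ^ s ∣ g then P.natDegree else 0) = k := by
  obtain ⟨hm, hk⟩ := mem_monics.1 hg
  set N := UniqueFactorizationMonoid.normalizedFactors g
  have hN : ∀ P ∈ N, P ∈ primes F k := fun P hP => by
    have h1 := UniqueFactorizationMonoid.irreducible_of_normalized_factor P hP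
    have h2 := UniqueFactorizationMonoid.dvd_of_mem_normalizedFactors hP
    have h3 := UniqueFactorizationMonoid.normalize_normalized_factor P hP
    refine mem_primes.2 ⟨?_, hk ▸ natDegree_le_of_dvd h2 hm.ne_zero, h1⟩
    rw [← h3]
    exact monic_normalize h1.ne_zero
  have hprod : N.prod = g := by
    have h1 := UniqueFactorizationMonoid.prod_normalizedFactors_eq hm.ne_zero
    rw [h1, hm.normalize_eq_self]
  have hcount : ∀ P ∈ primes F k,
      ∑ s ∈ Finset.Icc 1 k, (if P ^ s ∣ g then P.natDegree else 0) = N.count P * P.natDegree := by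
    intro P hP
    obtain ⟨h1, -, h2⟩ := mem_primes.1 hP
    have h3 : ∀ s, P ^ s ∣ g ↔ s ≤ N.count P := fun s => by
      rw [pow_dvd_iff_le_emultiplicity,
        UniqueFactorizationMonoid.emultiplicity_eq_count_normalizedFactors h2 hm.ne_zero,
        h1.normalize_eq_self, Nat.cast_le]
    have h4 : N.count P ≤ k := by
      have h5 := natDegree_le_of_dvd ((h3 _).2 le_rfl) hm.ne_zero
      rw [natDegree_pow, hk] at h5
      exact (Nat.le_mul_of_pos_right _ h2.natDegree_pos).trans h5
    rw [← Finset.sum_filter, Finset.sum_const, smul_eq_mul]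
    congr 1
    rw [show {s ∈ Finset.Icc 1 k | P ^ s ∣ g} = Finset.Icc 1 (N.count P) by
      ext s
      rw [Finset.mem_filter, h3, Finset.mem_Icc, Finset.mem_Icc]
      omega]
    simp
  rw [Finset.sum_congr rfl hcount]
  have h5 : g.natDegree = (N.map natDegree).sum := by
    rw [← hprod, natDegree_multiset_prod]
    exact fun h0 => (mem_primes.1 (hN 0 h0)).1.ne_zero rfl
  conv_rhs => rw [← hk, h5, Finset.sum_multiset_map_count]
  refine (Finset.sum_subset (fun P hP => hN P (Multiset.mem_toFinset.1 hP)) fun P _ hP => ?_).symm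
  rw [Multiset.mem_toFinset] at hP
  rw [Multiset.count_eq_zero.2 hP, zero_mul]

variable (ψ : AddChar F ℂ) (f : F[X])

/-- The coefficients of the `L`-function of `f`. -/
noncomputable def lcoeff (k : ℕ) : ℂ := ∑ g ∈ monics F k, ψ (rootSum f g)

open Classical in
/-- The coefficients of the logarithmic derivative of the `L`-function of `f`. -/
noncomputable def lpow (j : ℕ) : ℂ :=
  ∑ P ∈ primes F j with P.natDegree ∣ j, P.natDegree * ψ (rootSum f P) ^ (j / P.natDegree)

lemma lcoeff_zero : lcoeff ψ f 0 = 1 := by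
  have : monics F 0 = {1} := by
    ext g
    rw [mem_monics, Finset.mem_singleton]
    exact ⟨fun h => h.1.natDegree_eq_zero.1 h.2, fun h => by simp [h]⟩
  rw [lcoeff, this, Finset.sum_singleton, rootSum_one, AddChar.map_zero_eq_one]

variable {ψ f}

lemma lcoeff_eq_zero (hf : 0 < f.natDegree) (hψ : ψ (f.natDegree * f.leadingCoeff) ≠ 1) {k : ℕ}
    (hk : f.natDegree ≤ k) : lcoeff ψ f k = 0 := by
  have hmaps : ∀ g ∈ monics F k, g + X ^ (k - f.natDegree) ∈ monics F k := by
    intro g hg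
    obtain ⟨hm, hgk⟩ := mem_monics.1 hg
    have hdeg : (X ^ (k - f.natDegree) : F[X]).natDegree < g.natDegree := by
      rw [natDegree_X_pow]; omega
    exact mem_monics.2 ⟨hm.add_of_left (degree_lt_degree hdeg),
      (natDegree_add_eq_left_of_natDegree_lt hdeg).trans hgk⟩
  have hinj : Set.InjOn (fun g : F[X] => g + X ^ (k - f.natDegree)) (monics F k) :=
    fun g _ h _ hgh => add_right_cancel hgh
  have h1 : lcoeff ψ f k = ∑ g ∈ monics F k, ψ (rootSum f (g + X ^ (k - f.natDegree))) :=
    (Finset.sum_bij (fun g _ => g + X ^ (k - f.natDegree)) hmaps (fun g _ h _ => add_right_cancel)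
      (fun g hg => by
        obtain ⟨h, hh, hgh⟩ := Finset.surjOn_of_injOn_of_card_le _ hmaps hinj le_rfl hg
        exact ⟨h, hh, hgh⟩) fun _ _ => rfl).symm
  have h2 : lcoeff ψ f k = ψ (f.natDegree * f.leadingCoeff) * lcoeff ψ f k := by
    conv_rhs => rw [h1, Finset.mul_sum]
    refine Finset.sum_congr rfl fun g hg => ?_
    obtain ⟨hm, rfl⟩ := mem_monics.1 hg
    rw [rootSum_add_X_pow hf hm hk, ← AddChar.map_add_eq_mul, add_sub_cancel]
  by_contra h3
  exact hψ ((mul_eq_right₀ h3).1 h2.symm)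

open Classical in
lemma sum_monics_dvd {P : F[X]} (hP : P.Monic) {k s : ℕ} :
    ∑ g ∈ monics F k with P ^ s ∣ g, ψ (rootSum f g) =
      if s * P.natDegree ≤ k then ψ (rootSum f P) ^ s * lcoeff ψ f (k - s * P.natDegree)
        else 0 := by
  have hdeg : ∀ h : F[X], h.Monic → (P ^ s * h).natDegree = s * P.natDegree + h.natDegree :=
    fun h hh => by rw [(hP.pow s).natDegree_mul hh, natDegree_pow]
  split_ifs with hk
  · rw [lcoeff, Finset.mul_sum]
    symm
    refine Finset.sum_bij (fun h _ => P ^ s * h) (fun h hh => ?_) (fun h _ h' _ hhh => ?_)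
      (fun g hg => ?_) fun h hh => ?_
    · obtain ⟨h1, h2⟩ := mem_monics.1 hh
      refine Finset.mem_filter.2 ⟨mem_monics.2 ⟨(hP.pow s).mul h1, ?_⟩, dvd_mul_right _ _⟩
      rw [hdeg h h1, h2]
      omega
    · exact mul_left_cancel₀ (pow_ne_zero s hP.ne_zero) hhh
    · obtain ⟨hg, h, rfl⟩ := Finset.mem_filter.1 hg
      obtain ⟨h1, h2⟩ := mem_monics.1 hg
      have h3 := (hP.pow s).of_mul_monic_left h1
      rw [hdeg h h3] at h2
      exact ⟨h, mem_monics.2 ⟨h3, by omega⟩, rfl⟩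
    · rw [rootSum_mul f (pow_ne_zero s hP.ne_zero) (mem_monics.1 hh).1.ne_zero,
        rootSum_pow f hP.ne_zero, AddChar.map_add_eq_mul, AddChar.map_nsmul_eq_pow]
  · refine Finset.sum_eq_zero fun g hg => (hk ?_).elim
    obtain ⟨hg, h, rfl⟩ := Finset.mem_filter.1 hg
    obtain ⟨h1, h2⟩ := mem_monics.1 hg
    rw [hdeg h ((hP.pow s).of_mul_monic_left h1)] at h2
    omega

lemma lpow_eq {j k : ℕ} (hj : j ∈ Finset.Icc 1 k) :
    lpow ψ f j = ∑ P ∈ primes F k, ∑ s ∈ Finset.Icc 1 k,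
      if s * P.natDegree = j then P.natDegree * ψ (rootSum f P) ^ s else 0 := by
  obtain ⟨hj1, hjk⟩ := Finset.mem_Icc.1 hj
  classical
  rw [lpow]
  refine Finset.sum_subset_zero_on_sdiff (fun P hP => ?_) (fun P hP => ?_) fun P hP => ?_
  · obtain ⟨h1, -⟩ := Finset.mem_filter.1 hP
    obtain ⟨h1, h2, h3⟩ := mem_primes.1 h1
    exact mem_primes.2 ⟨h1, h2.trans hjk, h3⟩
  · obtain ⟨h1, h2⟩ := Finset.mem_sdiff.1 hP
    obtain ⟨h3, h4, h5⟩ := mem_primes.1 h1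
    refine Finset.sum_eq_zero fun s _ => if_neg fun h6 => h2 ?_
    have h7 : P.natDegree ∣ j := ⟨s, by rw [← h6, mul_comm]⟩
    exact Finset.mem_filter.2 ⟨mem_primes.2 ⟨h3, Nat.le_of_dvd hj1 h7, h5⟩, h7⟩
  · obtain ⟨h1, s, rfl⟩ := Finset.mem_filter.1 hP
    obtain ⟨-, -, h3⟩ := mem_primes.1 h1
    have h4 := h3.natDegree_pos
    have h5 : 0 < s := Nat.pos_of_mul_pos_left hj1
    have h6 : s ≤ P.natDegree * s := Nat.le_mul_of_pos_left s h4
    rw [Nat.mul_div_cancel_left s h4, Finset.sum_eq_single_of_mem s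
      (Finset.mem_Icc.2 ⟨h5, h6.trans hjk⟩), if_pos (mul_comm _ _)]
    exact fun t _ hts => if_neg fun h => hts (Nat.eq_of_mul_eq_mul_right h4 (by rw [h, mul_comm]))

lemma mul_lcoeff (k : ℕ) :
    k * lcoeff ψ f k = ∑ j ∈ Finset.Icc 1 k, lpow ψ f j * lcoeff ψ f (k - j) := by
  classical
  calc
    k * lcoeff ψ f k = ∑ P ∈ primes F k, ∑ s ∈ Finset.Icc 1 k,
        P.natDegree * ∑ g ∈ monics F k with P ^ s ∣ g, ψ (rootSum f g) := by
      rw [lcoeff, Finset.mul_sum]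
      simp_rw [Finset.mul_sum, Finset.sum_filter]
      rw [Finset.sum_congr rfl fun P _ => Finset.sum_comm, Finset.sum_comm]
      refine Finset.sum_congr rfl fun g hg => ?_
      nth_rewrite 1 [← sum_natDegree_primes hg]
      push_cast
      simp_rw [Finset.sum_mul, ite_mul, zero_mul]
    _ = ∑ P ∈ primes F k, ∑ s ∈ Finset.Icc 1 k, ∑ j ∈ Finset.Icc 1 k,
        if s * P.natDegree = j then P.natDegree * ψ (rootSum f P) ^ s * lcoeff ψ f (k - j)
          else 0 := by
      refine Finset.sum_congr rfl fun P hP => Finset.sum_congr rfl fun s hs => ?_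
      obtain ⟨h1, h2, h3⟩ := mem_primes.1 hP
      have := h3.natDegree_pos
      have := Nat.mul_pos (Finset.mem_Icc.1 hs).1 this
      rw [sum_monics_dvd h1, Finset.sum_ite_eq, mul_ite, mul_zero, mul_assoc]
      exact if_congr (by rw [Finset.mem_Icc]; omega) rfl rfl
    _ = _ := by
      rw [Finset.sum_congr rfl fun P _ => Finset.sum_comm, Finset.sum_comm]
      refine Finset.sum_congr rfl fun j hj => ?_
      rw [lpow_eq hj]
      simp_rw [Finset.sum_mul, ite_mul, zero_mul]

end EulerProduct

section FiniteFieldSums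

variable {F : Type*} [Field F]

lemma algebraMap_rootSum (f : F[X]) {g : F[X]} (hg : g.Monic) {Ω : Type*} [Field Ω] [Algebra F Ω]
    (hs : (g.map (algebraMap F Ω)).Splits) :
    algebraMap F Ω (rootSum f g) = ((g.aroots Ω).map fun α => aeval α f).sum := by
  have h : ∀ i, algebraMap F Ω (PowerSeries.coeff i (psum g)) =
      ((g.aroots Ω).map (· ^ i)).sum := by
    intro i
    rw [← coeff_psum_prod, ← PowerSeries.coeff_map, ← psum_map _ hg.ne_zero]
    conv_lhs => rw [hs.eq_prod_roots_of_monic (hg.map _)]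
  rw [rootSum, map_sum]
  simp_rw [map_mul, h, aeval_eq_sum_range, Algebra.smul_def]
  simp_rw [← Multiset.sum_map_mul_left]
  exact Multiset.sum_map_sum_map (Finset.range (f.natDegree + 1)).val (g.aroots Ω)

variable [Finite F] {K : Type*} [Field K] [Finite K] [Algebra F K]

lemma trace_aeval (f : F[X]) (x : K) :
    Algebra.trace F K (aeval x f) =
      (Module.finrank F K / (minpoly F x).natDegree) • rootSum f (minpoly F x) := by
  have hx : IsIntegral F x := Algebra.IsIntegral.isIntegral x
  have : FiniteDimensional F K := Module.Finite.of_finite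
  set L := IntermediateField.adjoin F {x}
  have h1 : aeval x f = algebraMap L K (aeval (IntermediateField.AdjoinSimple.gen F x) f) := by
    rw [← aeval_algebraMap_apply, IntermediateField.AdjoinSimple.algebraMap_gen]
  have h2 : Module.finrank F K / (minpoly F x).natDegree = Module.finrank L K := by
    rw [← IntermediateField.adjoin.finrank hx, ← Module.finrank_mul_finrank F L K,
      Nat.mul_div_cancel_left _ Module.finrank_pos]
  rw [h1, ← Algebra.trace_trace (S := L), Algebra.trace_algebraMap, map_nsmul, h2]
  congr 1
  apply (algebraMap F (AlgebraicClosure F)).injective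
  have hsep : (minpoly F x).Separable := Algebra.IsSeparable.isSeparable F x
  rw [algebraMap_rootSum f (minpoly.monic hx) (IsAlgClosed.splits _),
    trace_eq_sum_embeddings (AlgebraicClosure F)]
  classical
  rw [Fintype.sum_equiv (IntermediateField.algHomAdjoinIntegralEquiv F hx) _
    (fun y => aeval (y : AlgebraicClosure F) f), Finset.sum_mem_multiset _ _ (fun y => aeval y f)
      (fun _ => rfl), Finset.sum_eq_multiset_sum, Multiset.toFinset_val, Multiset.dedup_eq_self.2]
  · exact nodup_roots hsep.map
  · intro σ
    obtain ⟨y, rfl⟩ := (IntermediateField.algHomAdjoinIntegralEquiv F hx).symm.surjective σ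
    rw [← aeval_algHom_apply, IntermediateField.algHomAdjoinIntegralEquiv_symm_apply_gen,
      Equiv.apply_symm_apply]

lemma card_filter_minpoly [Fintype K] [DecidableEq F[X]] {P : F[X]} (hP : P.Monic)
    (hP' : Irreducible P) (hd : P.natDegree ∣ Module.finrank F K) :
    (Finset.univ.filter fun x : K => minpoly F x = P).card = P.natDegree := by
  have hs : (P.map (algebraMap F K)).Splits := by
    have h1 : P ∣ X ^ Nat.card F ^ Module.finrank F K - X :=
      hP'.natDegree_dvd_iff_dvd_X_pow_card_pow_sub_X.1 hd
    have h2 := Polynomial.map_dvd (algebraMap F K) h1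
    rw [← Module.natCard_eq_pow_finrank, Polynomial.map_sub, Polynomial.map_pow, map_X,
      Nat.card_eq_fintype_card] at h2
    refine Splits.of_dvd ?_ (FiniteField.X_pow_card_sub_X_ne_zero K Fintype.one_lt_card) h2
    rw [splits_iff_card_roots, FiniteField.roots_X_pow_card_sub_X,
      FiniteField.X_pow_card_sub_X_natDegree_eq K Fintype.one_lt_card]
    rfl
  have hsep : P.Separable := PerfectField.separable_of_irreducible hP'
  rw [← card_rootSet_eq_natDegree hsep hs, ← Set.toFinset_card]
  congr 1
  ext x
  rw [Finset.mem_filter_univ, Set.mem_toFinset, mem_rootSet_of_ne hP.ne_zero]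
  refine ⟨fun h => h ▸ minpoly.aeval F x, fun h => ?_⟩
  exact (minpoly.eq_of_irreducible_of_monic hP' h hP).symm

lemma lpow_finrank (ψ : AddChar F ℂ) (f : F[X]) [Fintype K] :
    lpow ψ f (Module.finrank F K) = ∑ x : K, ψ (Algebra.trace F K (aeval x f)) := by
  classical
  have : FiniteDimensional F K := Module.Finite.of_finite
  have hmaps : ∀ x : K, minpoly F x ∈
      (primes F (Module.finrank F K)).filter fun P => P.natDegree ∣ Module.finrank F K := by
    intro x
    have hx : IsIntegral F x := Algebra.IsIntegral.isIntegral x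
    have h := minpoly.degree_dvd hx
    exact Finset.mem_filter.2 ⟨mem_primes.2 ⟨minpoly.monic hx,
      Nat.le_of_dvd Module.finrank_pos h, minpoly.irreducible hx⟩, h⟩
  rw [lpow, ← Finset.sum_fiberwise_of_maps_to fun x _ => hmaps x]
  refine Finset.sum_congr rfl fun P hP => ?_
  obtain ⟨h1, h2⟩ := Finset.mem_filter.1 hP
  obtain ⟨h3, -, h4⟩ := mem_primes.1 h1
  rw [Finset.sum_congr rfl (g := fun _ => ψ (rootSum f P) ^ (Module.finrank F K / P.natDegree))
    fun x hx => by
      rw [trace_aeval, (Finset.mem_filter.1 hx).2, AddChar.map_nsmul_eq_pow],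
    Finset.sum_const, card_filter_minpoly h3 h4 h2, nsmul_eq_mul]

end FiniteFieldSums

section Weil

lemma norm_le_of_norm_sum_pow_le (s : Multiset ℂ) {B R : ℝ} (hR : 0 ≤ R)
    (h : ∀ n, 0 < n → ‖(s.map (· ^ n)).sum‖ ≤ B * R ^ n) {β : ℂ} (hβ : β ∈ s) : ‖β‖ ≤ R := by
  set T := s.toFinset
  set Q : ℂ[X] := ∏ γ ∈ T.erase β, (X - C γ)
  have hQ : Q.eval β ≠ 0 := by
    rw [eval_prod]
    exact Finset.prod_ne_zero_iff.2 fun γ hγ => by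
      simpa [sub_eq_zero] using (Finset.ne_of_mem_erase hγ).symm
  have hQ0 : ∀ α ∈ s, α ≠ β → Q.eval α = 0 := fun α hα hne => by
    rw [eval_prod]
    exact Finset.prod_eq_zero (Finset.mem_erase.2 ⟨hne, Multiset.mem_toFinset.2 hα⟩) (by simp)
  have hcount : 1 ≤ s.count β := Multiset.one_le_count_iff_mem.2 hβ
  have hsum : ∀ N, ∑ t ∈ Finset.range (Q.natDegree + 1),
      Q.coeff t * (s.map (· ^ (N + t))).sum = s.count β * (β ^ N * Q.eval β) := by
    intro N
    have h1 : (s.map fun α => α ^ N * Q.eval α).sum = s.count β * (β ^ N * Q.eval β) := by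
      rw [Finset.sum_multiset_map_count, Finset.sum_eq_single_of_mem β (Multiset.mem_toFinset.2 hβ),
        nsmul_eq_mul]
      intro α hα hne
      rw [hQ0 α (Multiset.mem_toFinset.1 hα) hne, mul_zero, smul_zero]
    rw [← h1]
    simp_rw [eval_eq_sum_range, Finset.mul_sum, ← Multiset.sum_map_mul_left]
    refine (Multiset.sum_map_sum_map (Finset.range (Q.natDegree + 1)).val s).trans ?_
    refine congrArg Multiset.sum (Multiset.map_congr rfl fun α _ => ?_)
    exact Finset.sum_congr rfl fun t _ => by ring
  set A := ∑ t ∈ Finset.range (Q.natDegree + 1), ‖Q.coeff t‖ * (B * R ^ t) with hA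
  have hbound : ∀ N, 0 < N → ‖β‖ ^ N * ‖Q.eval β‖ ≤ A * R ^ N := by
    intro N hN
    have h1 := congrArg norm (hsum N)
    rw [norm_mul, norm_mul, norm_pow, Complex.norm_natCast] at h1
    have h2 : ‖β‖ ^ N * ‖Q.eval β‖ ≤ s.count β * (‖β‖ ^ N * ‖Q.eval β‖) :=
      le_mul_of_one_le_left (by positivity) (by exact_mod_cast hcount)
    rw [← h1] at h2
    refine h2.trans ((norm_sum_le _ _).trans ?_)
    rw [hA, Finset.sum_mul]
    refine Finset.sum_le_sum fun t _ => ?_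
    rw [norm_mul, mul_assoc, mul_assoc, ← pow_add, add_comm t]
    exact mul_le_mul_of_nonneg_left (h _ (by omega)) (norm_nonneg _)
  by_contra! hlt
  have hβ0 : 0 < ‖β‖ := hR.trans_lt hlt
  have hQ' : 0 < ‖Q.eval β‖ := norm_pos_iff.2 hQ
  rcases hR.eq_or_lt with rfl | hR
  · have := hbound 1 one_pos
    rw [pow_one, pow_one, mul_zero] at this
    exact (mul_pos hβ0 hQ').not_ge this
  · obtain ⟨N, hN⟩ := pow_unbounded_of_one_lt (max 1 (A / ‖Q.eval β‖)) ((one_lt_div hR).2 hlt)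
    have hN0 : 0 < N := by
      rcases Nat.eq_zero_or_pos N with rfl | hN0
      · exact absurd ((le_max_left _ _).trans_lt hN) (by simp)
      · exact hN0
    have h1 := (le_max_right _ _).trans_lt hN
    rw [div_pow, div_lt_div_iff₀ hQ' (by positivity)] at h1
    exact h1.not_ge (hbound N hN0)

variable {p : ℕ} [hp : Fact p.Prime] {f : (ZMod p)[X]} {ψ : AddChar (ZMod p) ℂ}

lemma addChar_zmod_ne_one (hψ : ψ ≠ 1) {a : ZMod p} (ha : a ≠ 0) : ψ a ≠ 1 := by
  refine fun h => hψ ?_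
  ext x
  have : x = (x / a).val • a := by
    rw [nsmul_eq_mul, ZMod.natCast_zmod_val, div_mul_cancel₀ _ ha]
  rw [this, AddChar.map_nsmul_eq_pow, h, one_pow, AddChar.one_apply]

lemma exists_roots (hψ : ψ ≠ 1) (hf : 0 < f.natDegree) (hfp : f.natDegree < p) :
    ∃ s : Multiset ℂ, s.card = f.natDegree ∧
      ∀ j, 0 < j → (s.map (· ^ j)).sum = -lpow ψ f j := by
  set d := f.natDegree
  have hd : ψ (d * f.leadingCoeff) ≠ 1 := by
    refine addChar_zmod_ne_one hψ (mul_ne_zero ?_ ?_)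
    · rw [Ne, ZMod.natCast_eq_zero_iff]
      exact Nat.not_dvd_of_pos_of_lt hf hfp
    · exact leadingCoeff_ne_zero.2 (ne_zero_of_natDegree_gt hf)
  have hc : ∀ k, d ≤ k → lcoeff ψ f k = 0 := fun k hk => lcoeff_eq_zero hf hd hk
  set L : ℂ[X] := ∑ k ∈ Finset.range d, C (lcoeff ψ f k) * X ^ (d - k)
  have hcoeff : ∀ n ≤ d, L.coeff (d - n) = lcoeff ψ f n := by
    intro n hn
    simp_rw [L, finsetSum_coeff, coeff_C_mul, coeff_X_pow]
    rcases hn.eq_or_lt with rfl | hn'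
    · rw [hc _ le_rfl]
      exact Finset.sum_eq_zero fun k hk => by
        rw [if_neg (by rw [Finset.mem_range] at hk; omega), mul_zero]
    · rw [Finset.sum_eq_single_of_mem n (Finset.mem_range.2 hn'), if_pos rfl, mul_one]
      intro k hk hne
      rw [if_neg (by rw [Finset.mem_range] at hk; omega), mul_zero]
  have hle : L.natDegree ≤ d := natDegree_sum_le_of_forall_le _ _ fun k _ =>
    (natDegree_C_mul_X_pow_le _ _).trans (Nat.sub_le _ _)
  have hlead : L.coeff d = 1 := by
    have := hcoeff 0 (Nat.zero_le _)
    rwa [Nat.sub_zero, lcoeff_zero] at this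
  have hm : L.Monic := monic_of_natDegree_le_of_coeff_eq_one d hle hlead
  have hdeg : L.natDegree = d :=
    hle.antisymm (le_natDegree_of_ne_zero (by rw [hlead]; exact one_ne_zero))
  have hrev : rev L = PowerSeries.mk (lcoeff ψ f) := by
    ext n
    rw [coeff_rev, hdeg, PowerSeries.coeff_mk]
    rcases le_or_gt n d with hn | hn
    · rw [revAt_le hn, hcoeff n hn]
    · rw [revAt_eq_self_of_lt hn, hc n hn.le, coeff_eq_zero_of_natDegree_lt (hle.trans_lt hn)]
  set S : PowerSeries ℂ := PowerSeries.mk fun j => if j = 0 then 0 else lpow ψ f j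
  have hS : S * rev L = PowerSeries.X * PowerSeries.derivative ℂ (rev L) := by
    ext n
    rw [PowerSeries.coeff_mul, Finset.Nat.sum_antidiagonal_eq_sum_range_succ
      (fun i j => PowerSeries.coeff i S * PowerSeries.coeff j (rev L)), hrev,
      Finset.range_eq_Ico, Finset.sum_eq_sum_Ico_succ_bot n.succ_pos]
    simp only [S, PowerSeries.coeff_mk, if_true, zero_mul, zero_add]
    have h1 : PowerSeries.coeff n (PowerSeries.X *
        PowerSeries.derivative ℂ (PowerSeries.mk (lcoeff ψ f))) = n * lcoeff ψ f n := by
      rcases n with _ | n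
      · simp
      · rw [PowerSeries.coeff_succ_X_mul, PowerSeries.coeff_derivative, PowerSeries.coeff_mk,
          mul_comm]
        push_cast
        ring
    rw [h1, mul_lcoeff]
    refine Finset.sum_congr rfl fun j hj => ?_
    rw [if_neg (by have := (Finset.mem_Ico.1 hj).1; omega)]
  have hpsum : PowerSeries.C (d : ℂ) - S = psum L := by
    refine eq_psum hm.ne_zero ?_
    rw [hdeg, sub_mul, hS]
  have hs := IsAlgClosed.splits L
  refine ⟨L.roots, by rw [← hs.natDegree_eq_card_roots, hdeg], fun j hj => ?_⟩
  rw [← coeff_psum_prod, ← hs.eq_prod_roots_of_monic hm, ← hpsum, map_sub, PowerSeries.coeff_C,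
    if_neg hj.ne', zero_sub, PowerSeries.coeff_mk, if_neg hj.ne']

/-- Weil's bound for exponential sums with a polynomial argument. -/
theorem norm_sum_le_mul_sqrt (hψ : ψ ≠ 1) (hf : 0 < f.natDegree) (hfp : f.natDegree < p) :
    ‖∑ x : ZMod p, ψ (f.eval x)‖ ≤ f.natDegree * √p := by
  obtain ⟨s, hcard, hs⟩ := exists_roots hψ hf hfp
  obtain ⟨B, hB⟩ := exists_norm_sum_even_le hf
    (Nat.coprime_of_lt_prime hf.ne' hfp hp.out).symm
  have hroot : ∀ ω ∈ s, ‖ω‖ ≤ √p := by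
    intro ω hω
    refine Real.le_sqrt_of_sq_le ?_
    rw [← norm_pow]
    refine norm_le_of_norm_sum_pow_le (s.map (· ^ 2)) (B := B) (Nat.cast_nonneg p) (fun n hn => ?_)
      (Multiset.mem_map_of_mem _ hω)
    obtain ⟨ν, rfl⟩ : ∃ ν, n = ν + 1 := ⟨n - 1, by omega⟩
    have h2 : 2 * (ν + 1) ≠ 0 := by omega
    have := Fintype.ofFinite (GaloisField p (2 * (ν + 1)))
    have h1 := hB ν (GaloisField p (2 * (ν + 1))) (by
      rw [← Nat.card_eq_fintype_card, GaloisField.card p _ h2, ← pow_mul, mul_comm]) ψ hψ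
    rw [← lpow_finrank, GaloisField.finrank p h2] at h1
    simp_rw [Multiset.map_map, Function.comp_apply, ← pow_mul]
    rwa [hs _ (by omega), norm_neg]
  have h1 : ∑ x : ZMod p, ψ (f.eval x) = -(s.map (· ^ 1)).sum := by
    have h2 := lpow_finrank (K := ZMod p) ψ f
    rw [Module.finrank_self] at h2
    rw [hs 1 one_pos, neg_neg, h2]
    exact Finset.sum_congr rfl fun x _ => by rw [Algebra.trace_self_apply, coe_aeval_eq_eval]
  rw [h1, norm_neg, ← hcard]
  refine (norm_multiset_sum_le _).trans ?_
  rw [Multiset.map_map, ← nsmul_eq_mul, ← Multiset.card_map (norm ∘ (· ^ 1)) s]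
  refine Multiset.sum_le_card_nsmul _ _ fun r hr => ?_
  obtain ⟨ω, hω, rfl⟩ := Multiset.mem_map.1 hr
  simpa using hroot ω hω

end Weil

section Heights

variable {p : ℕ} [hp : Fact p.Prime]

/-- The common form of `Hfun` (`s = 1`) and `Jfun` (`s = 2`). -/
noncomputable def hfun (s : ℕ) (P : ℚ_[p][X]) (z : ℤ_[p]) : NNReal :=
  (Finset.Icc s P.natDegree).sup fun k =>
    ‖(derivative^[k] P).eval (z : ℚ_[p]) / (k.factorial : ℚ_[p])‖₊ ^ ((1 : ℝ) / (k : ℝ))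

/-- The common form of `Hinf` (`s = 1`) and `Jinf` (`s = 2`). -/
noncomputable def hinf (s : ℕ) (P : ℚ_[p][X]) : NNReal := ⨅ z : ℤ_[p], hfun s P z

variable {s : ℕ} {P : ℚ_[p][X]}

lemma hfun_le_iff (hs : 0 < s) {z : ℤ_[p]} {T : NNReal} :
    hfun s P z ≤ T ↔
      ∀ k, s ≤ k → ‖(taylor (z : ℚ_[p]) P).coeff k‖₊ ^ ((1 : ℝ) / (k : ℝ)) ≤ T := by
  have h : ∀ k, (derivative^[k] P).eval (z : ℚ_[p]) / (k.factorial : ℚ_[p]) =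
      (taylor (z : ℚ_[p]) P).coeff k := fun k => by
    rw [taylor_coeff, ← factorial_smul_hasseDeriv, LinearMap.smul_apply, eval_smul, nsmul_eq_mul,
      mul_div_cancel_left₀ _ (Nat.cast_ne_zero.2 k.factorial_ne_zero)]
  simp_rw [hfun, Finset.sup_le_iff, Finset.mem_Icc, h]
  refine ⟨fun H k hk => ?_, fun H k hk => H k hk.1⟩
  rcases le_or_gt k P.natDegree with hkd | hkd
  · exact H k ⟨hk, hkd⟩
  · rw [coeff_eq_zero_of_natDegree_lt (by rwa [natDegree_taylor]), nnnorm_zero,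
      NNReal.zero_rpow (one_div_ne_zero (Nat.cast_ne_zero.2 (hs.trans_le hk).ne'))]
    exact zero_le

lemma hinf_le_hfun (z : ℤ_[p]) : hinf s P ≤ hfun s P z := ciInf_le (OrderBot.bddBelow _) z

lemma hinf_add_C_le (hs : 0 < s) (c : ℚ_[p]) : hinf s (P + C c) ≤ hinf s P := by
  refine le_ciInf fun z => (hinf_le_hfun z).trans ((hfun_le_iff hs).2 fun k hk => ?_)
  rw [map_add, taylor_C, coeff_add, coeff_C_of_ne_zero (by omega), add_zero]
  exact (hfun_le_iff hs).1 le_rfl k hk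

lemma hinf_le_mul_hinf_comp (hs : 0 < s) (a : ℤ) :
    hinf s P ≤ p * hinf s (P.comp (C (a : ℚ_[p]) + C (p : ℚ_[p]) * X)) := by
  rw [hinf, hinf, NNReal.mul_iInf]
  refine le_ciInf fun z => (hinf_le_hfun ((a : ℤ_[p]) + (p : ℤ_[p]) * z)).trans ((hfun_le_iff hs).2 fun k hk => ?_)
  have h1 := (hfun_le_iff hs).1 (le_refl (hfun s (P.comp (C (a : ℚ_[p]) + C (p : ℚ_[p]) * X)) z)) k hk
  have h2 : taylor (z : ℚ_[p]) (P.comp (C (a : ℚ_[p]) + C (p : ℚ_[p]) * X)) =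
      (taylor (((a : ℤ_[p]) + (p : ℤ_[p]) * z : ℤ_[p]) : ℚ_[p]) P).comp (C (p : ℚ_[p]) * X) := by
    simp only [taylor_apply, comp_assoc]
    congr 1
    simp
    ring
  rw [h2, comp_C_mul_X_coeff, nnnorm_mul, nnnorm_pow, NNReal.mul_rpow, ← NNReal.rpow_natCast,
    ← NNReal.rpow_mul, mul_one_div_cancel (Nat.cast_ne_zero.2 (by omega)), NNReal.rpow_one] at h1
  have hp0 : (p : NNReal) * ‖(p : ℚ_[p])‖₊ = 1 := by
    ext
    simp [hp.out.ne_zero]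
  calc _ = (p : NNReal) * ‖(p : ℚ_[p])‖₊ *
        ‖(taylor (((a : ℤ_[p]) + (p : ℤ_[p]) * z : ℤ_[p]) : ℚ_[p]) P).coeff k‖₊ ^ ((1 : ℝ) / (k : ℝ)) := by
          rw [hp0, one_mul]
    _ ≤ _ := by
      rw [mul_assoc, mul_comm ‖(p : ℚ_[p])‖₊]
      exact mul_le_mul_right h1 _

lemma hinf_padicScaled_le (hs : 0 < s) (n : ℕ) (g : ℤ[X]) :
    hinf s (padicScaled p n g) ≤ ((p : NNReal) ^ n) ^ ((1 : ℝ) / (s : ℝ)) := by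
  refine (hinf_le_hfun 0).trans ((hfun_le_iff hs).2 fun k hk => ?_)
  have h1 : ‖(taylor ((0 : ℤ_[p]) : ℚ_[p]) (padicScaled p n g)).coeff k‖₊ ≤ (p : NNReal) ^ n := by
    rw [PadicInt.coe_zero, taylor_zero, padicScaled, coeff_C_mul, coeff_map, nnnorm_mul]
    refine mul_le_of_le_of_le_one ?_ ?_
    · rw [← NNReal.coe_le_coe]
      simp
    · exact_mod_cast Padic.norm_int_le_one (g.coeff k)
  refine (NNReal.rpow_le_rpow h1 (by positivity)).trans ?_
  refine NNReal.rpow_le_rpow_of_exponent_le ?_ ?_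
  · exact one_le_pow₀ (by exact_mod_cast hp.out.one_le)
  · exact one_div_le_one_div_of_le (by exact_mod_cast hs) (by exact_mod_cast hk)

lemma hinf_padicScaled_C_add_le (hs : 0 < s) {n σ : ℕ} (h : σ ≤ n) (c : ℤ) (g : ℤ[X]) :
    hinf s (padicScaled p n (C c + C ((p : ℤ) ^ σ) * g)) ≤ hinf s (padicScaled p (n - σ) g) := by
  have h1 : padicScaled p n (C c + C ((p : ℤ) ^ σ) * g) =
      padicScaled p (n - σ) g + C (((p : ℚ_[p]) ^ n)⁻¹ * c) := by
    have hp0 : (p : ℚ_[p]) ≠ 0 := Nat.cast_ne_zero.2 hp.out.ne_zero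
    obtain ⟨m, rfl⟩ := Nat.exists_eq_add_of_le h
    rw [Nat.add_sub_cancel_left, padicScaled, padicScaled, Polynomial.map_add, Polynomial.map_mul,
      map_C, map_C, mul_add, ← C_mul, ← mul_assoc, ← C_mul, add_comm]
    congr 3
    simp only [eq_intCast, Int.cast_pow, Int.cast_natCast, pow_add]
    field_simp
  rw [h1]
  exact hinf_add_C_le hs _

lemma hinf_padicScaled_C_add_le_one (hs : 0 < s) {n σ : ℕ} (h : n ≤ σ) (c : ℤ) (g : ℤ[X]) :
    hinf s (padicScaled p n (C c + C ((p : ℤ) ^ σ) * g)) ≤ 1 := by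
  obtain ⟨m, rfl⟩ := Nat.exists_eq_add_of_le h
  rw [pow_add, C_mul, mul_assoc]
  refine (hinf_padicScaled_C_add_le hs le_rfl c _).trans ((hinf_padicScaled_le hs _ _).trans ?_)
  rw [Nat.sub_self, pow_zero, NNReal.one_rpow]

lemma hinf_padicScaled_le_mul (hs : 0 < s) (n : ℕ) (g : ℤ[X]) (a : ℤ) :
    hinf s (padicScaled p n g) ≤ p * hinf s (padicScaled p n (g.comp (C a + C (p : ℤ) * X))) := by
  refine (hinf_le_mul_hinf_comp hs a).trans_eq ?_
  simp [padicScaled, mul_comp, Polynomial.map_comp]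

end Heights

section Sums

/-- The additive character `a ↦ exp (2πia / p ^ n)`. -/
noncomputable def e (p n : ℕ) (a : ℤ) : ℂ :=
  Complex.exp (2 * (Real.pi : ℂ) * Complex.I * (a : ℂ) / (p : ℂ) ^ n)

/-- The mean of `e p n (g x)` over `x < p ^ M`. -/
noncomputable def mean (p M n : ℕ) (g : ℤ[X]) : ℂ :=
  ((p : ℂ) ^ M)⁻¹ * ∑ x ∈ Finset.range (p ^ M), e p n (g.eval (x : ℤ))

lemma norm_e {p : ℕ} (n : ℕ) (a : ℤ) : ‖e p n a‖ = 1 := by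
  rw [e, show 2 * (Real.pi : ℂ) * Complex.I * (a : ℂ) / (p : ℂ) ^ n =
    ((2 * Real.pi * a / (p : ℝ) ^ n : ℝ) : ℂ) * Complex.I by push_cast; ring]
  exact Complex.norm_exp_ofReal_mul_I _

lemma e_add {p : ℕ} (n : ℕ) (a b : ℤ) : e p n (a + b) = e p n a * e p n b := by
  rw [e, e, e, ← Complex.exp_add]
  congr 1
  push_cast
  ring

lemma sum_range_mul {A : Type*} [AddCommMonoid A] {p : ℕ} (hp : 0 < p) (N : ℕ) (F : ℕ → A) :
    ∑ x ∈ Finset.range (p * N), F x =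
      ∑ a ∈ Finset.range p, ∑ y ∈ Finset.range N, F (a + p * y) := by
  rw [← Finset.sum_product']
  symm
  refine Finset.sum_nbij' (fun v => v.1 + p * v.2) (fun x => (x % p, x / p)) ?_ ?_ ?_ ?_ ?_
  · rintro ⟨a, y⟩ h
    rw [Finset.mem_product, Finset.mem_range, Finset.mem_range] at h
    rw [Finset.mem_range]
    calc a + p * y < p + p * y := Nat.add_lt_add_right h.1 _
      _ = p * (y + 1) := by ring
      _ ≤ p * N := Nat.mul_le_mul_left p h.2
  · intro x hx
    rw [Finset.mem_range] at hx
    exact Finset.mem_product.2 ⟨Finset.mem_range.2 (Nat.mod_lt _ hp),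
      Finset.mem_range.2 (Nat.div_lt_of_lt_mul hx)⟩
  · rintro ⟨a, y⟩ h
    rw [Finset.mem_product, Finset.mem_range, Finset.mem_range] at h
    simp [Nat.mod_eq_of_lt h.1, Nat.add_mul_div_left _ _ hp, Nat.div_eq_of_lt h.1]
  · exact fun x _ => Nat.mod_add_div x p
  · exact fun _ _ => rfl

lemma sum_range_add_of_periodic {A : Type*} [AddCommGroup A] {N : ℕ} {F : ℕ → A}
    (hF : ∀ y, F (y + N) = F y) (c : ℕ) :
    ∑ y ∈ Finset.range N, F (y + c) = ∑ y ∈ Finset.range N, F y := by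
  induction c with
  | zero => rfl
  | succ c ih =>
    have h := Finset.sum_range_succ' (fun y => F (y + c)) N
    rw [Finset.sum_range_succ, add_comm N, hF, zero_add] at h
    rw [← ih, add_right_cancel h]
    exact Finset.sum_congr rfl fun y _ => by rw [add_right_comm, add_assoc]

variable {p : ℕ} [hp : Fact p.Prime]

lemma e_add_mul (n k : ℕ) (a : ℤ) : e p (n + k) (p ^ k * a) = e p n a := by
  have hp0 : (p : ℂ) ≠ 0 := Nat.cast_ne_zero.2 hp.out.ne_zero
  rw [e, e]
  congr 1
  push_cast
  rw [pow_add]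
  field_simp

lemma e_mul_eq_one (n : ℕ) (a : ℤ) : e p n (p ^ n * a) = 1 := by
  have := e_add_mul (p := p) 0 n a
  rw [zero_add] at this
  rw [this, e, pow_zero, div_one, mul_comm]
  exact Complex.exp_int_mul_two_pi_mul_I a

lemma e_congr {n : ℕ} {a b : ℤ} (h : (p : ℤ) ^ n ∣ a - b) : e p n a = e p n b := by
  obtain ⟨c, hc⟩ := h
  rw [sub_eq_iff_eq_add.1 hc, e_add, e_mul_eq_one, one_mul]

lemma e_one (a : ℤ) : e p 1 a = ZMod.stdAddChar (a : ZMod p) := by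
  rw [ZMod.stdAddChar_coe, e, pow_one]

lemma norm_mean_le_one (M n : ℕ) (g : ℤ[X]) : ‖mean p M n g‖ ≤ 1 := by
  have hp0 : (0 : ℝ) < p ^ M := by have := hp.out.pos; positivity
  rw [mean, norm_mul, norm_inv, norm_pow, Complex.norm_natCast, inv_mul_le_one₀ hp0]
  refine (norm_sum_le _ _).trans ?_
  simp [norm_e]

lemma norm_mean_C_add {M n σ : ℕ} (h : σ ≤ n) (c : ℤ) (g : ℤ[X]) :
    ‖mean p M n (C c + C ((p : ℤ) ^ σ) * g)‖ = ‖mean p M (n - σ) g‖ := by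
  obtain ⟨m, rfl⟩ := Nat.exists_eq_add_of_le h
  have h1 : ∀ x : ℤ, e p (σ + m) ((C c + C ((p : ℤ) ^ σ) * g).eval x) =
      e p (σ + m) c * e p m (g.eval x) := fun x => by
    rw [eval_add, eval_C, eval_mul, eval_C, e_add, add_comm σ, e_add_mul]
  rw [mean, mean, Nat.add_sub_cancel_left]
  simp_rw [h1]
  rw [← Finset.mul_sum, mul_left_comm, norm_mul, norm_e, one_mul]

lemma sum_range_eq_sum_zmod {A : Type*} [AddCommMonoid A] (F : ZMod p → A) :
    ∑ a ∈ Finset.range p, F a = ∑ x, F x := by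
  refine Finset.sum_nbij' (fun a => (a : ZMod p)) ZMod.val ?_ ?_ ?_ ?_ ?_
  · simp
  · exact fun x _ => Finset.mem_range.2 (ZMod.val_lt x)
  · exact fun a ha => ZMod.val_cast_of_lt (Finset.mem_range.1 ha)
  · exact fun x _ => ZMod.natCast_zmod_val x
  · simp

lemma mean_succ (M n : ℕ) (g : ℤ[X]) :
    mean p (M + 1) n g =
      (p : ℂ)⁻¹ * ∑ a ∈ Finset.range p, mean p M n (g.comp (C (a : ℤ) + C (p : ℤ) * X)) := by
  simp_rw [mean, ← Finset.mul_sum]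
  rw [pow_succ', pow_succ', sum_range_mul hp.out.pos, mul_inv, mul_assoc]
  simp

lemma mean_one_eq (M : ℕ) (g : ℤ[X]) :
    mean p (M + 1) 1 g =
      (p : ℂ)⁻¹ * ∑ x, ZMod.stdAddChar ((g.map (Int.castRingHom (ZMod p))).eval x) := by
  rw [mean_succ, ← sum_range_eq_sum_zmod]
  congr 1
  refine Finset.sum_congr rfl fun a _ => ?_
  have hp0 : (p : ℂ) ^ M ≠ 0 := pow_ne_zero _ (Nat.cast_ne_zero.2 hp.out.ne_zero)
  have h : ∀ y : ℕ, e p 1 ((g.comp (C (a : ℤ) + C (p : ℤ) * X)).eval (y : ℤ)) =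
      ZMod.stdAddChar ((g.map (Int.castRingHom (ZMod p))).eval (a : ZMod p)) := fun y => by
    have h1 := eval_intCast_map (Int.castRingHom (ZMod p)) g (a + p * y)
    rw [e_one]
    congr 1
    simpa using h1.symm
  rw [mean, Finset.sum_congr rfl fun y _ => h y, Finset.sum_const, Finset.card_range, nsmul_eq_mul,
    Nat.cast_pow, inv_mul_cancel_left₀ hp0]

lemma mean_comp_eq_zero {M n : ℕ} (hn : 2 ≤ n) (hM : n ≤ M + 1) {g : ℤ[X]} {a : ℤ}
    (ha : ¬(p : ℤ) ∣ g.derivative.eval a) :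
    mean p M n (g.comp (C a + C (p : ℤ) * X)) = 0 := by
  obtain ⟨k, rfl⟩ := Nat.exists_eq_add_of_le' hn
  have hev : ∀ y : ℤ, (g.comp (C a + C (p : ℤ) * X)).eval y = g.eval (a + p * y) := by simp
  have hper : ∀ y : ℕ, e p (k + 2) (g.eval (a + p * ((y + p ^ M : ℕ) : ℤ))) =
      e p (k + 2) (g.eval (a + p * (y : ℤ))) := fun y => by
    refine e_congr (dvd_trans ?_ (sub_dvd_eval_sub _ _ g))
    refine (pow_dvd_pow (p : ℤ) hM).trans ⟨1, ?_⟩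
    push_cast
    ring
  have hshift : ∀ y : ℕ, e p (k + 2) (g.eval (a + p * ((y + p ^ k : ℕ) : ℤ))) =
      e p (k + 2) (g.eval (a + p * (y : ℤ))) * e p 1 (g.derivative.eval a) := fun y => by
    rw [← e_add_mul 1 (k + 1), show 1 + (k + 1) = k + 2 by ring, ← e_add]
    apply e_congr
    obtain ⟨b, hb⟩ := binomExpansion g (a + p * (y : ℤ)) (p ^ (k + 1))
    obtain ⟨c, hc⟩ : (p : ℤ) ∣ g.derivative.eval (a + p * (y : ℤ)) - g.derivative.eval a :=
      dvd_trans ⟨(y : ℤ), by ring⟩ (sub_dvd_eval_sub _ _ _)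
    have h1 : a + p * ((y + p ^ k : ℕ) : ℤ) = a + p * (y : ℤ) + p ^ (k + 1) := by
      push_cast
      ring
    refine ⟨c + b * p ^ k, ?_⟩
    rw [h1, hb, sub_eq_iff_eq_add.1 hc]
    ring
  have hne : e p 1 (g.derivative.eval a) ≠ 1 := by
    rw [e_one]
    intro h
    rw [← AddChar.map_zero_eq_one (ZMod.stdAddChar (N := p))] at h
    exact ha ((ZMod.intCast_zmod_eq_zero_iff_dvd _ _).1 (ZMod.injective_stdAddChar h))
  simp_rw [mean, hev]
  have h := sum_range_add_of_periodic (N := p ^ M)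
    (F := fun y : ℕ => e p (k + 2) (g.eval (a + p * (y : ℤ)))) hper (p ^ k)
  simp_rw [hshift, ← Finset.sum_mul] at h
  by_contra h0
  exact hne ((mul_eq_left₀ (right_ne_zero_of_mul h0)).1 h)

end Sums

section Descent

lemma exists_eq_C_add_C_pow_mul {p : ℕ} [hp : Fact p.Prime] {h : ℤ[X]} (hh : 0 < h.natDegree) :
    ∃ (c : ℤ) (σ : ℕ) (g : ℤ[X]), h = C c + C ((p : ℤ) ^ σ) * g ∧ g.natDegree ≤ h.natDegree ∧
      0 < (g.map (Int.castRingHom (ZMod p))).natDegree := by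
  have hpZ : Prime (p : ℤ) := Nat.prime_iff_prime_int.1 hp.out
  have h0 : h - C (h.coeff 0) ≠ 0 := fun h1 => by
    rw [sub_eq_zero.1 h1, natDegree_C] at hh
    exact hh.false
  have hfin : FiniteMultiplicity (C (p : ℤ)) (h - C (h.coeff 0)) :=
    FiniteMultiplicity.of_prime_left (prime_C_iff.2 hpZ) h0
  obtain ⟨g, hg, hndvd⟩ := hfin.exists_eq_pow_mul_and_not_dvd
  rw [← C_pow] at hg
  set σ := multiplicity (C (p : ℤ)) (h - C (h.coeff 0))
  have hσ : (p : ℤ) ^ σ ≠ 0 := pow_ne_zero _ hpZ.ne_zero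
  refine ⟨h.coeff 0, σ, g, by rw [← hg]; ring, ?_, ?_⟩
  · rw [← natDegree_C_mul hσ, ← hg, natDegree_sub_C]
  · have hg0 : g.coeff 0 = 0 := by
      have := congrArg (coeff · 0) hg
      simp only [coeff_sub, coeff_C_zero, sub_self, coeff_C_mul] at this
      exact (mul_eq_zero.1 this.symm).resolve_left hσ
    rw [Nat.pos_iff_ne_zero]
    intro hd
    refine hndvd ((C_dvd_iff_dvd_coeff _ _).2 fun i => ?_)
    rcases Nat.eq_zero_or_pos i with rfl | hi
    · simp [hg0]
    · have := coeff_eq_zero_of_natDegree_lt (hd.trans_lt hi)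
      rw [coeff_map, eq_intCast] at this
      exact (ZMod.intCast_zmod_eq_zero_iff_dvd _ _).1 this

lemma derivative_ne_zero_of_natDegree_lt {p : ℕ} {K : Type*} [Field K] [CharP K p] {g : K[X]} (h0 : 0 < g.natDegree)
    (hlt : g.natDegree < p) : derivative g ≠ 0 := by
  intro h
  have h1 := congrArg (coeff · (g.natDegree - 1)) h
  simp only [coeff_derivative, coeff_zero] at h1
  rw [← Nat.cast_succ, Nat.succ_eq_add_one, Nat.sub_add_cancel h0, mul_eq_zero,
    coeff_natDegree, leadingCoeff_eq_zero, CharP.cast_eq_zero_iff K p] at h1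
  rcases h1 with rfl | h1
  · simp at h0
  · exact (Nat.le_of_dvd h0 h1).not_gt hlt

lemma sum_rootMultiplicity_le {K : Type*} [Field K] [Fintype K] (g : K[X]) :
    ∑ x, g.rootMultiplicity x ≤ g.natDegree := by
  classical
  simp_rw [← count_roots]
  rw [Multiset.sum_count_eq_card fun _ _ => Finset.mem_univ _]
  exact card_roots' g

variable {p : ℕ} [hp : Fact p.Prime]

lemma natDegree_derivative_map_le_rootMultiplicity {g h : ℤ[X]} {a c : ℤ} {σ : ℕ}
    (hg : derivative (g.map (Int.castRingHom (ZMod p))) ≠ 0)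
    (h_eq : g.comp (C a + C (p : ℤ) * X) = C c + C ((p : ℤ) ^ σ) * h) :
    (derivative (h.map (Int.castRingHom (ZMod p)))).natDegree ≤
      (derivative (g.map (Int.castRingHom (ZMod p)))).rootMultiplicity (a : ZMod p) := by
  have hp0 : (p : ℤ) ≠ 0 := Nat.cast_ne_zero.2 hp.out.ne_zero
  set μ := (derivative (g.map (Int.castRingHom (ZMod p)))).rootMultiplicity (a : ZMod p) with hμ
  set T := taylor a (derivative g) with hT
  have hTmap : T.map (Int.castRingHom (ZMod p)) =
      taylor (a : ZMod p) (derivative (g.map (Int.castRingHom (ZMod p)))) := by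
    rw [hT, taylor_apply, taylor_apply, map_comp, derivative_map]
    simp
  have hcoeff : ∀ k, (p : ℤ) ^ (k + 1) * T.coeff k = p ^ σ * (derivative h).coeff k := fun k => by
    have h1 := congrArg derivative h_eq
    have h2 : derivative (g.comp (C a + C (p : ℤ) * X)) =
        C (p : ℤ) * T.comp (C (p : ℤ) * X) := by
      rw [derivative_comp, hT, taylor_apply, comp_assoc]
      simp [add_comm]
    rw [h2, derivative_add, derivative_C, zero_add, derivative_C_mul] at h1
    have h3 := congrArg (coeff · k) h1
    simp only [coeff_C_mul, comp_C_mul_X_coeff] at h3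
    rw [← h3]
    ring
  have hμT : ¬(p : ℤ) ∣ T.coeff μ := by
    intro hd
    have h1 : (T.map (Int.castRingHom (ZMod p))).coeff μ = 0 := by
      rw [coeff_map, eq_intCast]
      exact (ZMod.intCast_zmod_eq_zero_iff_dvd _ _).2 hd
    rw [hμ, rootMultiplicity_eq_natTrailingDegree, ← taylor_apply, hTmap] at h1
    exact hg (taylor_injective _ ((coeff_natTrailingDegree_eq_zero.1 h1).trans (map_zero _).symm))
  have hσ : σ ≤ μ + 1 := by
    by_contra! hlt
    obtain ⟨j, rfl⟩ := Nat.exists_eq_add_of_lt hlt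
    have h1 := hcoeff μ
    refine hμT ⟨p ^ j * (derivative h).coeff μ, mul_left_cancel₀ (pow_ne_zero (μ + 1) hp0) ?_⟩
    rw [h1]
    ring
  rw [natDegree_le_iff_coeff_eq_zero]
  intro k hk
  obtain ⟨j, hj⟩ := Nat.exists_eq_add_of_lt (show σ < k + 1 by lia)
  have h1 := hcoeff k
  have h2 : (derivative h).coeff k = p * (p ^ j * T.coeff k) := by
    refine mul_left_cancel₀ (pow_ne_zero σ hp0) ?_
    rw [← h1, hj]
    ring
  rw [derivative_map, coeff_map, eq_intCast, ZMod.intCast_zmod_eq_zero_iff_dvd]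
  exact ⟨_, h2⟩

lemma one_le_of_comp_eq {g h : ℤ[X]} {a c : ℤ} {σ : ℕ}
    (hh : 0 < (h.map (Int.castRingHom (ZMod p))).natDegree)
    (h_eq : g.comp (C a + C (p : ℤ) * X) = C c + C ((p : ℤ) ^ σ) * h) : 1 ≤ σ := by
  rw [Nat.one_le_iff_ne_zero]
  rintro rfl
  have h1 := congrArg (map (Int.castRingHom (ZMod p))) h_eq
  have h2 : h.map (Int.castRingHom (ZMod p)) =
      C ((g.map (Int.castRingHom (ZMod p))).eval (a : ZMod p) - c) := by
    rw [map_comp, pow_zero, C_1, one_mul, Polynomial.map_add, Polynomial.map_add,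
      Polynomial.map_mul, map_C, map_C, map_C] at h1
    rw [C_sub]
    refine eq_sub_of_add_eq' ?_
    rw [← comp_C]
    simpa using h1.symm
  rw [h2, natDegree_C] at hh
  exact hh.false

theorem hinf_mul_norm_mean_le {s d : ℕ} (hs : 0 < s) (hd : d < p) {B : ℝ} (hB1 : 1 ≤ B)
    (hB : (p : ℝ) ^ ((1 : ℝ) / s) * (d * √p) ≤ B * p) {n M : ℕ} (hn : 1 ≤ n) (hM : n ≤ M)
    {g : ℤ[X]} (hgd : g.natDegree ≤ d) (hg : 0 < (g.map (Int.castRingHom (ZMod p))).natDegree) :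
    (hinf s (padicScaled p n g) : ℝ) * ‖mean p M n g‖ ≤
      B * max 1 (derivative (g.map (Int.castRingHom (ZMod p)))).natDegree := by
  have hp0 : (0 : ℝ) < p := Nat.cast_pos.2 hp.out.pos
  induction n using Nat.strong_induction_on generalizing M g with
  | _ n ih =>
  obtain ⟨M, rfl⟩ := Nat.exists_eq_add_of_le' (hn.trans hM)
  set G := g.map (Int.castRingHom (ZMod p)) with hG
  have hGd : G.natDegree ≤ d := natDegree_map_le.trans hgd
  rcases hn.eq_or_lt with rfl | hn2
  · have h1 : (hinf s (padicScaled p 1 g) : ℝ) ≤ (p : ℝ) ^ ((1 : ℝ) / s) := by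
      have := NNReal.coe_le_coe.2 (hinf_padicScaled_le (p := p) hs 1 g)
      simpa using this
    have h2 : ‖mean p (M + 1) 1 g‖ ≤ (p : ℝ)⁻¹ * (d * √p) := by
      rw [mean_one_eq, norm_mul, norm_inv, Complex.norm_natCast]
      gcongr
      have hψ : (ZMod.stdAddChar : AddChar (ZMod p) ℂ) ≠ 1 := fun h =>
        one_ne_zero (ZMod.injective_stdAddChar (N := p) (a₁ := 1) (a₂ := 0) (by rw [h]; rfl))
      refine (norm_sum_le_mul_sqrt hψ hg (hGd.trans_lt hd)).trans ?_
      gcongr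
    calc
      _ ≤ (p : ℝ) ^ ((1 : ℝ) / s) * ((p : ℝ)⁻¹ * (d * √p)) := by gcongr
      _ = (p : ℝ)⁻¹ * ((p : ℝ) ^ ((1 : ℝ) / s) * (d * √p)) := by ring
      _ ≤ (p : ℝ)⁻¹ * (B * p) := by gcongr
      _ = B * 1 := by field_simp
      _ ≤ _ := by gcongr; exact Nat.one_le_cast.2 (le_max_left _ _)
  · have hG' : derivative G ≠ 0 := derivative_ne_zero_of_natDegree_lt (p := p) hg (hGd.trans_lt hd)
    have hterm : ∀ a : ℕ, (hinf s (padicScaled p n (g.comp (C (a : ℤ) + C (p : ℤ) * X))) : ℝ) *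
        ‖mean p M n (g.comp (C (a : ℤ) + C (p : ℤ) * X))‖ ≤
          B * (derivative G).rootMultiplicity (a : ZMod p) := fun a => by
      by_cases ha : (p : ℤ) ∣ g.derivative.eval (a : ℤ)
      · have hμ : 1 ≤ (derivative G).rootMultiplicity (a : ZMod p) := by
          rw [Nat.one_le_iff_ne_zero, ← Nat.pos_iff_ne_zero, rootMultiplicity_pos hG', IsRoot,
            hG, derivative_map]
          have := eval_intCast_map (Int.castRingHom (ZMod p)) (derivative g) a
          rw [Int.cast_natCast] at this
          rw [this, eq_intCast, ZMod.intCast_zmod_eq_zero_iff_dvd]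
          exact ha
        have hBμ : 1 ≤ B * (derivative G).rootMultiplicity (a : ZMod p) :=
          one_le_mul_of_one_le_of_one_le hB1 (mod_cast hμ)
        have hdeg : (g.comp (C (a : ℤ) + C (p : ℤ) * X)).natDegree = g.natDegree := by
          rw [natDegree_comp, natDegree_C_add, natDegree_C_mul_X _
            (Nat.cast_ne_zero.2 hp.out.ne_zero), mul_one]
        obtain ⟨c, σ, h, h_eq, hhd, hh⟩ :=
          exists_eq_C_add_C_pow_mul (p := p) (hdeg ▸ hg.trans_le natDegree_map_le)
        have hσ := one_le_of_comp_eq hh h_eq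
        have hμh := natDegree_derivative_map_le_rootMultiplicity hG' h_eq
        rw [Int.cast_natCast] at hμh
        rw [h_eq]
        rcases le_or_gt n σ with hnσ | hnσ
        · refine le_trans ?_ hBμ
          exact mul_le_one₀ (mod_cast hinf_padicScaled_C_add_le_one hs hnσ c h) (norm_nonneg _)
            (norm_mean_le_one _ _ _)
        · rw [norm_mean_C_add hnσ.le]
          calc
            _ ≤ (hinf s (padicScaled p (n - σ) h) : ℝ) * ‖mean p M (n - σ) h‖ := by
              gcongr
              exact hinf_padicScaled_C_add_le hs hnσ.le c h
            _ ≤ B * max 1 (derivative (h.map (Int.castRingHom (ZMod p)))).natDegree :=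
              ih (n - σ) (by lia) (by lia) (by lia) (hhd.trans (hdeg.trans_le hgd)) hh
            _ ≤ _ := by
              gcongr
              exact mod_cast max_le hμ hμh
      · rw [mean_comp_eq_zero hn2 hM ha, norm_zero, mul_zero]
        positivity
    calc
      _ ≤ (hinf s (padicScaled p n g) : ℝ) * ((p : ℝ)⁻¹ * ∑ a ∈ Finset.range p,
          ‖mean p M n (g.comp (C (a : ℤ) + C (p : ℤ) * X))‖) := by
        gcongr
        rw [mean_succ, norm_mul, norm_inv, Complex.norm_natCast]
        gcongr
        exact norm_sum_le _ _
      _ = ∑ a ∈ Finset.range p, (p : ℝ)⁻¹ * hinf s (padicScaled p n g) *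
          ‖mean p M n (g.comp (C (a : ℤ) + C (p : ℤ) * X))‖ := by
        rw [← Finset.mul_sum]
        ring
      _ ≤ ∑ a ∈ Finset.range p, B * (derivative G).rootMultiplicity (a : ZMod p) := by
        refine Finset.sum_le_sum fun a _ => le_trans ?_ (hterm a)
        gcongr
        rw [inv_mul_le_iff₀ hp0]
        exact mod_cast hinf_padicScaled_le_mul hs n g a
      _ = B * (∑ x, (derivative G).rootMultiplicity x : ℕ) := by
        rw [← sum_range_eq_sum_zmod, Nat.cast_sum, Finset.mul_sum]
      _ ≤ _ := by
        gcongr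
        exact mod_cast (sum_rootMultiplicity_le _).trans (le_max_right _ _)

theorem hinf_mul_norm_mean_self_le {s d : ℕ} (hs : 0 < s) (hd0 : 1 ≤ d) (hd : d < p) {B : ℝ}
    (hB1 : 1 ≤ B) (hB : (p : ℝ) ^ ((1 : ℝ) / s) * (d * √p) ≤ B * p) {f : ℤ[X]}
    (hf : f.natDegree = d) (m : ℕ) :
    (hinf s (padicScaled p m f) : ℝ) * ‖mean p m m f‖ ≤ B * d := by
  have hBd : 1 ≤ B * d := one_le_mul_of_one_le_of_one_le hB1 (mod_cast hd0)
  obtain ⟨c, σ, g, rfl, hgd, hg⟩ := exists_eq_C_add_C_pow_mul (p := p) (hf ▸ hd0)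
  rcases le_or_gt m σ with hmσ | hmσ
  · refine le_trans ?_ hBd
    exact mul_le_one₀ (mod_cast hinf_padicScaled_C_add_le_one hs hmσ c g) (norm_nonneg _)
      (norm_mean_le_one _ _ _)
  · rw [norm_mean_C_add hmσ.le]
    calc
      _ ≤ (hinf s (padicScaled p (m - σ) g) : ℝ) * ‖mean p m (m - σ) g‖ := by
        gcongr
        exact hinf_padicScaled_C_add_le hs hmσ.le c g
      _ ≤ B * max 1 (derivative (g.map (Int.castRingHom (ZMod p)))).natDegree :=
        hinf_mul_norm_mean_le hs hd hB1 hB (by lia) (by lia) (hgd.trans_eq hf) hg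
      _ ≤ _ := by
        gcongr
        refine mod_cast max_le hd0 ((natDegree_derivative_le _).trans ?_)
        exact (Nat.sub_le _ _).trans (natDegree_map_le.trans (hgd.trans_eq hf))

end Descent

end WeilBound

/-- For every `d ≥ 1` there is `C_d > 0` such that for every prime `p > d`, every `f ∈ ℤ[X]` of
degree `d` and every `m ≥ 1`, both `H_{p^{-m}f}·|S_m(f)| ≤ C_d·√p` and
`J_{p^{-m}f}·|S_m(f)| ≤ C_d`. -/
theorem exp_sum_H_and_J_bounds :
    ∀ d : ℕ, 1 ≤ d → ∃ C : ℝ, 0 < C ∧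
      ∀ (p : ℕ) [Fact p.Prime], d < p →
        ∀ f : Polynomial ℤ, f.natDegree = d →
          ∀ m : ℕ, 1 ≤ m →
            (Hinf (padicScaled p m f) : ℝ) * ‖expSum p m f‖ ≤ C * Real.sqrt p ∧
            (Jinf (padicScaled p m f) : ℝ) * ‖expSum p m f‖ ≤ C := by
  intro d hd
  refine ⟨d * d, by positivity, fun p _ hdp f hf m _ => ?_⟩
  have hp0 : (0 : ℝ) < p := Nat.cast_pos.2 (hd.trans_lt hdp |>.trans' one_pos)
  have hp1 : (1 : ℝ) ≤ √p := Real.one_le_sqrt.2 (mod_cast hd.trans hdp.le)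
  have hd1 : (1 : ℝ) ≤ d := mod_cast hd
  have hsq : √(p : ℝ) * √p = p := Real.mul_self_sqrt hp0.le
  constructor
  · have hB : (p : ℝ) ^ ((1 : ℝ) / (1 : ℕ)) * (d * √p) ≤ d * √p * p := by
      rw [Nat.cast_one, div_one, Real.rpow_one, mul_comm]
    exact (WeilBound.hinf_mul_norm_mean_self_le one_pos hd hdp
      (one_le_mul_of_one_le_of_one_le hd1 hp1) hB hf m).trans_eq (by ring)
  · have hB : (p : ℝ) ^ ((1 : ℝ) / (2 : ℕ)) * (d * √p) ≤ d * p := by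
      rw [Nat.cast_ofNat, ← Real.sqrt_eq_rpow, mul_left_comm, hsq]
    exact WeilBound.hinf_mul_norm_mean_self_le two_pos hd hdp hd1 hB hf m
end
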